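/- If G is a finite simple graph with at least one edge and chromatic number k, then the prime product number of G equals ⌈log₂(k)⌉ − 1 or ⌈log₂(k)⌉. -/

import Mathlib

/-- `L` is a `k`-prime product distance labeling of `G`: `L` is injective,
labels of distinct vertices differ by more than 1, and for every edge the
absolute difference of labels has at most `k` prime factors counted with
multiplicity. -/
def IsPrimeProductLabeling {V : Type*} (G : SimpleGraph V) (k : ℕ) (L : V → ℤ) : Prop :=
  Function.Injective L ∧
  (∀ u v : V, u ≠ v → 1 < |L u - L v|) ∧
  (∀ u v : V, G.Adj u v → (L u - L v).natAbs.primeFactorsList.length ≤ k)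

/-- `G` is a `k`-prime product graph. -/
def IsPrimeProductGraph {V : Type*} (G : SimpleGraph V) (k : ℕ) : Prop :=
  ∃ L : V → ℤ, IsPrimeProductLabeling G k L

/-- The prime product number of `G`: the least positive `k` such that `G` is a
`k`-prime product graph. -/
noncomputable def ppn {V : Type*} (G : SimpleGraph V) : ℕ :=
  sInf {k : ℕ | 0 < k ∧ IsPrimeProductGraph G k}

namespace PrimeProduct

open Finset Function
open scoped BigOperators

section Averages

variable {I X : Type} [Fintype I] [DecidableEq I] [Fintype X]

/-- Averaging over one overridden coordinate does not change an average. -/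
lemma expect_update (G : (I → X) → ℝ) (i : I) :
    𝔼 u, 𝔼 x : I → X, G (update x i u) = 𝔼 x, G x := by
  have key : 𝔼 p : X × (I → X), G (update p.2 i p.1) = 𝔼 p : X × (I → X), G p.2 := by
    let e : X × (I → X) ≃ X × (I → X) :=
      { toFun := fun p => (p.2 i, update p.2 i p.1)
        invFun := fun p => (p.2 i, update p.2 i p.1)
        left_inv := fun p => by simp
        right_inv := fun p => by simp }
    exact Fintype.expect_equiv e _ _ fun p => rfl
  rw [← univ_product_univ, expect_product, expect_product] at key
  rw [key]
  rcases isEmpty_or_nonempty X with h | h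
  · have : IsEmpty (I → X) := ⟨fun x => h.elim (x i)⟩
    simp
  · simp

lemma expect_update₂ (G : (I → X) → ℝ) (i j : I) :
    𝔼 u, 𝔼 v, 𝔼 x : I → X, G (update (update x i u) j v) = 𝔼 x, G x := by
  rw [expect_comm, ← expect_update G j]
  refine expect_congr rfl fun v _ => ?_
  exact expect_update (fun x => G (update x j v)) i

lemma expect_prod_univ_eq (w : I → X → ℝ) :
    𝔼 x : I → X, ∏ i, w i (x i) = ∏ i, 𝔼 u, w i u := by
  simp only [Fintype.expect_eq_sum_div_card, prod_div_distrib, prod_univ_sum,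
    Fintype.piFinset_univ, prod_const, card_univ, Fintype.card_fun, Nat.cast_pow]

lemma expect_prod_eq [Nonempty X] (S : Finset I) (w : I → X → ℝ) :
    𝔼 x : I → X, ∏ i ∈ S, w i (x i) = ∏ i ∈ S, 𝔼 u, w i u := by
  have h := expect_prod_univ_eq fun i u => if i ∈ S then w i u else 1
  have h1 : ∀ i, 𝔼 u : X, (if i ∈ S then w i u else 1) = if i ∈ S then 𝔼 u, w i u else 1 :=
    fun i => by split_ifs <;> simp [expect_const univ_nonempty]
  simpa only [h1, prod_ite_mem, univ_inter] using h

end Averages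

section ProdOn

variable {I X : Type}

/-- The product of the edge weights `f e` over the edges in `S` at the tuple `x`. -/
def prodOn (f : I × I → X → X → ℝ) (S : Finset (I × I)) (x : I → X) : ℝ :=
  ∏ e ∈ S, f e (x e.1) (x e.2)

lemma prodOn_nonneg {f : I × I → X → X → ℝ} {S : Finset (I × I)}
    (h : ∀ e ∈ S, ∀ x y, 0 ≤ f e x y) (x : I → X) : 0 ≤ prodOn f S x :=
  prod_nonneg fun e he => h e he _ _

lemma prodOn_le_prodOn {f g : I × I → X → X → ℝ} {S : Finset (I × I)}
    (h : ∀ e ∈ S, ∀ x y, 0 ≤ f e x y) (h' : ∀ e ∈ S, ∀ x y, f e x y ≤ g e x y) (x : I → X) :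
    prodOn f S x ≤ prodOn g S x :=
  prod_le_prod (fun e he => h e he _ _) fun e he => h' e he _ _

lemma prodOn_le_one {f : I × I → X → X → ℝ} {S : Finset (I × I)}
    (h : ∀ e ∈ S, ∀ x y, 0 ≤ f e x y) (h' : ∀ e ∈ S, ∀ x y, f e x y ≤ 1) (x : I → X) :
    prodOn f S x ≤ 1 :=
  prod_le_one (fun e he => h e he _ _) fun e he => h' e he _ _

end ProdOn

section Counting

variable {I X : Type} [LinearOrder I]

/-- The edges of `E` other than `e₀` that contain `i`. -/
def edgesAt (E : Finset (I × I)) (e₀ : I × I) (i : I) : Finset (I × I) :=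
  {e ∈ E.erase e₀ | e.1 = i ∨ e.2 = i}

/-- The edges of `E` that are disjoint from `e₀`. -/
def edgesAway (E : Finset (I × I)) (e₀ : I × I) : Finset (I × I) :=
  {e ∈ E | (e.1 ≠ e₀.1 ∧ e.2 ≠ e₀.1) ∧ e.1 ≠ e₀.2 ∧ e.2 ≠ e₀.2}

/-- `E` is a set of increasingly ordered pairs. -/
def Ordered (E : Finset (I × I)) : Prop := ∀ e ∈ E, e.1 < e.2

lemma erase_eq_union {E : Finset (I × I)} (e₀ : I × I) :
    E.erase e₀ = edgesAt E e₀ e₀.1 ∪ edgesAt E e₀ e₀.2 ∪ (edgesAway E e₀).erase e₀ := by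
  ext e
  simp only [edgesAt, edgesAway, mem_union, mem_filter, mem_erase]
  tauto

lemma edgesAt_disjoint {E : Finset (I × I)} (hE : Ordered E) {e₀ : I × I} (he₀ : e₀ ∈ E) :
    Disjoint (edgesAt E e₀ e₀.1) (edgesAt E e₀ e₀.2) := by
  rw [Finset.disjoint_left]
  intro e h1 h2
  simp only [edgesAt, mem_filter, mem_erase] at h1 h2
  have ha := hE e h1.1.2
  have hb := hE e₀ he₀
  apply h1.1.1
  rcases h1.2 with h | h <;> rcases h2.2 with h' | h'
  · exact absurd (h.symm.trans h') hb.ne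
  · exact Prod.ext h h'
  · rw [h, h'] at ha; exact absurd hb ha.not_gt
  · exact absurd (h.symm.trans h') hb.ne

lemma notMem_edgesAway {E : Finset (I × I)} (e₀ : I × I) : e₀ ∉ edgesAway E e₀ := by
  simp [edgesAway]

lemma prodOn_erase_split (f : I × I → X → X → ℝ) {E : Finset (I × I)} (hE : Ordered E)
    {e₀ : I × I} (he₀ : e₀ ∈ E) (x : I → X) (u v : X) :
    prodOn f (E.erase e₀) (update (update x e₀.1 u) e₀.2 v) =
      prodOn f (edgesAt E e₀ e₀.1) (update x e₀.1 u) *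
        prodOn f (edgesAt E e₀ e₀.2) (update x e₀.2 v) * prodOn f (edgesAway E e₀) x := by
  have hlt := hE e₀ he₀
  have hdis := edgesAt_disjoint hE he₀
  have hdis' : Disjoint (edgesAt E e₀ e₀.1 ∪ edgesAt E e₀ e₀.2) (edgesAway E e₀) := by
    rw [Finset.disjoint_left]
    intro e h1 h2
    simp only [edgesAt, edgesAway, mem_union, mem_filter, mem_erase] at h1 h2
    tauto
  unfold prodOn
  rw [erase_eq_union, erase_eq_of_notMem (notMem_edgesAway e₀), prod_union hdis', prod_union hdis]
  congr 1
  · congr 1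
    · refine prod_congr rfl fun e he => ?_
      have h2 : e ∉ edgesAt E e₀ e₀.2 := Finset.disjoint_left.mp hdis he
      simp only [edgesAt, mem_filter, mem_erase] at he h2
      have h3 : e.1 ≠ e₀.2 := fun h => h2 ⟨he.1, Or.inl h⟩
      have h4 : e.2 ≠ e₀.2 := fun h => h2 ⟨he.1, Or.inr h⟩
      rw [update_of_ne h3, update_of_ne h4]
    · refine prod_congr rfl fun e he => ?_
      have h2 : e ∉ edgesAt E e₀ e₀.1 := Finset.disjoint_right.mp hdis he
      simp only [edgesAt, mem_filter, mem_erase] at he h2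
      have h3 : e.1 ≠ e₀.1 := fun h => h2 ⟨he.1, Or.inl h⟩
      have h4 : e.2 ≠ e₀.1 := fun h => h2 ⟨he.1, Or.inr h⟩
      rw [update_comm hlt.ne, update_of_ne h3, update_of_ne h4]
  · refine prod_congr rfl fun e he => ?_
    simp only [edgesAway, mem_filter] at he
    obtain ⟨-, ⟨h1, h2⟩, h3, h4⟩ := he
    rw [update_of_ne h3, update_of_ne h4, update_of_ne h1, update_of_ne h2]

/-- `g` has cut norm at most `ε`. -/
def CutLe [Fintype X] (g : X → X → ℝ) (ε : ℝ) : Prop :=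
  ∀ a b : X → ℝ, (∀ x, 0 ≤ a x ∧ a x ≤ 1) → (∀ x, 0 ≤ b x ∧ b x ≤ 1) →
    |𝔼 x, 𝔼 y, g x y * a x * b y| ≤ ε

variable [Fintype I] [Fintype X]

lemma expect_prodOn_eq (f : I × I → X → X → ℝ) {E : Finset (I × I)} (hE : Ordered E)
    {e₀ : I × I} (he₀ : e₀ ∈ E) (w : (I → X) → ℝ) :
    𝔼 x, prodOn f E x * w x = 𝔼 u, 𝔼 v, f e₀ u v *
      𝔼 x, prodOn f (E.erase e₀) (update (update x e₀.1 u) e₀.2 v) *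
        w (update (update x e₀.1 u) e₀.2 v) := by
  rw [← expect_update₂ _ e₀.1 e₀.2]
  refine expect_congr rfl fun u _ => expect_congr rfl fun v _ => ?_
  rw [mul_expect]
  refine expect_congr rfl fun x _ => ?_
  rw [prodOn, ← mul_prod_erase E _ he₀, prodOn, update_self,
    update_of_ne (hE e₀ he₀).ne, update_self]
  ring

/-- Changing the weight of a single edge, all other weights being bounded by one. -/
lemma abs_expect_prodOn_single_mul {E : Finset (I × I)} (hE : Ordered E) {e₀ : I × I} (he₀ : e₀ ∈ E)
    (f g : I × I → X → X → ℝ) (hfg : ∀ e ∈ E, e ≠ e₀ → f e = g e)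
    (hf : ∀ e ∈ E, e ≠ e₀ → ∀ x y, 0 ≤ f e x y ∧ f e x y ≤ 1)
    (w : I → X → ℝ) (hw : ∀ i x, 0 ≤ w i x) {ε : ℝ}
    (hcut : ∀ a b : X → ℝ, (∀ x, 0 ≤ a x ∧ a x ≤ w e₀.1 x) → (∀ x, 0 ≤ b x ∧ b x ≤ w e₀.2 x) →
      |𝔼 x, 𝔼 y, (f e₀ x y - g e₀ x y) * a x * b y| ≤ ε * (𝔼 x, w e₀.1 x) * (𝔼 x, w e₀.2 x)) :
    |𝔼 x, prodOn f E x * ∏ i, w i (x i) - 𝔼 x, prodOn g E x * ∏ i, w i (x i)| ≤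
      ε * ∏ i, 𝔼 x, w i x := by
  have hlt := hE e₀ he₀
  rw [expect_prodOn_eq f hE he₀, expect_prodOn_eq g hE he₀]
  have hsame : ∀ x, prodOn g (E.erase e₀) x = prodOn f (E.erase e₀) x := fun x => by
    refine prod_congr rfl fun e he => ?_
    rw [hfg e (mem_of_mem_erase he) (ne_of_mem_erase he)]
  have hmem : ∀ i, ∀ e ∈ edgesAt E e₀ i, e ∈ E ∧ e ≠ e₀ := fun i e he => by
    simp only [edgesAt, mem_filter, mem_erase] at he; tauto
  have hmem' : ∀ e ∈ edgesAway E e₀, e ∈ E ∧ e ≠ e₀ := fun e he => by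
    refine ⟨?_, fun h => notMem_edgesAway e₀ (h ▸ he)⟩
    simp only [edgesAway, mem_filter] at he; tauto
  set A : X → (I → X) → ℝ := fun u x => prodOn f (edgesAt E e₀ e₀.1) (update x e₀.1 u) *
    w e₀.1 u with hA
  set B : X → (I → X) → ℝ := fun v x => prodOn f (edgesAt E e₀ e₀.2) (update x e₀.2 v) *
    w e₀.2 v with hB
  set C : (I → X) → ℝ := fun x => prodOn f (edgesAway E e₀) x *
    ∏ i ∈ (univ.erase e₀.1).erase e₀.2, w i (x i) with hC
  have hprod : ∀ x u v, ∏ i, w i (update (update x e₀.1 u) e₀.2 v i) =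
      w e₀.1 u * w e₀.2 v * ∏ i ∈ (univ.erase e₀.1).erase e₀.2, w i (x i) := fun x u v => by
    rw [← mul_prod_erase univ _ (mem_univ e₀.1),
      ← mul_prod_erase (univ.erase e₀.1) _ (mem_erase.2 ⟨hlt.ne', mem_univ e₀.2⟩),
      update_self, update_of_ne hlt.ne, update_self, mul_assoc]
    congr 2
    refine prod_congr rfl fun i hi => ?_
    simp only [mem_erase] at hi
    rw [update_of_ne hi.1, update_of_ne hi.2.1]
  have hABC : ∀ x u v, prodOn f (E.erase e₀) (update (update x e₀.1 u) e₀.2 v) *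
      ∏ i, w i (update (update x e₀.1 u) e₀.2 v i) = A u x * B v x * C x := fun x u v => by
    rw [prodOn_erase_split f hE he₀, hprod]
    simp only [hA, hB, hC]
    ring
  have hdiff : 𝔼 u, 𝔼 v, f e₀ u v * 𝔼 x, A u x * B v x * C x -
      𝔼 u, 𝔼 v, g e₀ u v * 𝔼 x, A u x * B v x * C x =
      𝔼 x, C x * 𝔼 u, 𝔼 v, (f e₀ u v - g e₀ u v) * A u x * B v x := by
    simp only [← expect_sub_distrib, mul_expect, ← sub_mul]
    conv_rhs => rw [expect_comm]
    refine expect_congr rfl fun u _ => ?_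
    conv_rhs => rw [expect_comm]
    refine expect_congr rfl fun v _ => expect_congr rfl fun x _ => ?_
    ring
  simp only [hsame, hABC]
  rw [hdiff]
  have h01 : ∀ S : Finset (I × I), (∀ e ∈ S, e ∈ E ∧ e ≠ e₀) → ∀ x,
      0 ≤ prodOn f S x ∧ prodOn f S x ≤ 1 := fun S hS x =>
    ⟨prodOn_nonneg (fun e he a b => (hf e (hS e he).1 (hS e he).2 a b).1) x,
      prodOn_le_one (fun e he a b => (hf e (hS e he).1 (hS e he).2 a b).1)
        (fun e he a b => (hf e (hS e he).1 (hS e he).2 a b).2) x⟩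
  have hCx : ∀ x, 0 ≤ C x ∧ C x ≤ ∏ i ∈ (univ.erase e₀.1).erase e₀.2, w i (x i) := fun x => by
    have h1 := h01 _ hmem' x
    have h2 : 0 ≤ ∏ i ∈ (univ.erase e₀.1).erase e₀.2, w i (x i) :=
      prod_nonneg fun i _ => hw i _
    exact ⟨mul_nonneg h1.1 h2, mul_le_of_le_one_left h2 h1.2⟩
  have hAx : ∀ x u, 0 ≤ A u x ∧ A u x ≤ w e₀.1 u := fun x u => by
    have h1 := h01 _ (hmem e₀.1) (update x e₀.1 u)
    exact ⟨mul_nonneg h1.1 (hw _ _), mul_le_of_le_one_left (hw _ _) h1.2⟩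
  have hBx : ∀ x u, 0 ≤ B u x ∧ B u x ≤ w e₀.2 u := fun x u => by
    have h1 := h01 _ (hmem e₀.2) (update x e₀.2 u)
    exact ⟨mul_nonneg h1.1 (hw _ _), mul_le_of_le_one_left (hw _ _) h1.2⟩
  rcases isEmpty_or_nonempty X with hX | hX
  · have : IsEmpty (I → X) := ⟨fun x => hX.elim (x e₀.1)⟩
    have h := prod_eq_zero (mem_univ e₀.1) (f := fun i => 𝔼 x, w i x) (by simp)
    rw [h]
    simp
  refine (abs_expect_le _ _).trans ?_
  calc 𝔼 x, |C x * 𝔼 u, 𝔼 v, (f e₀ u v - g e₀ u v) * A u x * B v x|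
      ≤ 𝔼 x : I → X, (∏ i ∈ (univ.erase e₀.1).erase e₀.2, w i (x i)) *
          (ε * (𝔼 x, w e₀.1 x) * (𝔼 x, w e₀.2 x)) := by
        refine expect_le_expect fun x _ => ?_
        have hc := hcut (fun u => A u x) (fun v => B v x) (hAx x) (hBx x)
        rw [abs_mul, abs_of_nonneg (hCx x).1]
        exact mul_le_mul (hCx x).2 hc (abs_nonneg _) ((hCx x).1.trans (hCx x).2)
    _ = ε * ∏ i, 𝔼 x, w i x := by
        rw [← expect_mul, expect_prod_eq, ← mul_prod_erase univ _ (mem_univ e₀.1),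
          ← mul_prod_erase (univ.erase e₀.1) _ (mem_erase.2 ⟨hlt.ne', mem_univ e₀.2⟩)]
        ring

lemma abs_expect_prodOn_single {E : Finset (I × I)} (hE : Ordered E) {e₀ : I × I} (he₀ : e₀ ∈ E)
    (f g : I × I → X → X → ℝ) (hfg : ∀ e ∈ E, e ≠ e₀ → f e = g e)
    (hf : ∀ e ∈ E, e ≠ e₀ → ∀ x y, 0 ≤ f e x y ∧ f e x y ≤ 1) {ε : ℝ}
    (hcut : CutLe (fun x y => f e₀ x y - g e₀ x y) ε) :
    |𝔼 x, prodOn f E x - 𝔼 x, prodOn g E x| ≤ ε := by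
  rcases isEmpty_or_nonempty X with hX | hX
  · have : IsEmpty (I → X) := ⟨fun x => hX.elim (x e₀.1)⟩
    have h := hcut 0 0 (by simp) (by simp)
    simpa using h
  have h := abs_expect_prodOn_single_mul hE he₀ f g hfg hf (fun _ _ => 1) (by simp) (ε := ε)
    (by simpa [expect_const univ_nonempty, CutLe] using hcut)
  simpa [expect_const univ_nonempty] using h

/-- Counting lemma for weights bounded by one. -/
lemma abs_expect_prodOn_sub_le_mul {E : Finset (I × I)} (hE : Ordered E)
    (f g : I × I → X → X → ℝ) (hf : ∀ e ∈ E, ∀ x y, 0 ≤ f e x y ∧ f e x y ≤ 1)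
    (hg : ∀ e ∈ E, ∀ x y, 0 ≤ g e x y ∧ g e x y ≤ 1)
    (w : I → X → ℝ) (hw : ∀ i x, 0 ≤ w i x) {ε : ℝ}
    (hcut : ∀ e ∈ E, ∀ a b : X → ℝ, (∀ x, 0 ≤ a x ∧ a x ≤ w e.1 x) →
      (∀ x, 0 ≤ b x ∧ b x ≤ w e.2 x) →
      |𝔼 x, 𝔼 y, (f e x y - g e x y) * a x * b y| ≤ ε * (𝔼 x, w e.1 x) * (𝔼 x, w e.2 x)) :
    |𝔼 x, prodOn f E x * ∏ i, w i (x i) - 𝔼 x, prodOn g E x * ∏ i, w i (x i)| ≤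
      #E * (ε * ∏ i, 𝔼 x, w i x) := by
  classical
  have main : ∀ T ⊆ E, |𝔼 x, prodOn (fun e => if e ∈ T then f e else g e) E x * ∏ i, w i (x i) -
      𝔼 x, prodOn g E x * ∏ i, w i (x i)| ≤ #T * (ε * ∏ i, 𝔼 x, w i x) := by
    intro T
    induction T using Finset.induction_on with
    | empty => simp
    | insert e₀ T he₀ ih =>
      intro hT
      have hT' := (subset_insert _ _).trans hT
      have he₀E := hT (mem_insert_self _ _)
      have step := abs_expect_prodOn_single_mul hE he₀E
        (fun e => if e ∈ insert e₀ T then f e else g e) (fun e => if e ∈ T then f e else g e)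
        (fun e _ hne => by simp [hne])
        (fun e he _ x y => by
          split_ifs
          · exact hf e he x y
          · exact hg e he x y) w hw (ε := ε) (by simpa [he₀] using hcut e₀ he₀E)
      rw [card_insert_of_notMem he₀]
      push_cast
      have := abs_sub_le (𝔼 x, prodOn (fun e => if e ∈ insert e₀ T then f e else g e) E x *
        ∏ i, w i (x i)) (𝔼 x, prodOn (fun e => if e ∈ T then f e else g e) E x * ∏ i, w i (x i))
        (𝔼 x, prodOn g E x * ∏ i, w i (x i))
      linarith [ih hT']
  have := main E Subset.rfl
  have hfE : ∀ x, prodOn (fun e => if e ∈ E then f e else g e) E x = prodOn f E x := fun x =>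
    prod_congr rfl fun e he => by simp [he]
  simpa only [hfE] using this

lemma abs_expect_prodOn_sub_le {E : Finset (I × I)} (hE : Ordered E)
    (f g : I × I → X → X → ℝ) (hf : ∀ e ∈ E, ∀ x y, 0 ≤ f e x y ∧ f e x y ≤ 1)
    (hg : ∀ e ∈ E, ∀ x y, 0 ≤ g e x y ∧ g e x y ≤ 1) {ε : ℝ} (hε : 0 ≤ ε)
    (hcut : ∀ e ∈ E, CutLe (fun x y => f e x y - g e x y) ε) :
    |𝔼 x, prodOn f E x - 𝔼 x, prodOn g E x| ≤ #E * ε := by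
  rcases isEmpty_or_nonempty X with hX | hX
  · rcases E.eq_empty_or_nonempty with rfl | ⟨e₀, he₀⟩
    · simp [prodOn]
    have : IsEmpty (I → X) := ⟨fun x => hX.elim (x e₀.1)⟩
    simpa using by positivity
  have h := abs_expect_prodOn_sub_le_mul hE f g hf hg (fun _ _ => 1) (by simp) (ε := ε)
    (by simpa [expect_const univ_nonempty, CutLe] using hcut)
  simpa [expect_const univ_nonempty] using h

end Counting

end PrimeProduct

namespace PrimeProduct

open Finset Function
open scoped BigOperators

section CauchySchwarz

lemma expect_prod_univ {α β : Type} [Fintype α] [Fintype β] (f : α × β → ℝ) :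
    𝔼 p, f p = 𝔼 a, 𝔼 b, f (a, b) := by
  rw [← univ_product_univ, expect_product]

lemma sq_expect_mul_le {T : Type} [Fintype T] {w wp : T → ℝ} (h : T → ℝ)
    (hw : ∀ t, 0 ≤ w t ∧ w t ≤ wp t) :
    (𝔼 t, w t * h t) ^ 2 ≤ (𝔼 t, wp t) * 𝔼 t, wp t * h t ^ 2 := by
  have hp : ∀ t, 0 ≤ wp t := fun t => (hw t).1.trans (hw t).2
  have h1 : |𝔼 t, w t * h t| ≤ 𝔼 t, √(wp t) * (√(wp t) * |h t|) := by
    refine (abs_expect_le _ _).trans (expect_le_expect fun t _ => ?_)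
    rw [abs_mul, abs_of_nonneg (hw t).1, ← mul_assoc, Real.mul_self_sqrt (hp t)]
    exact mul_le_mul_of_nonneg_right (hw t).2 (abs_nonneg _)
  have h2 := expect_mul_sq_le_sq_mul_sq univ (fun t => √(wp t)) fun t => √(wp t) * |h t|
  simp only [mul_pow, Real.sq_sqrt (hp _), sq_abs] at h2
  rw [← sq_abs]
  exact (pow_le_pow_left₀ (abs_nonneg _) h1 2).trans h2

lemma expect_box_le {X Y : Type} [Fintype X] [Fintype Y] (g : X → X → ℝ)
    (A Ap B Bp : X → Y → ℝ) (C Cp : Y → ℝ) (hA : ∀ u y, 0 ≤ A u y ∧ A u y ≤ Ap u y)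
    (hB : ∀ u y, 0 ≤ B u y ∧ B u y ≤ Bp u y) (hC : ∀ y, 0 ≤ C y ∧ C y ≤ Cp y) :
    (𝔼 y, 𝔼 u, 𝔼 v, g u v * (A u y * B v y * C y)) ^ 4 ≤
      (𝔼 y, 𝔼 v, Bp v y * Cp y) ^ 2 * (𝔼 y, 𝔼 u, 𝔼 u', Ap u y * Ap u' y * Cp y) *
        𝔼 y, 𝔼 u, 𝔼 u', 𝔼 v, 𝔼 v', g u v * g u' v * g u v' * g u' v' *
          (Ap u y * Ap u' y * (Bp v y * Bp v' y) * Cp y) := by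
  have hAp : ∀ u y, 0 ≤ Ap u y := fun u y => (hA u y).1.trans (hA u y).2
  have hBp : ∀ u y, 0 ≤ Bp u y := fun u y => (hB u y).1.trans (hB u y).2
  have hCp : ∀ y, 0 ≤ Cp y := fun y => (hC y).1.trans (hC y).2
  have h1 := sq_expect_mul_le (T := Y × X) (w := fun p => B p.2 p.1 * C p.1)
    (wp := fun p => Bp p.2 p.1 * Cp p.1) (fun p => 𝔼 u, g u p.2 * A u p.1)
    fun p => ⟨mul_nonneg (hB _ _).1 (hC _).1, mul_le_mul (hB _ _).2 (hC _).2 (hC _).1 (hBp _ _)⟩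
  have h2 := sq_expect_mul_le (T := Y × X × X) (w := fun p => A p.2.1 p.1 * A p.2.2 p.1 * Cp p.1)
    (wp := fun p => Ap p.2.1 p.1 * Ap p.2.2 p.1 * Cp p.1)
    (fun p => 𝔼 v, g p.2.1 v * g p.2.2 v * Bp v p.1)
    fun p => ⟨mul_nonneg (mul_nonneg (hA _ _).1 (hA _ _).1) (hCp _),
      mul_le_mul_of_nonneg_right (mul_le_mul (hA _ _).2 (hA _ _).2 (hA _ _).1 (hAp _ _)) (hCp _)⟩
  simp only [expect_prod_univ] at h1 h2
  set Q' := 𝔼 y, 𝔼 v, Bp v y * Cp y * (𝔼 u, g u v * A u y) ^ 2 with hQ'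
  have e1 : 𝔼 y, 𝔼 u, 𝔼 v, g u v * (A u y * B v y * C y) =
      𝔼 y, 𝔼 v, B v y * C y * 𝔼 u, g u v * A u y := by
    refine expect_congr rfl fun y _ => ?_
    rw [expect_comm]
    refine expect_congr rfl fun v _ => ?_
    rw [mul_expect]
    exact expect_congr rfl fun u _ => by ring
  have e2 : Q' = 𝔼 y, 𝔼 u, 𝔼 u', A u y * A u' y * Cp y * 𝔼 v, g u v * g u' v * Bp v y := by
    refine expect_congr rfl fun y _ => ?_
    simp only [sq, mul_expect, expect_mul]
    rw [expect_comm]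
    refine expect_congr rfl fun u _ => ?_
    rw [expect_comm]
    refine expect_congr rfl fun u' _ => expect_congr rfl fun v _ => ?_
    ring
  have e3 : 𝔼 y, 𝔼 u, 𝔼 u', Ap u y * Ap u' y * Cp y * (𝔼 v, g u v * g u' v * Bp v y) ^ 2 =
      𝔼 y, 𝔼 u, 𝔼 u', 𝔼 v, 𝔼 v', g u v * g u' v * g u v' * g u' v' *
          (Ap u y * Ap u' y * (Bp v y * Bp v' y) * Cp y) := by
    refine expect_congr rfl fun y _ => expect_congr rfl fun u _ => expect_congr rfl fun u' _ => ?_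
    simp only [sq, mul_expect, expect_mul]
    refine expect_congr rfl fun v _ => expect_congr rfl fun v' _ => ?_
    ring
  rw [e1, ← e3]
  rw [← e2] at h2
  have hM : 0 ≤ 𝔼 y, 𝔼 v, Bp v y * Cp y :=
    expect_nonneg fun y _ => expect_nonneg fun v _ => mul_nonneg (hBp _ _) (hCp _)
  have h3 := pow_le_pow_left₀ (sq_nonneg _) h1 2
  calc _ = ((𝔼 y, 𝔼 v, B v y * C y * 𝔼 u, g u v * A u y) ^ 2) ^ 2 := by ring
    _ ≤ _ := h3
    _ = (𝔼 y, 𝔼 v, Bp v y * Cp y) ^ 2 * Q' ^ 2 := by ring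
    _ ≤ _ := by
      rw [mul_assoc]
      exact mul_le_mul_of_nonneg_left h2 (sq_nonneg _)

end CauchySchwarz

end PrimeProduct

namespace PrimeProduct

open Finset Function
open scoped BigOperators

section LinearForms

variable {I X : Type}

/-- The product of the majorants `ν e` over doubled edges in `S`, where `(e, a, b)` stands for the
edge `e` with endpoints in the copies `a` and `b`. -/
def mon (ν : I × I → X → X → ℝ) (S : Finset ((I × I) × Bool × Bool)) (z : Bool × I → X) : ℝ :=
  ∏ s ∈ S, ν s.1 (z (s.2.1, s.1.1)) (z (s.2.2, s.1.2))

/-- The linear forms condition: averages of products of majorants over doubled edges are close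
to one. -/
def LFC [Fintype I] [DecidableEq I] [Fintype X] (E : Finset (I × I)) (ν : I × I → X → X → ℝ)
    (δ : ℝ) : Prop :=
  ∀ S : Finset ((I × I) × Bool × Bool), (∀ s ∈ S, s.1 ∈ E) → |𝔼 z, mon ν S z - 1| ≤ δ

lemma mon_union [DecidableEq I] (ν : I × I → X → X → ℝ) {S T : Finset ((I × I) × Bool × Bool)}
    (h : Disjoint S T) (z : Bool × I → X) : mon ν (S ∪ T) z = mon ν S z * mon ν T z :=
  prod_union h

lemma LFC.update_one [Fintype I] [DecidableEq I] [Fintype X] {E : Finset (I × I)}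
    {ν : I × I → X → X → ℝ} {δ : ℝ} (h : LFC E ν δ) (e₀ : I × I) :
    LFC E (update ν e₀ fun _ _ => 1) δ := by
  intro S hS
  have : ∀ z, mon (update ν e₀ fun _ _ => 1) S z = mon ν {s ∈ S | s.1 ≠ e₀} z := fun z => by
    unfold mon
    rw [prod_filter]
    refine prod_congr rfl fun s _ => ?_
    by_cases hs : s.1 = e₀ <;> simp [hs]
  simp only [this]
  exact h _ fun s hs => hS s (mem_filter.1 hs).1

/-- The doubled edges obtained from `S` by sending, for each copy `b`, the endpoint `i` to the copy
`φ b i`. -/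
def double [DecidableEq I] (S : Finset (I × I)) (φ : Bool → I → Bool) :
    Finset ((I × I) × Bool × Bool) :=
  (S ×ˢ univ).image fun p => (p.1, φ p.2 p.1.1, φ p.2 p.1.2)

lemma mem_double [DecidableEq I] {S : Finset (I × I)} {φ : Bool → I → Bool}
    {s : (I × I) × Bool × Bool} :
    s ∈ double S φ ↔ s.1 ∈ S ∧ ∃ b, φ b s.1.1 = s.2.1 ∧ φ b s.1.2 = s.2.2 := by
  simp only [double, mem_image, mem_product, mem_univ, and_true, Prod.exists]
  constructor
  · rintro ⟨i, j, b, h, rfl⟩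
    exact ⟨h, b, rfl, rfl⟩
  · rintro ⟨h, b, h1, h2⟩
    exact ⟨s.1.1, s.1.2, b, h, by rw [← Prod.mk.eta (p := s), ← Prod.mk.eta (p := s.2), ← h1, ← h2]⟩

lemma prod_prodOn_eq_mon [DecidableEq I] (ν : I × I → X → X → ℝ) (S : Finset (I × I))
    (φ : Bool → I → Bool) (hφ : ∀ e ∈ S, (∀ b, φ b e.1 = b) ∨ ∀ b, φ b e.2 = b)
    (z : Bool × I → X) (x : Bool → I → X)
    (h : ∀ b, ∀ e ∈ S, x b e.1 = z (φ b e.1, e.1) ∧ x b e.2 = z (φ b e.2, e.2)) :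
    ∏ b, prodOn ν S (x b) = mon ν (double S φ) z := by
  unfold mon double prodOn
  rw [prod_image, prod_product, prod_comm]
  · refine prod_congr rfl fun e he => prod_congr rfl fun b _ => ?_
    rw [(h b e he).1, (h b e he).2]
  · rintro ⟨e, b⟩ he ⟨e', b'⟩ he' heq
    simp only [Prod.mk.injEq] at heq
    obtain ⟨rfl, h1, h2⟩ := heq
    simp only [coe_product, Set.mem_prod, mem_coe] at he
    rcases hφ e he.1 with h | h
    · rw [h, h] at h1; rw [h1]
    · rw [h, h] at h2; rw [h2]

variable [Fintype I] [DecidableEq I] [Fintype X]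

lemma expect_update₄ (G : (Bool × I → X) → ℝ) (p q r s : Bool × I) :
    𝔼 y, 𝔼 u, 𝔼 u', 𝔼 v, 𝔼 v', G (update (update (update (update y p u) q u') r v) s v') =
      𝔼 z, G z := by
  rw [← expect_update₂ G r s, expect_comm]
  conv_rhs => enter [2, v]; rw [expect_comm]
  conv_rhs => rw [expect_comm]
  conv_rhs => rw [← expect_update₂ _ p q]
  refine expect_congr rfl fun u _ => ?_
  rw [expect_comm]

lemma expect_prod_sub_one_mul_mon {E : Finset (I × I)} {ν : I × I → X → X → ℝ} {δ : ℝ}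
    (h : LFC E ν δ) {e₀ : I × I} (he₀ : e₀ ∈ E) (S : Finset ((I × I) × Bool × Bool))
    (hS : ∀ s ∈ S, s.1 ∈ E ∧ s.1 ≠ e₀) :
    |𝔼 z, (∏ p : Bool × Bool, (ν e₀ (z (p.1, e₀.1)) (z (p.2, e₀.2)) - 1)) * mon ν S z| ≤
      16 * δ := by
  have hexp : ∀ z, (∏ p : Bool × Bool, (ν e₀ (z (p.1, e₀.1)) (z (p.2, e₀.2)) - 1)) * mon ν S z =
      ∑ T ∈ (univ : Finset (Bool × Bool)).powerset, (∏ _p ∈ univ \ T, (-1 : ℝ)) *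
        mon ν (T.image (fun p => (e₀, p)) ∪ S) z := fun z => by
    simp only [sub_eq_add_neg]
    rw [prod_add, sum_mul]
    refine sum_congr rfl fun T _ => ?_
    rw [mon_union]
    · have hm : mon ν (T.image fun p => (e₀, p)) z =
          ∏ p ∈ T, ν e₀ (z (p.1, e₀.1)) (z (p.2, e₀.2)) := by
        rw [mon, prod_image (by simp)]
      rw [hm]
      ring
    · rw [Finset.disjoint_left]
      intro s hs hs'
      obtain ⟨p, -, rfl⟩ := mem_image.1 hs
      exact (hS _ hs').2 rfl
  have hzero : ∑ T ∈ (univ : Finset (Bool × Bool)).powerset, (∏ _p ∈ univ \ T, (-1 : ℝ)) = 0 := by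
    have := prod_add (fun _ : Bool × Bool => (1 : ℝ)) (fun _ => -1) univ
    simpa using this.symm
  simp only [hexp]
  rw [expect_sum_comm]
  have : ∑ T ∈ (univ : Finset (Bool × Bool)).powerset, 𝔼 z, (∏ _p ∈ univ \ T, (-1 : ℝ)) *
      mon ν (T.image (fun p => (e₀, p)) ∪ S) z =
      ∑ T ∈ (univ : Finset (Bool × Bool)).powerset, (∏ _p ∈ univ \ T, (-1 : ℝ)) *
      (𝔼 z, mon ν (T.image (fun p => (e₀, p)) ∪ S) z - 1) := by
    simp only [mul_sub, sum_sub_distrib, mul_one, hzero, sub_zero, mul_expect]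
  rw [this]
  refine (abs_sum_le_sum_abs _ _).trans ?_
  have hb : ∀ T ∈ (univ : Finset (Bool × Bool)).powerset, |(∏ _p ∈ univ \ T, (-1 : ℝ)) *
      (𝔼 z, mon ν (T.image (fun p => (e₀, p)) ∪ S) z - 1)| ≤ δ := fun T _ => by
    rw [abs_mul, abs_prod]
    simp only [abs_neg, abs_one, prod_const_one, one_mul]
    refine h _ fun s hs => ?_
    rcases mem_union.1 hs with hs | hs
    · obtain ⟨p, -, rfl⟩ := mem_image.1 hs
      exact he₀
    · exact (hS s hs).1
  refine (sum_le_sum hb).trans ?_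
  simp

end LinearForms

end PrimeProduct

namespace PrimeProduct

open Finset Function
open scoped BigOperators

section Decorrelation

variable {I X : Type}

lemma expect_bool_prod [Fintype I] [DecidableEq I] [Fintype X] (G : Bool → (I → X) → ℝ) :
    𝔼 y : Bool × I → X, ∏ b, G b (fun i => y (b, i)) = ∏ b, 𝔼 x, G b x := by
  have h1 : 𝔼 y : Bool × I → X, ∏ b, G b (fun i => y (b, i)) =
      𝔼 p : (I → X) × (I → X), G true p.2 * G false p.1 := by
    refine Fintype.expect_equiv ((Equiv.curry Bool I X).trans (Equiv.boolArrowEquivProd _))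
      _ _ fun y => ?_
    rw [Fintype.prod_bool]
    rfl
  rw [h1, expect_prod_univ, Fintype.prod_bool]
  simp only [← mul_expect, ← expect_mul]

/-- The point of `Bool × I → X` obtained from `y` by overriding both copies of the coordinates
`i` and `j`. -/
def ovr [DecidableEq I] (i j : I) (y : Bool × I → X) (u₀ u₁ v₀ v₁ : X) : Bool × I → X :=
  update (update (update (update y (false, i) u₀) (true, i) u₁) (false, j) v₀) (true, j) v₁

/-- The copy map sending `i` to the copy `a` and everything else to the copy `b`. -/
def cop [DecidableEq I] (i : I) (a b : Bool) (k : I) : Bool := if k = i then a else b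

variable [LinearOrder I]

lemma ovr_left {i j : I} (hij : i ≠ j) (y : Bool × I → X) (u u' v v' : X) (a : Bool) :
    ovr i j y u u' v v' (a, i) = bif a then u' else u := by
  cases a <;> simp [ovr, hij]

lemma ovr_right {i j : I} (y : Bool × I → X) (u u' v v' : X) (a : Bool) :
    ovr i j y u u' v v' (a, j) = bif a then v' else v := by
  cases a <;> simp [ovr]

lemma ovr_other {i j k : I} (hi : k ≠ i) (hj : k ≠ j) (y : Bool × I → X) (u u' v v' : X)
    (a : Bool) : ovr i j y u u' v v' (a, k) = y (a, k) := by
  cases a <;> simp [ovr, hi, hj]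

variable {E : Finset (I × I)} {e₀ : I × I}

lemma mem_edgesAt_ne (hE : Ordered E) (he₀ : e₀ ∈ E) {e : I × I} :
    (e ∈ edgesAt E e₀ e₀.1 → e.1 ≠ e₀.2 ∧ e.2 ≠ e₀.2) ∧
      (e ∈ edgesAt E e₀ e₀.2 → e.1 ≠ e₀.1 ∧ e.2 ≠ e₀.1) := by
  have hdis := edgesAt_disjoint hE he₀
  constructor
  · intro he
    have h2 : e ∉ edgesAt E e₀ e₀.2 := Finset.disjoint_left.mp hdis he
    simp only [edgesAt, mem_filter, mem_erase] at he h2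
    tauto
  · intro he
    have h2 : e ∉ edgesAt E e₀ e₀.1 := Finset.disjoint_right.mp hdis he
    simp only [edgesAt, mem_filter, mem_erase] at he h2
    tauto

lemma cop_edgesAt (hE : Ordered E) (i : I) (a : Bool) {e : I × I}
    (he : e ∈ edgesAt E e₀ i) : (∀ b, cop i a b e.1 = b) ∨ ∀ b, cop i a b e.2 = b := by
  simp only [edgesAt, mem_filter, mem_erase] at he
  have := hE e he.1.2
  rcases he.2 with h | h
  · exact Or.inr fun b => by rw [cop, if_neg]; rintro rfl; exact this.ne h
  · exact Or.inl fun b => by rw [cop, if_neg]; rintro rfl; exact this.ne' h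

lemma at_left_eq_mon (ν : I × I → X → X → ℝ) (hE : Ordered E) (he₀ : e₀ ∈ E)
    (y : Bool × I → X) (u u' v v' : X) (a : Bool) :
    ∏ b, prodOn ν (edgesAt E e₀ e₀.1) (update (fun i => y (b, i)) e₀.1 (bif a then u' else u)) =
      mon ν (double (edgesAt E e₀ e₀.1) (cop e₀.1 a)) (ovr e₀.1 e₀.2 y u u' v v') := by
  refine prod_prodOn_eq_mon ν _ _ (fun e he => cop_edgesAt hE e₀.1 a he) _ _ fun b e he => ?_
  have key : ∀ k, k ≠ e₀.2 → update (fun i => y (b, i)) e₀.1 (bif a then u' else u) k =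
      ovr e₀.1 e₀.2 y u u' v v' (cop e₀.1 a b k, k) := fun k hk => by
    by_cases h : k = e₀.1
    · subst h; rw [update_self, cop, if_pos rfl, ovr_left (hE e₀ he₀).ne]
    · rw [update_of_ne h, cop, if_neg h, ovr_other h hk]
  have := (mem_edgesAt_ne hE he₀).1 he
  exact ⟨key _ this.1, key _ this.2⟩

lemma at_right_eq_mon (ν : I × I → X → X → ℝ) (hE : Ordered E) (he₀ : e₀ ∈ E)
    (y : Bool × I → X) (u u' v v' : X) (a : Bool) :
    ∏ b, prodOn ν (edgesAt E e₀ e₀.2) (update (fun i => y (b, i)) e₀.2 (bif a then v' else v)) =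
      mon ν (double (edgesAt E e₀ e₀.2) (cop e₀.2 a)) (ovr e₀.1 e₀.2 y u u' v v') := by
  refine prod_prodOn_eq_mon ν _ _ (fun e he => cop_edgesAt hE e₀.2 a he) _ _ fun b e he => ?_
  have key : ∀ k, k ≠ e₀.1 → update (fun i => y (b, i)) e₀.2 (bif a then v' else v) k =
      ovr e₀.1 e₀.2 y u u' v v' (cop e₀.2 a b k, k) := fun k hk => by
    by_cases h : k = e₀.2
    · subst h; rw [update_self, cop, if_pos rfl, ovr_right]
    · rw [update_of_ne h, cop, if_neg h, ovr_other hk h]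
  have := (mem_edgesAt_ne hE he₀).2 he
  exact ⟨key _ this.1, key _ this.2⟩

lemma away_eq_mon (ν : I × I → X → X → ℝ) (y : Bool × I → X) (u u' v v' : X) :
    ∏ b, prodOn ν (edgesAway E e₀) (fun i => y (b, i)) =
      mon ν (double (edgesAway E e₀) fun b _ => b) (ovr e₀.1 e₀.2 y u u' v v') := by
  refine prod_prodOn_eq_mon ν _ _ (fun e he => Or.inl fun b => rfl) _ _ fun b e he => ?_
  simp only [edgesAway, mem_filter] at he
  rw [ovr_other he.2.1.1 he.2.2.1, ovr_other he.2.1.2 he.2.2.2]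
  exact ⟨rfl, rfl⟩

lemma disjoint_double {S T : Finset (I × I)} (h : Disjoint S T) (φ ψ : Bool → I → Bool) :
    Disjoint (double S φ) (double T ψ) := by
  rw [Finset.disjoint_left]
  intro s hs hs'
  exact Finset.disjoint_left.1 h (mem_double.1 hs).1 (mem_double.1 hs').1

lemma disjoint_double_cop (i : I) :
    Disjoint (double (edgesAt E e₀ i) (cop i false)) (double (edgesAt E e₀ i) (cop i true)) := by
  rw [Finset.disjoint_left]
  intro s hs hs'
  obtain ⟨h, b, h1, h2⟩ := mem_double.1 hs
  obtain ⟨-, b', h1', h2'⟩ := mem_double.1 hs'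
  simp only [edgesAt, mem_filter] at h
  rcases h.2 with h | h
  · rw [cop, if_pos h] at h1 h1'
    exact Bool.false_ne_true (h1.trans h1'.symm)
  · rw [cop, if_pos h] at h2 h2'
    exact Bool.false_ne_true (h2.trans h2'.symm)

lemma disjoint_edgesAt_away (i : I) (hi : i = e₀.1 ∨ i = e₀.2) :
    Disjoint (edgesAt E e₀ i) (edgesAway E e₀) := by
  rw [Finset.disjoint_left]
  intro e h1 h2
  simp only [edgesAt, edgesAway, mem_filter] at h1 h2
  rcases hi with rfl | rfl <;> tauto

/-- The average of the product of all weights except that of `e₀`, with the endpoints of `e₀`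
prescribed. -/
noncomputable def marg [Fintype I] [Fintype X] (f : I × I → X → X → ℝ) (E : Finset (I × I))
    (e₀ : I × I) (u v : X) : ℝ :=
  𝔼 x, prodOn f (E.erase e₀) (update (update x e₀.1 u) e₀.2 v)

/-- The part of the doubled product involving the endpoint `i`. -/
def atProd (f : Bool → I × I → X → X → ℝ) (E : Finset (I × I)) (e₀ : I × I) (i : I) (u : X)
    (y : Bool × I → X) : ℝ :=
  ∏ b, prodOn (f b) (edgesAt E e₀ i) (update (fun k => y (b, k)) i u)

/-- The part of the doubled product not involving the endpoints of `e₀`. -/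
def awayProd (f : Bool → I × I → X → X → ℝ) (E : Finset (I × I)) (e₀ : I × I)
    (y : Bool × I → X) : ℝ :=
  ∏ b, prodOn (f b) (edgesAway E e₀) (fun k => y (b, k))

lemma prod_marg [Fintype I] [Fintype X] (f : Bool → I × I → X → X → ℝ) (hE : Ordered E)
    (he₀ : e₀ ∈ E) (u v : X) :
    ∏ b, marg (f b) E e₀ u v =
      𝔼 y, atProd f E e₀ e₀.1 u y * atProd f E e₀ e₀.2 v y * awayProd f E e₀ y := by
  unfold marg
  rw [← expect_bool_prod (fun b x => prodOn (f b) (E.erase e₀) (update (update x e₀.1 u) e₀.2 v))]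
  refine expect_congr rfl fun y _ => ?_
  simp only [prodOn_erase_split _ hE he₀, prod_mul_distrib]
  rfl

lemma atProd_mem {f g : Bool → I × I → X → X → ℝ}
    (hf : ∀ b, ∀ e ∈ E.erase e₀, ∀ x y, 0 ≤ f b e x y ∧ f b e x y ≤ g b e x y) (i : I) (u : X)
    (y : Bool × I → X) :
    0 ≤ atProd f E e₀ i u y ∧ atProd f E e₀ i u y ≤ atProd g E e₀ i u y := by
  have hm : ∀ e ∈ edgesAt E e₀ i, e ∈ E.erase e₀ := fun e he => (mem_filter.1 he).1
  exact ⟨prod_nonneg fun b _ => prodOn_nonneg (fun e he x y => (hf b e (hm e he) x y).1) _,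
    prod_le_prod (fun b _ => prodOn_nonneg (fun e he x y => (hf b e (hm e he) x y).1) _) fun b _ =>
      prodOn_le_prodOn (fun e he x y => (hf b e (hm e he) x y).1)
        (fun e he x y => (hf b e (hm e he) x y).2) _⟩

lemma awayProd_mem {f g : Bool → I × I → X → X → ℝ}
    (hf : ∀ b, ∀ e ∈ E.erase e₀, ∀ x y, 0 ≤ f b e x y ∧ f b e x y ≤ g b e x y)
    (y : Bool × I → X) :
    0 ≤ awayProd f E e₀ y ∧ awayProd f E e₀ y ≤ awayProd g E e₀ y := by
  have hm : ∀ e ∈ edgesAway E e₀, e ∈ E.erase e₀ := fun e he =>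
    mem_erase.2 ⟨fun h => notMem_edgesAway e₀ (h ▸ he), (mem_filter.1 he).1⟩
  exact ⟨prod_nonneg fun b _ => prodOn_nonneg (fun e he x y => (hf b e (hm e he) x y).1) _,
    prod_le_prod (fun b _ => prodOn_nonneg (fun e he x y => (hf b e (hm e he) x y).1) _) fun b _ =>
      prodOn_le_prodOn (fun e he x y => (hf b e (hm e he) x y).1)
        (fun e he x y => (hf b e (hm e he) x y).2) _⟩

lemma mem_erase_of_mem_double {i : I} {φ : Bool → I → Bool} {s : (I × I) × Bool × Bool}
    (hs : s ∈ double (edgesAt E e₀ i) φ) : s.1 ∈ E ∧ s.1 ≠ e₀ := by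
  have := (mem_filter.1 (mem_double.1 hs).1).1
  exact ⟨mem_of_mem_erase this, ne_of_mem_erase this⟩

lemma mem_erase_of_mem_double_away {φ : Bool → I → Bool} {s : (I × I) × Bool × Bool}
    (hs : s ∈ double (edgesAway E e₀) φ) : s.1 ∈ E ∧ s.1 ≠ e₀ := by
  have := (mem_double.1 hs).1
  exact ⟨(mem_filter.1 this).1, fun h => notMem_edgesAway e₀ (h ▸ this)⟩

variable [Fintype I] [Fintype X] {ν : I × I → X → X → ℝ} {δ : ℝ}

lemma abs_expect_right_away (h : LFC E ν δ) (hE : Ordered E) (he₀ : e₀ ∈ E) [Nonempty X] :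
    |𝔼 y, 𝔼 v, atProd (fun _ => ν) E e₀ e₀.2 v y * awayProd (fun _ => ν) E e₀ y - 1| ≤ δ := by
  have key := h (double (edgesAt E e₀ e₀.2) (cop e₀.2 false) ∪
    double (edgesAway E e₀) fun b _ => b) fun s hs => by
      rcases mem_union.1 hs with hs | hs
      · exact (mem_erase_of_mem_double hs).1
      · exact (mem_erase_of_mem_double_away hs).1
  rw [← expect_update₄ _ (false, e₀.1) (true, e₀.1) (false, e₀.2) (true, e₀.2)] at key
  simp only [mon_union ν (disjoint_double (disjoint_edgesAt_away (E := E) (e₀ := e₀) e₀.2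
    (Or.inr rfl)) _ _)] at key
  have e : ∀ y u u' v v', mon ν (double (edgesAt E e₀ e₀.2) (cop e₀.2 false))
      (update (update (update (update y (false, e₀.1) u) (true, e₀.1) u') (false, e₀.2) v)
        (true, e₀.2) v') * mon ν (double (edgesAway E e₀) fun b _ => b)
      (update (update (update (update y (false, e₀.1) u) (true, e₀.1) u') (false, e₀.2) v)
        (true, e₀.2) v') = atProd (fun _ => ν) E e₀ e₀.2 v y * awayProd (fun _ => ν) E e₀ y :=
    fun y u u' v v' => by
      have h1 := at_right_eq_mon ν hE he₀ y u u' v v' false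
      have h2 := away_eq_mon (E := E) (e₀ := e₀) ν y u u' v v'
      unfold ovr at h1 h2
      rw [← h1, ← h2]
      rfl
  simp only [e, expect_const univ_nonempty] at key
  exact key

lemma abs_expect_left_left_away (h : LFC E ν δ) (hE : Ordered E) (he₀ : e₀ ∈ E) [Nonempty X] :
    |𝔼 y, 𝔼 u, 𝔼 u', atProd (fun _ => ν) E e₀ e₀.1 u y * atProd (fun _ => ν) E e₀ e₀.1 u' y *
      awayProd (fun _ => ν) E e₀ y - 1| ≤ δ := by
  have key := h (double (edgesAt E e₀ e₀.1) (cop e₀.1 false) ∪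
    double (edgesAt E e₀ e₀.1) (cop e₀.1 true) ∪ double (edgesAway E e₀) fun b _ => b)
    fun s hs => by
      rcases mem_union.1 hs with hs | hs
      · rcases mem_union.1 hs with hs | hs
        · exact (mem_erase_of_mem_double hs).1
        · exact (mem_erase_of_mem_double hs).1
      · exact (mem_erase_of_mem_double_away hs).1
  rw [← expect_update₄ _ (false, e₀.1) (true, e₀.1) (false, e₀.2) (true, e₀.2)] at key
  have hd := disjoint_edgesAt_away (E := E) (e₀ := e₀) e₀.1 (Or.inl rfl)
  simp only [mon_union ν (disjoint_union_left.2 ⟨disjoint_double hd _ _, disjoint_double hd _ _⟩),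
    mon_union ν (disjoint_double_cop _)] at key
  have e : ∀ y u u' v v', mon ν (double (edgesAt E e₀ e₀.1) (cop e₀.1 false))
      (update (update (update (update y (false, e₀.1) u) (true, e₀.1) u') (false, e₀.2) v)
        (true, e₀.2) v') * mon ν (double (edgesAt E e₀ e₀.1) (cop e₀.1 true))
      (update (update (update (update y (false, e₀.1) u) (true, e₀.1) u') (false, e₀.2) v)
        (true, e₀.2) v') * mon ν (double (edgesAway E e₀) fun b _ => b)
      (update (update (update (update y (false, e₀.1) u) (true, e₀.1) u') (false, e₀.2) v)
        (true, e₀.2) v') = atProd (fun _ => ν) E e₀ e₀.1 u y *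
          atProd (fun _ => ν) E e₀ e₀.1 u' y * awayProd (fun _ => ν) E e₀ y :=
    fun y u u' v v' => by
      have h1 := at_left_eq_mon ν hE he₀ y u u' v v' false
      have h1' := at_left_eq_mon ν hE he₀ y u u' v v' true
      have h2 := away_eq_mon (E := E) (e₀ := e₀) ν y u u' v v'
      unfold ovr at h1 h1' h2
      rw [← h1, ← h1', ← h2]
      rfl
  simp only [e, expect_const univ_nonempty] at key
  exact key

lemma abs_expect_left_right_away (h : LFC E ν δ) (hE : Ordered E) (he₀ : e₀ ∈ E) [Nonempty X] :
    |𝔼 u, 𝔼 v, 𝔼 y, atProd (fun _ => ν) E e₀ e₀.1 u y * atProd (fun _ => ν) E e₀ e₀.2 v y *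
      awayProd (fun _ => ν) E e₀ y - 1| ≤ δ := by
  have key := h (double (edgesAt E e₀ e₀.1) (cop e₀.1 false) ∪
    double (edgesAt E e₀ e₀.2) (cop e₀.2 false) ∪ double (edgesAway E e₀) fun b _ => b)
    fun s hs => by
      rcases mem_union.1 hs with hs | hs
      · rcases mem_union.1 hs with hs | hs
        · exact (mem_erase_of_mem_double hs).1
        · exact (mem_erase_of_mem_double hs).1
      · exact (mem_erase_of_mem_double_away hs).1
  rw [← expect_update₄ _ (false, e₀.1) (true, e₀.1) (false, e₀.2) (true, e₀.2)] at key
  simp only [mon_union ν (disjoint_union_left.2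
    ⟨disjoint_double (disjoint_edgesAt_away (E := E) (e₀ := e₀) e₀.1 (Or.inl rfl)) _ _,
      disjoint_double (disjoint_edgesAt_away (E := E) (e₀ := e₀) e₀.2 (Or.inr rfl)) _ _⟩),
    mon_union ν (disjoint_double (edgesAt_disjoint hE he₀) _ _)] at key
  have e : ∀ y u u' v v', mon ν (double (edgesAt E e₀ e₀.1) (cop e₀.1 false))
      (update (update (update (update y (false, e₀.1) u) (true, e₀.1) u') (false, e₀.2) v)
        (true, e₀.2) v') * mon ν (double (edgesAt E e₀ e₀.2) (cop e₀.2 false))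
      (update (update (update (update y (false, e₀.1) u) (true, e₀.1) u') (false, e₀.2) v)
        (true, e₀.2) v') * mon ν (double (edgesAway E e₀) fun b _ => b)
      (update (update (update (update y (false, e₀.1) u) (true, e₀.1) u') (false, e₀.2) v)
        (true, e₀.2) v') = atProd (fun _ => ν) E e₀ e₀.1 u y *
          atProd (fun _ => ν) E e₀ e₀.2 v y * awayProd (fun _ => ν) E e₀ y :=
    fun y u u' v v' => by
      have h1 := at_left_eq_mon ν hE he₀ y u u' v v' false
      have h1' := at_right_eq_mon ν hE he₀ y u u' v v' false
      have h2 := away_eq_mon (E := E) (e₀ := e₀) ν y u u' v v'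
      unfold ovr at h1 h1' h2
      rw [← h1, ← h1', ← h2]
      rfl
  simp only [e, expect_const univ_nonempty] at key
  rw [expect_comm] at key
  refine Eq.trans_le ?_ key
  congr 2
  refine expect_congr rfl fun u _ => ?_
  rw [expect_comm]

lemma abs_expect_box (h : LFC E ν δ) (hE : Ordered E) (he₀ : e₀ ∈ E) :
    |𝔼 y, 𝔼 u, 𝔼 u', 𝔼 v, 𝔼 v',
      (ν e₀ u v - 1) * (ν e₀ u' v - 1) * (ν e₀ u v' - 1) * (ν e₀ u' v' - 1) *
      (atProd (fun _ => ν) E e₀ e₀.1 u y * atProd (fun _ => ν) E e₀ e₀.1 u' y *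
        (atProd (fun _ => ν) E e₀ e₀.2 v y * atProd (fun _ => ν) E e₀ e₀.2 v' y) *
        awayProd (fun _ => ν) E e₀ y)| ≤ 16 * δ := by
  have key := expect_prod_sub_one_mul_mon h he₀ (double (edgesAt E e₀ e₀.1) (cop e₀.1 false) ∪
    double (edgesAt E e₀ e₀.1) (cop e₀.1 true) ∪ (double (edgesAt E e₀ e₀.2) (cop e₀.2 false) ∪
    double (edgesAt E e₀ e₀.2) (cop e₀.2 true)) ∪ double (edgesAway E e₀) fun b _ => b)
    fun s hs => by
      simp only [mem_union] at hs
      rcases hs with ((hs | hs) | hs | hs) | hs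
      · exact mem_erase_of_mem_double hs
      · exact mem_erase_of_mem_double hs
      · exact mem_erase_of_mem_double hs
      · exact mem_erase_of_mem_double hs
      · exact mem_erase_of_mem_double_away hs
  rw [← expect_update₄ _ (false, e₀.1) (true, e₀.1) (false, e₀.2) (true, e₀.2)] at key
  have hd := disjoint_edgesAt_away (E := E) (e₀ := e₀) e₀.1 (Or.inl rfl)
  have hd' := disjoint_edgesAt_away (E := E) (e₀ := e₀) e₀.2 (Or.inr rfl)
  have hd'' := edgesAt_disjoint hE he₀
  refine Eq.trans_le ?_ key
  congr 1
  refine expect_congr rfl fun y _ => expect_congr rfl fun u _ => expect_congr rfl fun u' _ =>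
    expect_congr rfl fun v _ => expect_congr rfl fun v' _ => ?_
  have h1 := at_left_eq_mon ν hE he₀ y u u' v v' false
  have h2 := at_left_eq_mon ν hE he₀ y u u' v v' true
  have h3 := at_right_eq_mon ν hE he₀ y u u' v v' false
  have h4 := at_right_eq_mon ν hE he₀ y u u' v v' true
  have h5 := away_eq_mon (E := E) (e₀ := e₀) ν y u u' v v'
  have hl := ovr_left (hE e₀ he₀).ne y u u' v v'
  have hr := ovr_right (i := e₀.1) (j := e₀.2) y u u' v v'
  change _ = (∏ p : Bool × Bool, (ν e₀ (ovr e₀.1 e₀.2 y u u' v v' (p.1, e₀.1))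
    (ovr e₀.1 e₀.2 y u u' v v' (p.2, e₀.2)) - 1)) * mon ν _ (ovr e₀.1 e₀.2 y u u' v v')
  have d1 := disjoint_double_cop (E := E) (e₀ := e₀) e₀.1
  have d2 := disjoint_double_cop (E := E) (e₀ := e₀) e₀.2
  have d3 := disjoint_union_left.2 ⟨disjoint_union_right.2
      ⟨disjoint_double hd'' (cop e₀.1 false) (cop e₀.2 false),
        disjoint_double hd'' (cop e₀.1 false) (cop e₀.2 true)⟩, disjoint_union_right.2
      ⟨disjoint_double hd'' (cop e₀.1 true) (cop e₀.2 false),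
        disjoint_double hd'' (cop e₀.1 true) (cop e₀.2 true)⟩⟩
  have d4 := disjoint_union_left.2 ⟨disjoint_union_left.2
      ⟨disjoint_double hd (cop e₀.1 false) fun b _ => b,
        disjoint_double hd (cop e₀.1 true) fun b _ => b⟩, disjoint_union_left.2
      ⟨disjoint_double hd' (cop e₀.2 false) fun b _ => b,
        disjoint_double hd' (cop e₀.2 true) fun b _ => b⟩⟩
  rw [mon_union ν d4, mon_union ν d3, mon_union ν d1, mon_union ν d2, ← h1, ← h2, ← h3, ← h4, ← h5]
  simp only [hl, hr, Fintype.prod_prod_type, Fintype.prod_bool, cond_true, cond_false, atProd,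
    awayProd]
  ring

end Decorrelation

end PrimeProduct

namespace PrimeProduct

open Finset Function
open scoped BigOperators

section RelativeCounting

lemma abs_le_of_pow_four_le {x y : ℝ} (hy : 0 ≤ y) (h : x ^ 4 ≤ y ^ 4) : |x| ≤ y :=
  abs_le_of_sq_le_sq (by nlinarith [sq_nonneg x, sq_nonneg y]) hy

lemma abs_expect_sub_le_of_moments {P : Type} [Fintype P] (F G N ν f g : P → ℝ) {ε η : ℝ}
    (hη : 14 * η ≤ (ε / 2) ^ 2) (hε : 0 ≤ ε) (hF : ∀ p, 0 ≤ F p ∧ F p ≤ N p)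
    (hG : ∀ p, 0 ≤ G p ∧ G p ≤ 1) (hf : ∀ p, 0 ≤ f p ∧ f p ≤ ν p)
    (h1 : |𝔼 p, min (F p) 1 * F p - 𝔼 p, min (F p) 1 * G p| ≤ η)
    (h2 : |𝔼 p, G p * F p - 𝔼 p, G p * G p| ≤ η) (h3 : 𝔼 p, N p * |N p - 1| ≤ η)
    (h4 : |𝔼 p, (ν p - 1) * (F p * F p)| ≤ η) (h5 : |𝔼 p, (ν p - 1) * (F p * G p)| ≤ η)
    (h6 : |𝔼 p, (ν p - 1) * (G p * G p)| ≤ η) (h7 : 𝔼 p, ν p ≤ 2)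
    (h8 : |𝔼 p, f p * G p - 𝔼 p, g p * G p| ≤ ε / 2) :
    |𝔼 p, f p * F p - 𝔼 p, g p * G p| ≤ ε := by
  have hsq : 𝔼 p, (F p - G p) ^ 2 ≤ 3 * η := by
    have hpt : ∀ p, (F p - G p) ^ 2 ≤ (min (F p) 1 * F p - min (F p) 1 * G p) -
        (G p * F p - G p * G p) + N p * |N p - 1| := fun p => by
      obtain ⟨hF0, hFN⟩ := hF p
      obtain ⟨hG0, hG1⟩ := hG p
      rcases le_total (F p) 1 with h | h
      · rw [min_eq_left h]
        nlinarith [mul_nonneg (hF0.trans hFN) (abs_nonneg (N p - 1))]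
      · rw [min_eq_right h, abs_of_nonneg (by linarith)]
        nlinarith
    have := expect_le_expect (s := univ) fun p _ => hpt p
    simp only [expect_add_distrib, expect_sub_distrib] at this
    linarith [le_abs_self (𝔼 p, min (F p) 1 * F p - 𝔼 p, min (F p) 1 * G p),
      neg_abs_le (𝔼 p, G p * F p - 𝔼 p, G p * G p)]
  have hw : 𝔼 p, ν p * (F p - G p) ^ 2 ≤ 7 * η := by
    have e : ∀ p, ν p * (F p - G p) ^ 2 = (F p - G p) ^ 2 + (ν p - 1) * (F p * F p) -
        ((ν p - 1) * (F p * G p) + (ν p - 1) * (F p * G p)) + (ν p - 1) * (G p * G p) :=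
      fun p => by ring
    simp only [e, expect_add_distrib, expect_sub_distrib]
    linarith [le_abs_self (𝔼 p, (ν p - 1) * (F p * F p)),
      neg_abs_le (𝔼 p, (ν p - 1) * (F p * G p)), le_abs_self (𝔼 p, (ν p - 1) * (G p * G p))]
  have hcs := sq_expect_mul_le (fun p => F p - G p) hf
  have hν : ∀ p, 0 ≤ ν p := fun p => (hf p).1.trans (hf p).2
  have h0 : 0 ≤ 𝔼 p, ν p * (F p - G p) ^ 2 :=
    expect_nonneg fun p _ => mul_nonneg (hν p) (sq_nonneg _)
  have hd : |𝔼 p, f p * (F p - G p)| ≤ ε / 2 := by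
    refine abs_le_of_sq_le_sq ?_ (by linarith)
    calc _ ≤ _ := hcs
      _ ≤ 2 * (7 * η) := mul_le_mul h7 hw h0 (by norm_num)
      _ ≤ _ := by linarith
  simp only [mul_sub, expect_sub_distrib] at hd
  calc _ ≤ _ := abs_sub_le _ (𝔼 p, f p * G p) _
    _ ≤ ε := by linarith

variable {I X : Type} [LinearOrder I] [Fintype I] {E : Finset (I × I)} {e₀ : I × I}

section

variable [Fintype X] {ν : I × I → X → X → ℝ} {δ : ℝ}

lemma LFC.mono {δ' : ℝ} (h : LFC E ν δ) (hδ : δ ≤ δ') : LFC E ν δ' :=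
  fun S hS => (h S hS).trans hδ

lemma pow_four_expect_sub_one_mul_marg_le (h : LFC E ν δ) (hδ : δ ≤ 1) (hE : Ordered E)
    (he₀ : e₀ ∈ E) {c : Bool → I × I → X → X → ℝ}
    (hc : ∀ b, ∀ e ∈ E.erase e₀, ∀ x y, 0 ≤ c b e x y ∧ c b e x y ≤ ν e x y) :
    (𝔼 u, 𝔼 v, (ν e₀ u v - 1) * ∏ b, marg (c b) E e₀ u v) ^ 4 ≤ 128 * δ := by
  rcases isEmpty_or_nonempty X with hX | hX
  · simpa using (abs_nonneg _).trans (h ∅ (by simp))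
  have hδ0 : 0 ≤ δ := (abs_nonneg _).trans (h ∅ (by simp))
  have e1 : 𝔼 u, 𝔼 v, (ν e₀ u v - 1) * ∏ b, marg (c b) E e₀ u v = 𝔼 y, 𝔼 u, 𝔼 v,
      (ν e₀ u v - 1) * (atProd c E e₀ e₀.1 u y * atProd c E e₀ e₀.2 v y * awayProd c E e₀ y) := by
    simp only [prod_marg c hE he₀, mul_expect]
    conv_rhs => rw [expect_comm]
    refine expect_congr rfl fun u _ => ?_
    rw [expect_comm]
  rw [e1]
  have hν : ∀ b : Bool, ∀ e ∈ E.erase e₀, ∀ x y,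
      0 ≤ (fun _ : Bool => ν) b e x y ∧ (fun _ : Bool => ν) b e x y ≤ (fun _ : Bool => ν) b e x y :=
    fun b e he x y => ⟨(hc b e he x y).1.trans (hc b e he x y).2, le_rfl⟩
  refine (expect_box_le (fun u v => ν e₀ u v - 1) _ (atProd (fun _ => ν) E e₀ e₀.1) _
    (atProd (fun _ => ν) E e₀ e₀.2) _ (awayProd (fun _ => ν) E e₀)
    (atProd_mem hc e₀.1) (atProd_mem hc e₀.2) (awayProd_mem hc)).trans ?_
  have b1 := abs_le.1 (abs_expect_right_away h hE he₀)
  have b2 := abs_le.1 (abs_expect_left_left_away h hE he₀)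
  have b3 := abs_le.1 (abs_expect_box h hE he₀)
  have n1 : 0 ≤ 𝔼 y, 𝔼 v, atProd (fun _ => ν) E e₀ e₀.2 v y * awayProd (fun _ => ν) E e₀ y :=
    expect_nonneg fun y _ => expect_nonneg fun v _ =>
      mul_nonneg (atProd_mem hν _ _ _).1 (awayProd_mem hν _).1
  have n2 : 0 ≤ 𝔼 y, 𝔼 u, 𝔼 u', atProd (fun _ => ν) E e₀ e₀.1 u y *
      atProd (fun _ => ν) E e₀ e₀.1 u' y * awayProd (fun _ => ν) E e₀ y :=
    expect_nonneg fun y _ => expect_nonneg fun u _ => expect_nonneg fun u' _ =>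
      mul_nonneg (mul_nonneg (atProd_mem hν _ _ _).1 (atProd_mem hν _ _ _).1) (awayProd_mem hν _).1
  generalize (𝔼 y, 𝔼 v, atProd (fun _ => ν) E e₀ e₀.2 v y * awayProd (fun _ => ν) E e₀ y) = M1
    at *
  generalize (𝔼 y, 𝔼 u, 𝔼 u', atProd (fun _ => ν) E e₀ e₀.1 u y *
      atProd (fun _ => ν) E e₀ e₀.1 u' y * awayProd (fun _ => ν) E e₀ y) = M2 at *
  have m1 : M1 ^ 2 ≤ 2 ^ 2 := pow_le_pow_left₀ n1 (by linarith) 2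
  have m12 : M1 ^ 2 * M2 ≤ 2 ^ 2 * 2 := mul_le_mul m1 (by linarith) n2 (by norm_num)
  calc _ ≤ M1 ^ 2 * M2 * (16 * δ) := mul_le_mul_of_nonneg_left b3.2 (by positivity)
    _ ≤ 2 ^ 2 * 2 * (16 * δ) := mul_le_mul_of_nonneg_right m12 (by linarith)
    _ = 128 * δ := by ring

lemma cutLe_sub_one (h : LFC E ν δ) (hE : Ordered E) (he₀ : e₀ ∈ E) {ε : ℝ} (hε : 0 ≤ ε)
    (hδ : 16 * δ ≤ ε ^ 4) : CutLe (fun x y => ν e₀ x y - 1) ε := by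
  intro a b ha hb
  have hδ0 : 0 ≤ δ := (abs_nonneg _).trans (h ∅ (by simp))
  rcases isEmpty_or_nonempty X with hX | hX
  · simpa using hε
  refine abs_le_of_pow_four_le hε (le_trans ?_ hδ)
  have hbox := expect_box_le (Y := Unit) (fun u v => ν e₀ u v - 1) (fun u _ => a u) (fun _ _ => 1)
    (fun u _ => b u) (fun _ _ => 1) (fun _ => 1) (fun _ => 1) (fun u _ => ha u) (fun u _ => hb u)
    (by simp)
  simp only [expect_const univ_nonempty, mul_one, one_pow, one_mul] at hbox
  have key := expect_prod_sub_one_mul_mon h he₀ ∅ (by simp)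
  rw [← expect_update₄ _ (false, e₀.1) (true, e₀.1) (false, e₀.2) (true, e₀.2)] at key
  have e : ∀ y u u' v v', (∏ p : Bool × Bool, (ν e₀
      (update (update (update (update y (false, e₀.1) u) (true, e₀.1) u') (false, e₀.2) v)
        (true, e₀.2) v' (p.1, e₀.1))
      (update (update (update (update y (false, e₀.1) u) (true, e₀.1) u') (false, e₀.2) v)
        (true, e₀.2) v' (p.2, e₀.2)) - 1)) * mon ν ∅
      (update (update (update (update y (false, e₀.1) u) (true, e₀.1) u') (false, e₀.2) v)
        (true, e₀.2) v') =
      (ν e₀ u v - 1) * (ν e₀ u' v - 1) * (ν e₀ u v' - 1) * (ν e₀ u' v' - 1) :=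
    fun y u u' v v' => by
      have hl := ovr_left (hE e₀ he₀).ne y u u' v v'
      have hr := ovr_right (i := e₀.1) (j := e₀.2) y u u' v v'
      unfold ovr at hl hr
      simp only [hl, hr, Fintype.prod_prod_type, Fintype.prod_bool, cond_true, cond_false, mon,
        prod_empty]
      ring
  simp only [e, expect_const univ_nonempty] at key
  simp only [mul_assoc] at hbox key ⊢
  exact hbox.trans ((le_abs_self _).trans key)

lemma expect_prodOn_eq_marg (f : I × I → X → X → ℝ) (hE : Ordered E) (he₀ : e₀ ∈ E) :
    𝔼 x, prodOn f E x = 𝔼 u, 𝔼 v, f e₀ u v * marg f E e₀ u v := by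
  have := expect_prodOn_eq f hE he₀ fun _ => 1
  simp only [mul_one] at this
  exact this

lemma marg_congr {f g : I × I → X → X → ℝ} (h : ∀ e ∈ E, e ≠ e₀ → f e = g e) (u v : X) :
    marg f E e₀ u v = marg g E e₀ u v := by
  refine expect_congr rfl fun x _ => prod_congr rfl fun e he => ?_
  rw [h e (mem_of_mem_erase he) (ne_of_mem_erase he)]

lemma expect_prodOn_update (f : I × I → X → X → ℝ) (hE : Ordered E) (he₀ : e₀ ∈ E)
    (h : X → X → ℝ) :
    𝔼 x, prodOn (update f e₀ h) E x = 𝔼 u, 𝔼 v, h u v * marg f E e₀ u v := by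
  rw [expect_prodOn_eq_marg _ hE he₀]
  simp only [update_self]
  refine expect_congr rfl fun u _ => expect_congr rfl fun v _ => ?_
  rw [marg_congr (g := f) fun e _ he => update_of_ne he _ _]

lemma marg_moments [Nonempty X] (h : LFC E ν δ) (hE : Ordered E) (he₀ : e₀ ∈ E) :
    |𝔼 u, 𝔼 v, marg ν E e₀ u v - 1| ≤ δ ∧
      |𝔼 u, 𝔼 v, marg ν E e₀ u v * marg ν E e₀ u v - 1| ≤ δ := by
  constructor
  · have h1 := h.update_one e₀ (E.image fun e => (e, true, true)) fun s hs => by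
      obtain ⟨e, he, rfl⟩ := mem_image.1 hs
      exact he
    have h2 := expect_prodOn_update ν hE he₀ fun _ _ => 1
    simp only [one_mul] at h2
    rw [← h2]
    refine Eq.trans_le ?_ h1
    congr 2
    have e : ∀ z : Bool × I → X, mon (update ν e₀ fun _ _ => 1)
        (E.image fun e => (e, true, true)) z = ∏ b, (fun b x => if b = true then
          prodOn (update ν e₀ fun _ _ => 1) E x else 1) b fun i => z (b, i) := fun z => by
      rw [mon, prod_image (by simp), Fintype.prod_bool]
      simp [prodOn]
    refine (((expect_congr rfl fun z _ => e z).trans (expect_bool_prod fun b x =>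
      if b = true then prodOn (update ν e₀ fun _ _ => 1) E x else 1)).trans ?_).symm
    simp [expect_const univ_nonempty]
  · have h1 := abs_expect_left_right_away h hE he₀
    have h2 := prod_marg (E := E) (e₀ := e₀) (fun _ => ν) hE he₀
    simp only [← h2, Fintype.prod_bool] at h1
    exact h1

end

lemma CutLe.mono [Fintype X] {g : X → X → ℝ} {ε ε' : ℝ} (h : CutLe g ε) (hε : ε ≤ ε') :
    CutLe g ε' := fun a b ha hb => (h a b ha hb).trans hε

lemma exists_count_of_sparse (hE : Ordered E) (T : Finset (I × I)) : T ⊆ E → ∀ ε : ℝ, 0 < ε →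
    ∃ δ : ℝ, 0 < δ ∧ ∀ (X : Type) [Fintype X] (ν f g : I × I → X → X → ℝ),
      (∀ e ∈ E, e ∉ T → ν e = fun _ _ => 1) →
      (∀ e ∈ E, ∀ x y, 0 ≤ f e x y ∧ f e x y ≤ ν e x y) →
      (∀ e ∈ E, ∀ x y, 0 ≤ g e x y ∧ g e x y ≤ ν e x y) →
      (∀ e ∈ E, ∀ x y, g e x y ≤ 1) →
      LFC E ν δ → (∀ e ∈ E, CutLe (fun x y => f e x y - g e x y) δ) →
      |𝔼 x, prodOn f E x - 𝔼 x, prodOn g E x| ≤ ε := by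
  induction T using Finset.induction_on with
  | empty =>
    intro _ ε hε
    refine ⟨ε / (#E + 1), by positivity, fun X _ ν f g hν hf hg hg1 _ hcut => ?_⟩
    have h := abs_expect_prodOn_sub_le hE f g
      (fun e he x y => ⟨(hf e he x y).1, by simpa [hν e he (by simp)] using (hf e he x y).2⟩)
      (fun e he x y => ⟨(hg e he x y).1, hg1 e he x y⟩) (by positivity) hcut
    refine h.trans ?_
    rw [mul_div_assoc', div_le_iff₀ (by positivity)]
    nlinarith
  | insert e₀ T he₀T ih =>
    intro hT ε hε
    have he₀ : e₀ ∈ E := hT (mem_insert_self _ _)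
    set η := (ε / 2) ^ 2 / 14 with hη
    have hη0 : 0 < η := by positivity
    obtain ⟨δ₁, hδ₁, H⟩ := ih ((subset_insert _ _).trans hT) η hη0
    refine ⟨min (min δ₁ 1) (min (ε / 2) (min (η ^ 4 / 128) (η ^ 2 / 6))), by positivity, ?_⟩
    intro X _ ν f g hν hf hg hg1 hL hcut
    set δ := min (min δ₁ 1) (min (ε / 2) (min (η ^ 4 / 128) (η ^ 2 / 6))) with hδ
    have hδ1 : δ ≤ δ₁ := (min_le_left _ _).trans (min_le_left _ _)
    have hδ2 : δ ≤ 1 := (min_le_left _ _).trans (min_le_right _ _)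
    have hδ3 : δ ≤ ε / 2 := (min_le_right _ _).trans (min_le_left _ _)
    have hδ4 : δ ≤ η ^ 4 / 128 :=
      (min_le_right _ _).trans ((min_le_right _ _).trans (min_le_left _ _))
    have hδ5 : δ ≤ η ^ 2 / 6 :=
      (min_le_right _ _).trans ((min_le_right _ _).trans (min_le_right _ _))
    rcases isEmpty_or_nonempty X with hX | hX
    · have : IsEmpty (I → X) := ⟨fun x => hX.elim (x e₀.1)⟩
      simpa using hε.le
    have her : ∀ e ∈ E.erase e₀, e ∈ E := fun e he => mem_of_mem_erase he
    have hmono : ∀ (a b : I × I → X → X → ℝ), (∀ e ∈ E, ∀ x y, 0 ≤ a e x y ∧ a e x y ≤ b e x y) →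
        ∀ u v, 0 ≤ marg a E e₀ u v ∧ marg a E e₀ u v ≤ marg b E e₀ u v := fun a b hab u v =>
      ⟨expect_nonneg fun x _ => prodOn_nonneg (fun e he x y => (hab e (her e he) x y).1) _,
        expect_le_expect fun x _ => prodOn_le_prodOn (fun e he x y => (hab e (her e he) x y).1)
          (fun e he x y => (hab e (her e he) x y).2) _⟩
    have hF := hmono f ν hf
    have hG : ∀ u v, 0 ≤ marg g E e₀ u v ∧ marg g E e₀ u v ≤ 1 := fun u v =>
      ⟨(hmono g ν hg u v).1, expect_le univ_nonempty fun x _ =>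
        prodOn_le_one (fun e he x y => (hg e (her e he) x y).1)
          (fun e he x y => hg1 e (her e he) x y) _⟩
    have hswap : ∀ h : X → X → ℝ, (∀ u v, 0 ≤ h u v ∧ h u v ≤ 1) →
        |𝔼 u, 𝔼 v, h u v * marg f E e₀ u v - 𝔼 u, 𝔼 v, h u v * marg g E e₀ u v| ≤ η := by
      intro h hh
      rw [← expect_prodOn_update f hE he₀, ← expect_prodOn_update g hE he₀]
      refine H X (update ν e₀ fun _ _ => 1) _ _ (fun e he heT => ?_) (fun e he x y => ?_)
        (fun e he x y => ?_) (fun e he x y => ?_) ((hL.mono hδ1).update_one e₀) fun e he => ?_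
      · by_cases h' : e = e₀
        · rw [h', update_self]
        · rw [update_of_ne h', hν e he (by simp [h', heT])]
      all_goals by_cases h' : e = e₀
      · rw [h', update_self, update_self]; exact hh x y
      · rw [update_of_ne h', update_of_ne h']; exact hf e he x y
      · rw [h', update_self, update_self]; exact hh x y
      · rw [update_of_ne h', update_of_ne h']; exact hg e he x y
      · rw [h', update_self]; exact (hh x y).2
      · rw [update_of_ne h']; exact hg1 e he x y
      · rw [h', update_self, update_self]
        intro a b _ _
        simpa using hδ₁.le
      · rw [update_of_ne h', update_of_ne h']; exact (hcut e he).mono hδ1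
    have hdec : ∀ a b : I × I → X → X → ℝ, (∀ e ∈ E, ∀ x y, 0 ≤ a e x y ∧ a e x y ≤ ν e x y) →
        (∀ e ∈ E, ∀ x y, 0 ≤ b e x y ∧ b e x y ≤ ν e x y) →
        |𝔼 u, 𝔼 v, (ν e₀ u v - 1) * (marg a E e₀ u v * marg b E e₀ u v)| ≤ η := by
      intro a b ha hb
      refine abs_le_of_pow_four_le hη0.le ?_
      have := pow_four_expect_sub_one_mul_marg_le hL hδ2 hE he₀ (c := fun i => bif i then a else b)
        (fun i e he x y => by
          cases i
          · exact hb e (her e he) x y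
          · exact ha e (her e he) x y)
      simp only [Fintype.prod_bool, cond_true, cond_false] at this
      linarith
    obtain ⟨hm1, hm2⟩ := marg_moments hL hE he₀
    have hνe : |𝔼 u, 𝔼 v, ν e₀ u v - 1| ≤ δ := by
      have := hL {(e₀, false, false)} (by simpa using he₀)
      rw [← expect_update₂ _ (false, e₀.1) (false, e₀.2)] at this
      simpa [mon, (hE e₀ he₀).ne, expect_const univ_nonempty] using this
    have hlast : |𝔼 u, 𝔼 v, f e₀ u v * marg g E e₀ u v - 𝔼 u, 𝔼 v, g e₀ u v * marg g E e₀ u v| ≤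
        ε / 2 := by
      have h1 := abs_expect_prodOn_single hE he₀ (update g e₀ (f e₀)) g
        (fun e _ hne => update_of_ne hne _ _) (fun e he hne x y => by
          rw [update_of_ne hne]; exact ⟨(hg e he x y).1, hg1 e he x y⟩)
        (by rw [update_self]; exact hcut e₀ he₀)
      rw [expect_prodOn_update g hE he₀, expect_prodOn_eq_marg g hE he₀] at h1
      exact h1.trans hδ3
    rw [expect_prodOn_eq_marg f hE he₀, expect_prodOn_eq_marg g hE he₀]
    have hNN : 𝔼 u, 𝔼 v, marg ν E e₀ u v * |marg ν E e₀ u v - 1| ≤ η := by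
      have hcs := expect_mul_sq_le_sq_mul_sq univ (fun p : X × X => marg ν E e₀ p.1 p.2)
        fun p => |marg ν E e₀ p.1 p.2 - 1|
      have e1 : ∀ p : X × X, |marg ν E e₀ p.1 p.2 - 1| ^ 2 =
          marg ν E e₀ p.1 p.2 * marg ν E e₀ p.1 p.2 - (marg ν E e₀ p.1 p.2 + marg ν E e₀ p.1 p.2)
            + 1 := fun p => by rw [sq_abs]; ring
      simp only [e1, sq (marg ν E e₀ _ _), expect_add_distrib, expect_sub_distrib,
        expect_prod_univ, expect_const univ_nonempty] at hcs
      refine le_of_sq_le_sq (hcs.trans ?_) hη0.le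
      have hA := abs_le.1 hm1
      have hB := abs_le.1 hm2
      have hδ0 : 0 ≤ δ := (abs_nonneg _).trans hm1
      generalize (𝔼 u, 𝔼 v, marg ν E e₀ u v) = A at hA ⊢
      generalize (𝔼 u, 𝔼 v, marg ν E e₀ u v * marg ν E e₀ u v) = B at hB ⊢
      have h1 : B * (B - (A + A) + 1) ≤ B * (3 * δ) :=
        mul_le_mul_of_nonneg_left (by linarith) (by linarith)
      have h2 : B * (3 * δ) ≤ 2 * (3 * δ) := mul_le_mul_of_nonneg_right (by linarith) (by linarith)
      linarith
    have final := abs_expect_sub_le_of_moments (P := X × X) (fun p => marg f E e₀ p.1 p.2)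
      (fun p => marg g E e₀ p.1 p.2) (fun p => marg ν E e₀ p.1 p.2) (fun p => ν e₀ p.1 p.2)
      (fun p => f e₀ p.1 p.2) (fun p => g e₀ p.1 p.2) (ε := ε) (η := η) (by rw [hη]; linarith)
      hε.le (fun p => hF _ _) (fun p => hG _ _) (fun p => hf e₀ he₀ _ _)
    simp only [expect_prod_univ] at final
    refine final (hswap (fun u v => min (marg f E e₀ u v) 1) fun u v =>
      ⟨le_min (hF u v).1 zero_le_one, min_le_right _ _⟩) (hswap _ hG) hNN (hdec f f hf hf)
      (hdec f g hf hg) (hdec g g hg hg) ?_ hlast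
    linarith [(abs_le.1 hνe).2]

end RelativeCounting

end PrimeProduct

namespace PrimeProduct

open Finset Function
open scoped BigOperators

section RelativeCountingGeneral

variable {I X : Type} [LinearOrder I] [Fintype I] {E : Finset (I × I)}

lemma LFC.average_one [Fintype X] {ν : I × I → X → X → ℝ} {δ : ℝ} (h : LFC E ν δ) :
    LFC E (fun e x y => ν e x y / 2 + 1 / 2) δ := by
  intro S hS
  have hexp : ∀ z : Bool × I → X, mon (fun e x y => ν e x y / 2 + 1 / 2) S z =
      ∑ T ∈ S.powerset, (1 / 2 : ℝ) ^ #S * mon ν T z := fun z => by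
    unfold mon
    rw [prod_add]
    refine sum_congr rfl fun T hT => ?_
    rw [prod_div_distrib, prod_const, prod_const, ← card_sdiff_add_card_eq_card (mem_powerset.1 hT),
      pow_add, div_eq_mul_inv, ← one_div, ← one_div_pow]
    ring
  have hone : ∑ T ∈ S.powerset, (1 / 2 : ℝ) ^ #S * 1 = 1 := by
    rw [sum_const, card_powerset, nsmul_eq_mul, mul_one]
    push_cast
    rw [← mul_pow]
    norm_num
  simp only [hexp]
  rw [expect_sum_comm]
  nth_rewrite 2 [← hone]
  rw [← sum_sub_distrib]
  simp only [← mul_expect, ← mul_sub]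
  refine (abs_sum_le_sum_abs _ _).trans ?_
  calc ∑ T ∈ S.powerset, |(1 / 2 : ℝ) ^ #S * (𝔼 z, mon ν T z - 1)|
      ≤ ∑ T ∈ S.powerset, (1 / 2 : ℝ) ^ #S * 1 * δ := by
        refine sum_le_sum fun T hT => ?_
        rw [abs_mul, abs_of_nonneg (by positivity), mul_one]
        exact mul_le_mul_of_nonneg_left (h T fun s hs => hS s (mem_powerset.1 hT hs))
          (by positivity)
    _ = δ := by rw [← sum_mul, hone, one_mul]

/-- Relative counting lemma. -/
lemma exists_count (hE : Ordered E) {ε : ℝ} (hε : 0 < ε) :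
    ∃ δ : ℝ, 0 < δ ∧ ∀ (X : Type) [Fintype X] (ν f g : I × I → X → X → ℝ),
      (∀ e ∈ E, ∀ x y, 0 ≤ f e x y ∧ f e x y ≤ ν e x y) →
      (∀ e ∈ E, ∀ x y, 0 ≤ g e x y ∧ g e x y ≤ 1) →
      LFC E ν δ → (∀ e ∈ E, CutLe (fun x y => f e x y - g e x y) δ) →
      |𝔼 x, prodOn f E x - 𝔼 x, prodOn g E x| ≤ ε := by
  obtain ⟨δ, hδ, H⟩ := exists_count_of_sparse hE E Subset.rfl (ε * (1 / 2) ^ #E) (by positivity)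
  refine ⟨δ, hδ, fun X _ ν f g hf hg hL hcut => ?_⟩
  have h := H X (fun e x y => ν e x y / 2 + 1 / 2) (fun e x y => 1 / 2 * f e x y)
    (fun e x y => 1 / 2 * g e x y) (fun e he he' => absurd he he')
    (fun e he x y => ⟨by linarith [(hf e he x y).1], by linarith [(hf e he x y).2]⟩)
    (fun e he x y => ⟨by linarith [(hg e he x y).1],
      by linarith [(hg e he x y).2, (hf e he x y).1.trans (hf e he x y).2]⟩)
    (fun e he x y => by linarith [(hg e he x y).2]) hL.average_one fun e he a b ha hb => by
      have := hcut e he a b ha hb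
      have e1 : 𝔼 x, 𝔼 y, (1 / 2 * f e x y - 1 / 2 * g e x y) * a x * b y =
          1 / 2 * 𝔼 x, 𝔼 y, (f e x y - g e x y) * a x * b y := by
        simp only [mul_expect]
        exact expect_congr rfl fun x _ => expect_congr rfl fun y _ => by ring
      rw [e1, abs_mul, abs_of_pos (by norm_num : (0 : ℝ) < 1 / 2)]
      linarith [abs_nonneg (𝔼 x, 𝔼 y, (f e x y - g e x y) * a x * b y)]
  have hhalf : ∀ a : I × I → X → X → ℝ, ∀ x, prodOn (fun e x y => 1 / 2 * a e x y) E x =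
      (1 / 2) ^ #E * prodOn a E x := fun a x => by
    unfold prodOn
    rw [prod_mul_distrib, prod_const]
  simp only [hhalf, ← mul_expect, ← mul_sub] at h
  rw [abs_mul, abs_of_pos (by positivity : (0 : ℝ) < (1 / 2) ^ #E), mul_comm] at h
  exact le_of_mul_le_mul_right h (by positivity)

end RelativeCountingGeneral

end PrimeProduct

namespace PrimeProduct

open Finset Function
open scoped BigOperators

section DenseModel

/-- Projection of the real line onto the unit interval. -/
noncomputable def clamp (t : ℝ) : ℝ := max 0 (min t 1)

/-- The primitive of `clamp` vanishing at zero. -/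
noncomputable def clampPrim (t : ℝ) : ℝ := t * clamp t - clamp t ^ 2 / 2

lemma clamp_mem (t : ℝ) : 0 ≤ clamp t ∧ clamp t ≤ 1 :=
  ⟨le_max_left _ _, max_le zero_le_one (min_le_right _ _)⟩

lemma clamp_cases (t : ℝ) : (t ≤ 0 ∧ clamp t = 0) ∨ (0 ≤ t ∧ t ≤ 1 ∧ clamp t = t) ∨
    (1 ≤ t ∧ clamp t = 1) := by
  rcases le_total t 0 with h | h
  · exact Or.inl ⟨h, by rw [clamp, min_eq_left (by linarith), max_eq_left h]⟩
  · rcases le_total t 1 with h' | h'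
    · exact Or.inr (Or.inl ⟨h, h', by rw [clamp, min_eq_left h', max_eq_right h]⟩)
    · exact Or.inr (Or.inr ⟨h', by rw [clamp, min_eq_right h', max_eq_right zero_le_one]⟩)

lemma clampPrim_add_le (s d : ℝ) : clampPrim (s + d) ≤ clampPrim s + d * clamp s + d ^ 2 / 2 := by
  unfold clampPrim
  rcases clamp_cases s with ⟨h1, h⟩ | ⟨h1, h1', h⟩ | ⟨h1, h⟩ <;>
  rcases clamp_cases (s + d) with ⟨h2, h'⟩ | ⟨h2, h2', h'⟩ | ⟨h2, h'⟩ <;>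
  rw [h, h'] <;> nlinarith

lemma max_zero_le_clampPrim (s : ℝ) : max s 0 ≤ clampPrim s + 1 / 2 := by
  unfold clampPrim
  rcases clamp_cases s with ⟨h1, h⟩ | ⟨h1, h1', h⟩ | ⟨h1, h⟩ <;> rw [h] <;> apply max_le <;> nlinarith

variable {X : Type} [Fintype X]

lemma expect_le_of_binary {g : X → X → ℝ} {ε : ℝ}
    (h : ∀ a b : X → ℝ, (∀ x, a x = 0 ∨ a x = 1) → (∀ x, b x = 0 ∨ b x = 1) →
      𝔼 x, 𝔼 y, g x y * a x * b y ≤ ε) {a b : X → ℝ} (ha : ∀ x, 0 ≤ a x ∧ a x ≤ 1)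
    (hb : ∀ x, 0 ≤ b x ∧ b x ≤ 1) : 𝔼 x, 𝔼 y, g x y * a x * b y ≤ ε := by
  have key : ∀ c w : X → ℝ, (∀ x, 0 ≤ w x ∧ w x ≤ 1) →
      𝔼 x, c x * w x ≤ 𝔼 x, c x * (if 0 ≤ c x then 1 else 0) := fun c w hw =>
    expect_le_expect fun x _ => by
      split_ifs with hc
      · exact mul_le_mul_of_nonneg_left (hw x).2 hc
      · rw [mul_zero]
        exact mul_nonpos_of_nonpos_of_nonneg (not_le.1 hc).le (hw x).1
  set a' : X → ℝ := fun x => if 0 ≤ 𝔼 y, g x y * b y then 1 else 0 with ha'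
  have h1 : 𝔼 x, 𝔼 y, g x y * a x * b y ≤ 𝔼 x, 𝔼 y, g x y * a' x * b y := by
    have := key (fun x => 𝔼 y, g x y * b y) a ha
    simp only [expect_mul] at this
    simpa only [mul_right_comm] using this
  set b' : X → ℝ := fun y => if 0 ≤ 𝔼 x, g x y * a' x then 1 else 0 with hb'
  have h2 : 𝔼 x, 𝔼 y, g x y * a' x * b y ≤ 𝔼 x, 𝔼 y, g x y * a' x * b' y := by
    rw [expect_comm, expect_comm (f := fun x y => g x y * a' x * b' y)]
    have := key (fun y => 𝔼 x, g x y * a' x) b hb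
    simp only [expect_mul] at this
    exact this
  refine h1.trans (h2.trans (h a' b' (fun x => ?_) fun x => ?_))
  · simp only [ha']; split_ifs <;> simp
  · simp only [hb']; split_ifs <;> simp

lemma cutLe_of_binary {g : X → X → ℝ} {ε : ℝ}
    (h : ∀ a b : X → ℝ, (∀ x, a x = 0 ∨ a x = 1) → (∀ x, b x = 0 ∨ b x = 1) →
      |𝔼 x, 𝔼 y, g x y * a x * b y| ≤ ε) : CutLe g ε := by
  intro a b ha hb
  rw [abs_le']
  constructor
  · exact expect_le_of_binary (fun a b ha hb => (le_abs_self _).trans (h a b ha hb)) ha hb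
  · have := expect_le_of_binary (g := fun x y => -g x y) (ε := ε) (fun a b ha hb => by
      simp only [neg_mul, expect_neg_distrib]
      exact (neg_le_abs _).trans (h a b ha hb)) ha hb
    simpa only [neg_mul, expect_neg_distrib] using this

lemma expect_mul_step_le {g : X → X → ℝ} {δ : ℝ} (h : CutLe g δ) {P : Type} [Fintype P]
    [DecidableEq P] (p q : X → P) (s : P → P → ℝ) {C : ℝ} (hs : ∀ i j, 0 ≤ s i j ∧ s i j ≤ C) :
    |𝔼 x, 𝔼 y, g x y * s (p x) (q y)| ≤ Fintype.card P ^ 2 * (C * δ) := by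
  have e : ∀ x y, g x y * s (p x) (q y) = ∑ i, ∑ j, s i j *
      (g x y * (if p x = i then 1 else 0) * (if q y = j then 1 else 0)) := fun x y => by
    simp [mul_comm]
  have e2 : 𝔼 x, 𝔼 y, g x y * s (p x) (q y) = ∑ i, ∑ j, s i j * 𝔼 x, 𝔼 y,
      g x y * (if p x = i then 1 else 0) * (if q y = j then 1 else 0) := by
    simp only [e]
    simp only [expect_sum_comm, mul_expect]
  rw [e2]
  refine (abs_sum_le_sum_abs _ _).trans ?_
  calc ∑ i, |∑ j, s i j * 𝔼 x, 𝔼 y,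
        g x y * (if p x = i then 1 else 0) * (if q y = j then 1 else 0)|
      ≤ ∑ _i : P, ∑ _j : P, C * δ := by
        refine sum_le_sum fun i _ => (abs_sum_le_sum_abs _ _).trans (sum_le_sum fun j _ => ?_)
        rw [abs_mul, abs_of_nonneg (hs i j).1]
        exact mul_le_mul (hs i j).2 (h _ _ (fun x => by split_ifs <;> simp)
          fun x => by split_ifs <;> simp) (abs_nonneg _) ((hs i j).1.trans (hs i j).2)
    _ = _ := by simp [sq, mul_assoc]

/-- Dense model theorem. -/
lemma exists_dense_model {ε : ℝ} (hε : 0 < ε) : ∃ δ : ℝ, 0 < δ ∧ ∀ (X : Type) [Fintype X]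
    (ν f : X → X → ℝ), (∀ x y, 0 ≤ f x y ∧ f x y ≤ ν x y) → CutLe (fun x y => ν x y - 1) δ →
    ∃ g : X → X → ℝ, (∀ x y, 0 ≤ g x y ∧ g x y ≤ 1) ∧ CutLe (fun x y => f x y - g x y) ε := by
  obtain ⟨T, hT⟩ := exists_nat_gt (2 / ε ^ 2)
  have hT' : 2 < T * ε ^ 2 := by rwa [div_lt_iff₀ (by positivity)] at hT
  have hT0 : 0 < T := by
    rcases Nat.eq_zero_or_pos T with rfl | h
    · norm_num at hT'
    · exact h
  set M : ℝ := (Fintype.card (Fin T → Bool) : ℝ) ^ 2 * (T * ε) with hM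
  have hM0 : 0 < M := by positivity
  refine ⟨1 / (2 * M), by positivity, fun X _ ν f hf hcut => ?_⟩
  rcases isEmpty_or_nonempty X with hX | hX
  · exact ⟨0, by simp, fun a b _ _ => by simpa using hε.le⟩
  by_contra! hno
  have hviol : ∀ S : X → X → ℝ, ∃ (σ : ℝ) (a b : X → ℝ), |σ| = 1 ∧ (∀ x, a x = 0 ∨ a x = 1) ∧
      (∀ x, b x = 0 ∨ b x = 1) ∧
      ε ≤ 𝔼 x, 𝔼 y, (f x y - clamp (S x y)) * (σ * a x * b y) := by
    intro S
    have h1 := hno (fun x y => clamp (S x y)) fun x y => clamp_mem _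
    have h2 := mt cutLe_of_binary h1
    push Not at h2
    obtain ⟨a, b, ha, hb, hab⟩ := h2
    rcases lt_abs.1 hab with h | h
    · refine ⟨1, a, b, by simp, ha, hb, h.le.trans_eq ?_⟩
      exact expect_congr rfl fun x _ => expect_congr rfl fun y _ => by ring
    · refine ⟨-1, a, b, by simp, ha, hb, h.le.trans_eq ?_⟩
      rw [← expect_neg_distrib]
      refine expect_congr rfl fun x _ => ?_
      rw [← expect_neg_distrib]
      exact expect_congr rfl fun y _ => by ring
  choose σ a b hσ ha hb hv using hviol
  let S : ℕ → X → X → ℝ := fun t => Nat.rec (fun _ _ => 0)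
    (fun _ S x y => S x y + ε * (σ S * a S x * b S y)) t
  have hS0 : ∀ x y, S 0 x y = 0 := fun x y => rfl
  have hS : ∀ t x y, S (t + 1) x y = S t x y + ε * (σ (S t) * a (S t) x * b (S t) y) :=
    fun t x y => rfl
  have hφ : ∀ t x y, |σ (S t) * a (S t) x * b (S t) y| ≤ 1 := fun t x y => by
    rcases ha (S t) x with h | h <;> rcases hb (S t) y with h' | h' <;> rw [h, h'] <;>
      simp [hσ]
  have hinv : ∀ t : ℕ, 𝔼 x, 𝔼 y, clampPrim (S t x y) + t * (ε ^ 2 / 2) ≤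
      𝔼 x, 𝔼 y, f x y * S t x y := by
    intro t
    induction t with
    | zero => simp [hS0, clampPrim, clamp]
    | succ t ih =>
      have h1 : 𝔼 x, 𝔼 y, clampPrim (S (t + 1) x y) ≤ 𝔼 x, 𝔼 y, (clampPrim (S t x y) +
          ε * (clamp (S t x y) * (σ (S t) * a (S t) x * b (S t) y)) + ε ^ 2 / 2) := by
        refine expect_le_expect fun x _ => expect_le_expect fun y _ => ?_
        rw [hS]
        refine (clampPrim_add_le _ _).trans ?_
        have := (sq_le_one_iff_abs_le_one _).2 (hφ t x y)
        nlinarith [sq_nonneg ε]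
      have h2 : 𝔼 x, 𝔼 y, f x y * S (t + 1) x y = 𝔼 x, 𝔼 y, f x y * S t x y +
          ε * 𝔼 x, 𝔼 y, f x y * (σ (S t) * a (S t) x * b (S t) y) := by
        simp only [hS, mul_expect, ← expect_add_distrib]
        exact expect_congr rfl fun x _ => expect_congr rfl fun y _ => by ring
      have h3 := hv (S t)
      simp only [sub_mul, expect_sub_distrib] at h3
      simp only [expect_add_distrib, ← mul_expect, expect_const univ_nonempty] at h1
      rw [h2]
      push_cast
      nlinarith
  have habs : ∀ t x y, |S t x y| ≤ t * ε := by
    intro t x y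
    induction t with
    | zero => simp [hS0]
    | succ t ih =>
      rw [hS]
      refine (abs_add_le _ _).trans ?_
      rw [abs_mul, abs_of_pos hε]
      push_cast
      nlinarith [hφ t x y]
  have hstep : ∀ t, ∀ x y, S t x y = ∑ i ∈ range t, ε * (σ (S i) * a (S i) x * b (S i) y) := by
    intro t x y
    induction t with
    | zero => simp [hS0]
    | succ t ih => rw [hS, ih, sum_range_succ]
  set s : (Fin T → Bool) → (Fin T → Bool) → ℝ := fun α β => min (max
    (∑ i : Fin T, ε * (σ (S i) * (if α i then 1 else 0) * (if β i then 1 else 0))) 0) (T * ε) with hs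
  have hsS : ∀ x y, s (fun i => decide (a (S i) x = 1)) (fun i => decide (b (S i) y = 1)) =
      max (S T x y) 0 := fun x y => by
    have h1 : ∑ i : Fin T, ε * (σ (S i) * (if decide (a (S i) x = 1) = true then 1 else 0) *
        (if decide (b (S i) y = 1) = true then 1 else 0)) = S T x y := by
      rw [hstep, ← Fin.sum_univ_eq_sum_range fun i => ε * (σ (S i) * a (S i) x * b (S i) y)]
      refine sum_congr rfl fun i _ => ?_
      rcases ha (S i) x with h | h <;> rcases hb (S i) y with h' | h' <;> simp [h, h']
    simp only [hs]
    rw [h1, min_eq_left]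
    exact max_le ((le_abs_self _).trans (habs T x y)) (by positivity)
  have herr := expect_mul_step_le hcut (P := Fin T → Bool)
    (fun x (i : Fin T) => decide (a (S i) x = 1))
    (fun y (i : Fin T) => decide (b (S i) y = 1)) s (C := T * ε)
    (fun i j => ⟨le_min (le_max_right _ _) (by positivity), min_le_right _ _⟩)
  simp only [hsS] at herr
  have herr' : (Fintype.card (Fin T → Bool) : ℝ) ^ 2 * (T * ε * (1 / (2 * M))) = 1 / 2 := by
    have : (Fintype.card (Fin T → Bool) : ℝ) ^ 2 * (T * ε * (1 / (2 * M))) = M * (1 / (2 * M)) := by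
      rw [hM]; ring
    rw [this]
    field_simp
  rw [herr'] at herr
  have hup : 𝔼 x, 𝔼 y, f x y * S T x y ≤ 𝔼 x, 𝔼 y,
      ((ν x y - 1) * max (S T x y) 0 + (clampPrim (S T x y) + 1 / 2)) :=
    expect_le_expect fun x _ => expect_le_expect fun y _ => by
      have h1 : f x y * S T x y ≤ f x y * max (S T x y) 0 :=
        mul_le_mul_of_nonneg_left (le_max_left _ _) (hf x y).1
      have h2 : f x y * max (S T x y) 0 ≤ ν x y * max (S T x y) 0 :=
        mul_le_mul_of_nonneg_right (hf x y).2 (le_max_right _ _)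
      linarith [max_zero_le_clampPrim (S T x y)]
  simp only [expect_add_distrib, expect_const univ_nonempty] at hup
  have := hinv T
  linarith [(abs_le.1 herr).2]

end DenseModel

end PrimeProduct

namespace PrimeProduct

open Finset Function
open scoped BigOperators Classical

section DenseRemoval

variable {I X : Type} [LinearOrder I] [Fintype I] [Fintype X] {E : Finset (I × I)}

lemma sum_sum_ite_mem (S T : Finset X) (F : X → X → ℝ) :
    ∑ x, ∑ y, (if x ∈ S then (if y ∈ T then F x y else 0) else 0) = ∑ x ∈ S, ∑ y ∈ T, F x y := by
  have : ∀ x, ∑ y, (if x ∈ S then (if y ∈ T then F x y else 0) else 0) =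
      if x ∈ S then ∑ y ∈ T, F x y else 0 := fun x => by
    split_ifs
    · rw [sum_ite_mem, univ_inter]
    · simp
  simp only [this, sum_ite_mem, univ_inter]

lemma le_expect_of_regular (hE : Ordered E) {g : I × I → X → X → ℝ}
    (hg : ∀ e ∈ E, ∀ x y, 0 ≤ g e x y ∧ g e x y ≤ 1) {τ ε : ℝ} (hτ : 0 < τ)
    (A : I → Finset X) (d : I × I → ℝ) (hd : ∀ e ∈ E, τ ≤ d e ∧ d e ≤ 1)
    (hreg : ∀ e ∈ E, ∀ S ⊆ A e.1, ∀ T ⊆ A e.2,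
      |∑ x ∈ S, ∑ y ∈ T, ((if τ ≤ g e x y then 1 else 0) - d e)| ≤ ε * #(A e.1) * #(A e.2))
    (hε : #E * ε ≤ τ ^ #E / 2) :
    τ ^ #E * (τ ^ #E / 2) * ∏ i, ((#(A i) : ℝ) / Fintype.card X) ≤ 𝔼 x, prodOn g E x := by
  set f : I × I → X → X → ℝ := fun e x y => if τ ≤ g e x y then 1 else 0 with hf
  set w : I → X → ℝ := fun i x => if x ∈ A i then 1 else 0 with hw
  have hw0 : ∀ i x, 0 ≤ w i x := fun i x => by simp only [hw]; split_ifs <;> simp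
  have hw1 : ∀ i x, w i x ≤ 1 := fun i x => by simp only [hw]; split_ifs <;> simp
  have hwE : ∀ i, 𝔼 x, w i x = (#(A i) : ℝ) / Fintype.card X := fun i => by
    simp [hw, Fintype.expect_eq_sum_div_card]
  have hf0 : ∀ e x y, 0 ≤ f e x y ∧ f e x y ≤ 1 := fun e x y => by
    simp only [hf]; split_ifs <;> simp
  have h := abs_expect_prodOn_sub_le_mul hE f (fun e _ _ => d e) (fun e _ => hf0 e)
    (fun e he _ _ => ⟨hτ.le.trans (hd e he).1, (hd e he).2⟩) w hw0 (ε := ε) (by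
      intro e he a b ha hb
      have hc : CutLe (fun x y => (f e x y - d e) * w e.1 x * w e.2 y)
          (ε * (𝔼 x, w e.1 x) * (𝔼 x, w e.2 x)) := by
        refine cutLe_of_binary fun a b ha hb => ?_
        have hs : ∀ (i : I) (a : X → ℝ), (∀ x, a x = 0 ∨ a x = 1) → ∀ x, w i x * a x =
            if x ∈ {x ∈ A i | a x = 1} then 1 else 0 := fun i a ha x => by
          simp only [hw, mem_filter]
          rcases ha x with h | h <;> by_cases h' : x ∈ A i <;> simp [h, h']
        have h1 := hreg e he {x ∈ A e.1 | a x = 1} (filter_subset _ _)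
          {x ∈ A e.2 | b x = 1} (filter_subset _ _)
        have h2 : 𝔼 x, 𝔼 y, (f e x y - d e) * w e.1 x * w e.2 y * a x * b y =
            (∑ x ∈ {x ∈ A e.1 | a x = 1}, ∑ y ∈ {x ∈ A e.2 | b x = 1}, (f e x y - d e)) /
              (Fintype.card X * Fintype.card X) := by
          have : ∀ x y, (f e x y - d e) * w e.1 x * w e.2 y * a x * b y =
              if x ∈ {x ∈ A e.1 | a x = 1} then
                (if y ∈ {x ∈ A e.2 | b x = 1} then (f e x y - d e) else 0) else 0 := fun x y => by
            have h3 := hs e.1 a ha x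
            have h4 := hs e.2 b hb y
            calc _ = (f e x y - d e) * (w e.1 x * a x) * (w e.2 y * b y) := by ring
              _ = _ := by rw [h3, h4]; split_ifs <;> simp
          simp only [this, Fintype.expect_eq_sum_div_card, ← sum_div, div_div]
          congr 1
          exact sum_sum_ite_mem _ _ _
        rw [h2, abs_div, abs_of_nonneg (by positivity : (0 : ℝ) ≤ Fintype.card X * Fintype.card X),
          hwE, hwE]
        calc _ ≤ ε * #(A e.1) * #(A e.2) / (Fintype.card X * Fintype.card X) := by gcongr
          _ = _ := by ring
      have h1 := hc a b (fun x => ⟨(ha x).1, (ha x).2.trans (hw1 _ _)⟩)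
        fun x => ⟨(hb x).1, (hb x).2.trans (hw1 _ _)⟩
      have h2 : ∀ (i : I) (a : X → ℝ), (∀ x, 0 ≤ a x ∧ a x ≤ w i x) → ∀ x, w i x * a x = a x :=
        fun i a ha x => by
          have := ha x
          simp only [hw] at this ⊢
          split_ifs at this ⊢
          · simp
          · have : a x = 0 := le_antisymm this.2 this.1
            simp [this]
      convert h1 using 2
      refine expect_congr rfl fun x _ => expect_congr rfl fun y _ => ?_
      rw [← h2 _ a ha x, ← h2 _ b hb y]
      have h3 := h2 _ a ha x
      have h4 := h2 _ b hb y
      calc _ = (f e x y - d e) * (w e.1 x * a x) * (w e.2 y * b y) := by ring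
        _ = (f e x y - d e) * (w e.1 x * (w e.1 x * a x)) * (w e.2 y * (w e.2 y * b y)) := by
          rw [h3, h4, h3, h4]
        _ = _ := by ring)
  have hconst : 𝔼 x : I → X, prodOn (fun e _ _ => d e) E x * ∏ i, w i (x i) =
      (∏ e ∈ E, d e) * ∏ i, 𝔼 x, w i x := by
    unfold prodOn
    rw [← mul_expect, expect_prod_univ_eq]
  rw [hconst] at h
  have hP : 0 ≤ ∏ i, 𝔼 x, w i x := prod_nonneg fun i _ => expect_nonneg fun x _ => hw0 i x
  have hD : τ ^ #E ≤ ∏ e ∈ E, d e := by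
    rw [← prod_const]
    exact prod_le_prod (fun _ _ => hτ.le) fun e he => (hd e he).1
  have h1 : τ ^ #E / 2 * ∏ i, 𝔼 x, w i x ≤ 𝔼 x, prodOn f E x * ∏ i, w i (x i) := by
    have := (abs_le.1 h).1
    nlinarith
  simp only [← hwE]
  rw [mul_assoc]
  calc τ ^ #E * (τ ^ #E / 2 * ∏ i, 𝔼 x, w i x)
      ≤ τ ^ #E * 𝔼 x, prodOn f E x * ∏ i, w i (x i) := by gcongr
    _ ≤ 𝔼 x, prodOn g E x := by
      rw [mul_expect]
      refine expect_le_expect fun x _ => ?_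
      have e1 : τ ^ #E * prodOn f E x ≤ prodOn g E x := by
        unfold prodOn
        rw [← prod_const, ← prod_mul_distrib]
        refine prod_le_prod (fun e _ => mul_nonneg hτ.le (hf0 _ _ _).1) fun e he => ?_
        simp only [hf]
        split_ifs with h
        · simpa using h
        · simpa using (hg e he _ _).1
      have e2 : ∏ i, w i (x i) ≤ 1 := prod_le_one (fun i _ => hw0 _ _) fun i _ => hw1 _ _
      have e3 : 0 ≤ ∏ i, w i (x i) := prod_nonneg fun i _ => hw0 _ _
      have e4 : 0 ≤ prodOn g E x := prodOn_nonneg (fun e he x y => (hg e he x y).1) x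
      nlinarith

end DenseRemoval

end PrimeProduct

namespace PrimeProduct

open Finset Function
open scoped BigOperators Classical

section DenseRemoval

variable {I X : Type} [LinearOrder I] {E : Finset (I × I)}

/-- The multipartite graph whose edges are the pairs of large weight. -/
def weightGraph (E : Finset (I × I)) (hE : Ordered E) (g : I × I → X → X → ℝ) (τ : ℝ) :
    SimpleGraph (I × X) where
  Adj u v := ((u.1, v.1) ∈ E ∧ τ ≤ g (u.1, v.1) u.2 v.2) ∨
    ((v.1, u.1) ∈ E ∧ τ ≤ g (v.1, u.1) v.2 u.2)
  symm := ⟨fun _ _ h => h.symm⟩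
  loopless := ⟨fun u h => by
    rcases h with h | h <;> exact lt_irrefl _ (hE _ h.1)⟩

lemma sum_weight_eq_density (hE : Ordered E) (g : I × I → X → X → ℝ) (τ : ℝ) {e : I × I}
    (he : e ∈ E) (S T : Finset X) :
    ∑ x ∈ S, ∑ y ∈ T, (if τ ≤ g e x y then (1 : ℝ) else 0) =
      ((weightGraph E hE g τ).edgeDensity ({e.1} ×ˢ S) ({e.2} ×ˢ T) : ℝ) * #S * #T := by
  have h1 : (#((weightGraph E hE g τ).interedges ({e.1} ×ˢ S) ({e.2} ×ˢ T)) : ℝ) =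
      ∑ x ∈ S, ∑ y ∈ T, (if τ ≤ g e x y then (1 : ℝ) else 0) := by
    rw [SimpleGraph.interedges, Rel.interedges, card_filter]
    push_cast
    rw [sum_product, sum_product, sum_singleton]
    refine sum_congr rfl fun x _ => ?_
    rw [sum_product, sum_singleton]
    refine sum_congr rfl fun y _ => ?_
    have h2 : (e.2, e.1) ∉ E := fun h => lt_asymm (hE _ h) (hE _ he)
    simp [weightGraph, he, h2]
  rw [← h1, SimpleGraph.edgeDensity_def]
  rcases S.eq_empty_or_nonempty with rfl | hS
  · simp
  rcases T.eq_empty_or_nonempty with rfl | hT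
  · rw [h1]
    simp
  have h1 : (#S : ℝ) ≠ 0 := by simpa using hS.ne_empty
  have h2 : (#T : ℝ) ≠ 0 := by simpa using hT.ne_empty
  simp only [card_product, card_singleton, one_mul]
  push_cast
  field_simp

lemma sum_le_of_uniform (hE : Ordered E) (g : I × I → X → X → ℝ) {τ γ ε : ℝ} (hγ : 0 < γ)
    (hγ1 : γ ≤ 1) (hε : 0 < ε) {e : I × I} (he : e ∈ E) {U V : Finset (I × X)}
    (hUV : (weightGraph E hE g τ).IsUniform ε U V) {A B : Finset X} (hA : {e.1} ×ˢ A ⊆ U)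
    (hB : {e.2} ×ˢ B ⊆ V) (hA' : γ * #U ≤ #A) (hB' : γ * #V ≤ #B) {S T : Finset X} (hS : S ⊆ A)
    (hT : T ⊆ B) :
    |∑ x ∈ S, ∑ y ∈ T, ((if τ ≤ g e x y then (1 : ℝ) else 0) -
      ((weightGraph E hE g τ).edgeDensity ({e.1} ×ˢ A) ({e.2} ×ˢ B) : ℝ))| ≤
        3 * ε / γ * #A * #B := by
  set G := weightGraph E hE g τ
  set d : ℝ := (G.edgeDensity ({e.1} ×ˢ A) ({e.2} ×ˢ B) : ℝ) with hd
  have hd0 : 0 ≤ d := by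
    rw [hd]
    exact_mod_cast G.edgeDensity_nonneg _ _
  have hd1 : d ≤ 1 := by
    rw [hd]
    exact_mod_cast G.edgeDensity_le_one _ _
  have hs0 : (0 : ℝ) ≤ (G.edgeDensity ({e.1} ×ˢ S) ({e.2} ×ˢ T) : ℝ) := by
    exact_mod_cast G.edgeDensity_nonneg _ _
  have hs1 : (G.edgeDensity ({e.1} ×ˢ S) ({e.2} ×ˢ T) : ℝ) ≤ 1 := by
    exact_mod_cast G.edgeDensity_le_one _ _
  have hsum : ∑ x ∈ S, ∑ y ∈ T, ((if τ ≤ g e x y then (1 : ℝ) else 0) - d) =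
      ((G.edgeDensity ({e.1} ×ˢ S) ({e.2} ×ˢ T) : ℝ) - d) * (#S * #T) := by
    simp only [sum_sub_distrib, sum_const, nsmul_eq_mul]
    rw [sum_weight_eq_density hE g τ he]
    ring
  have hSA : (#S : ℝ) ≤ #A := by exact_mod_cast card_le_card hS
  have hTB : (#T : ℝ) ≤ #B := by exact_mod_cast card_le_card hT
  have hS0 : (0 : ℝ) ≤ #S := by positivity
  have hT0 : (0 : ℝ) ≤ #T := by positivity
  have hU0 : (0 : ℝ) ≤ #U := by positivity
  have hV0 : (0 : ℝ) ≤ #V := by positivity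
  rw [hsum, abs_mul, abs_of_nonneg (mul_nonneg hS0 hT0)]
  have habs : |(G.edgeDensity ({e.1} ×ˢ S) ({e.2} ×ˢ T) : ℝ) - d| ≤ 1 := by
    rw [abs_le]; constructor <;> linarith
  have hAB : (0 : ℝ) ≤ #A * #B := by positivity
  have hmono : ε * (#A * #B : ℝ) ≤ ε / γ * (#A * #B) := by
    gcongr
    rw [le_div_iff₀ hγ]
    nlinarith
  have hrw : 3 * ε / γ * #A * #B = 3 * (ε / γ * (#A * #B : ℝ)) := by ring
  rw [hrw]
  have hpos := mul_nonneg (div_pos hε hγ).le hAB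
  have hST : (0 : ℝ) ≤ #S * #T := mul_nonneg hS0 hT0
  by_cases h1 : #U * ε ≤ (#S : ℝ)
  · by_cases h2 : #V * ε ≤ (#T : ℝ)
    · have e1 := hUV ((product_subset_product_right hS).trans hA)
        ((product_subset_product_right hT).trans hB) (by simpa using h1) (by simpa using h2)
      have hA2 : #U * ε ≤ (#A : ℝ) := h1.trans hSA
      have hB2 : #V * ε ≤ (#B : ℝ) := h2.trans hTB
      have e2 := hUV hA hB (by simpa using hA2) (by simpa using hB2)
      have e3 : |(G.edgeDensity ({e.1} ×ˢ S) ({e.2} ×ˢ T) : ℝ) - d| ≤ 2 * ε := by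
        rw [abs_lt] at e1 e2
        rw [abs_le]
        constructor <;> linarith
      have h4 : (#S : ℝ) * #T ≤ #A * #B := mul_le_mul hSA hTB hT0 (hS0.trans hSA)
      have h5 := mul_le_mul e3 h4 hST (by linarith)
      linarith
    · have h3 : (#T : ℝ) ≤ ε / γ * #B := by
        rw [div_mul_eq_mul_div, le_div_iff₀ hγ]
        have := mul_le_mul_of_nonneg_left hB' hε.le
        have := mul_le_mul_of_nonneg_right (not_le.1 h2).le hγ.le
        linarith
      have h4 : (#S : ℝ) * #T ≤ #A * (ε / γ * #B) := mul_le_mul hSA h3 hT0 (hS0.trans hSA)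
      have h5 := mul_le_mul_of_nonneg_right habs hST
      linarith
  · have h3 : (#S : ℝ) ≤ ε / γ * #A := by
      rw [div_mul_eq_mul_div, le_div_iff₀ hγ]
      have := mul_le_mul_of_nonneg_left hA' hε.le
      have := mul_le_mul_of_nonneg_right (not_le.1 h1).le hγ.le
      linarith
    have h4 : (#S : ℝ) * #T ≤ ε / γ * #A * #B := mul_le_mul h3 hTB hT0 (hS0.trans h3)
    have h5 := mul_le_mul_of_nonneg_right habs hST
    linarith

end DenseRemoval

end PrimeProduct

namespace PrimeProduct

open Finset Function
open scoped BigOperators Classical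

section DenseRemoval

variable {I X : Type} [LinearOrder I] [Fintype X] {E : Finset (I × I)}

/-- The vertices of a set `U` in the `i`-th vertex class. -/
noncomputable def slice (U : Finset (I × X)) (i : I) : Finset X := {x | (i, x) ∈ U}

lemma mem_slice {U : Finset (I × X)} {i : I} {x : X} : x ∈ slice U i ↔ (i, x) ∈ U := by
  simp [slice]

lemma slice_subset (U : Finset (I × X)) (i : I) : {i} ×ˢ slice U i ⊆ U := by
  rintro ⟨j, x⟩ h
  simp only [mem_product, mem_singleton, mem_slice] at h
  rw [h.1]
  exact h.2

lemma card_slice_le (U : Finset (I × X)) (i : I) : #(slice U i) ≤ #U := by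
  simpa using card_le_card (slice_subset U i)

variable [Fintype I]

lemma sum_eq_sum_slice (P : Finpartition (univ : Finset (I × X))) (i : I)
    (φ : Finset (I × X) → X → ℝ) :
    ∑ x, φ (P.part (i, x)) x = ∑ U ∈ P.parts, ∑ x ∈ slice U i, φ U x := by
  rw [← sum_fiberwise_of_maps_to (s := univ) (t := P.parts) (g := fun x => P.part (i, x))
    (fun x _ => P.part_mem.2 (mem_univ _))]
  refine sum_congr rfl fun U hU => ?_
  have : ({x ∈ univ | P.part (i, x) = U} : Finset X) = slice U i := by
    ext x
    simp only [mem_filter, mem_univ, true_and, mem_slice]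
    exact ⟨fun h => h ▸ P.mem_part (mem_univ _), fun h => P.part_eq_of_mem hU h⟩
  rw [this]
  refine sum_congr rfl fun x hx => ?_
  rw [P.part_eq_of_mem hU (mem_slice.1 hx)]

/-- The pairs of cells that are useless for counting. -/
def BadPair (hE : Ordered E) (g : I × I → X → X → ℝ) (τ γ ε : ℝ) (e : I × I)
    (U V : Finset (I × X)) : Prop :=
  U = V ∨ (U ≠ V ∧ ¬(weightGraph E hE g τ).IsUniform ε U V) ∨ #(slice U e.1) < γ * #U ∨
    #(slice V e.2) < γ * #V ∨
    ((weightGraph E hE g τ).edgeDensity ({e.1} ×ˢ slice U e.1) ({e.2} ×ˢ slice V e.2) : ℝ) < τ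

lemma sum_small_slice_le (P : Finpartition (univ : Finset (I × X))) (i : I) {γ : ℝ}
    (hγ : 0 ≤ γ) :
    ∑ x, (if (#(slice (P.part (i, x)) i) : ℝ) < γ * #(P.part (i, x)) then (1 : ℝ) else 0) ≤
      γ * (Fintype.card I * Fintype.card X) := by
  rw [sum_eq_sum_slice P i fun U _ => if (#(slice U i) : ℝ) < γ * #U then (1 : ℝ) else 0]
  have h : ∑ U ∈ P.parts, (#U : ℝ) = Fintype.card I * Fintype.card X := by
    exact_mod_cast P.sum_card_parts.trans (by simp)
  rw [← h, mul_sum]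
  refine sum_le_sum fun U _ => ?_
  rw [sum_const, nsmul_eq_mul]
  split_ifs with h
  · simpa using h.le
  · rw [mul_zero]
    positivity

lemma sum_sparse_le (hE : Ordered E) (P : Finpartition (univ : Finset (I × X)))
    (g : I × I → X → X → ℝ) {τ : ℝ} (hτ : 0 ≤ τ) {e : I × I} (he : e ∈ E) :
    ∑ x, ∑ y, (if ((weightGraph E hE g τ).edgeDensity ({e.1} ×ˢ slice (P.part (e.1, x)) e.1)
      ({e.2} ×ˢ slice (P.part (e.2, y)) e.2) : ℝ) < τ then
        (if τ ≤ g e x y then (1 : ℝ) else 0) else 0) ≤ τ * (Fintype.card X * Fintype.card X) := by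
  set G := weightGraph E hE g τ with hG
  have hX : ∀ i, ∑ U ∈ P.parts, (#(slice U i) : ℝ) = Fintype.card X := fun i => by
    have := sum_eq_sum_slice P i fun _ _ => 1
    simpa using this.symm
  have h1 : ∀ x, ∑ y, (if (G.edgeDensity ({e.1} ×ˢ slice (P.part (e.1, x)) e.1)
      ({e.2} ×ˢ slice (P.part (e.2, y)) e.2) : ℝ) < τ then
        (if τ ≤ g e x y then (1 : ℝ) else 0) else 0) = ∑ V ∈ P.parts, ∑ y ∈ slice V e.2,
      (if (G.edgeDensity ({e.1} ×ˢ slice (P.part (e.1, x)) e.1)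
      ({e.2} ×ˢ slice V e.2) : ℝ) < τ then
        (if τ ≤ g e x y then (1 : ℝ) else 0) else 0) := fun x =>
    sum_eq_sum_slice P e.2 fun V y => (if (G.edgeDensity ({e.1} ×ˢ slice (P.part (e.1, x)) e.1)
      ({e.2} ×ˢ slice V e.2) : ℝ) < τ then
        (if τ ≤ g e x y then (1 : ℝ) else 0) else 0)
  simp only [h1]
  rw [sum_eq_sum_slice P e.1 fun U x => ∑ V ∈ P.parts, ∑ y ∈ slice V e.2,
      (if (G.edgeDensity ({e.1} ×ˢ slice U e.1) ({e.2} ×ˢ slice V e.2) : ℝ) < τ then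
        (if τ ≤ g e x y then (1 : ℝ) else 0) else 0)]
  calc _ = ∑ U ∈ P.parts, ∑ V ∈ P.parts, ∑ x ∈ slice U e.1, ∑ y ∈ slice V e.2,
      (if (G.edgeDensity ({e.1} ×ˢ slice U e.1) ({e.2} ×ˢ slice V e.2) : ℝ) < τ then
        (if τ ≤ g e x y then (1 : ℝ) else 0) else 0) :=
        sum_congr rfl fun U _ => sum_comm
    _ ≤ ∑ U ∈ P.parts, ∑ V ∈ P.parts, τ * (#(slice U e.1) * #(slice V e.2)) := by
        refine sum_le_sum fun U _ => sum_le_sum fun V _ => ?_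
        split_ifs with h
        · rw [sum_weight_eq_density hE g τ he, ← hG, mul_assoc]
          gcongr
        · simp only [sum_const_zero]
          positivity
    _ = _ := by
        simp only [← mul_sum, ← sum_mul, hX]

lemma mul_ite_or_le (p₁ p₂ p₃ p₄ p₅ : Prop) {p q : Prop} [Decidable p₁] [Decidable p₂]
    [Decidable p₃] [Decidable p₄] [Decidable p₅] [Decidable p] [Decidable q]
    (hq : q → p₁ ∨ p₂ ∨ p₃ ∨ p₄ ∨ p₅) {a τ : ℝ} (ha : 0 ≤ a) (ha' : a ≤ 1)
    (hτ : 0 ≤ τ) (h : ¬p → a ≤ τ) : a * (if q then 1 else 0) ≤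
      (if p₁ then 1 else 0) + (if p₂ then 1 else 0) + (if p₃ then 1 else 0) +
      (if p₄ then 1 else 0) + (τ + if p₅ then (if p then 1 else 0) else 0) := by
  have hle : a * (if q then 1 else 0) ≤ a := by split_ifs <;> linarith
  by_cases hq' : q
  · have := hq hq'
    by_cases h₁ : p₁ <;> by_cases h₂ : p₂ <;> by_cases h₃ : p₃ <;> by_cases h₄ : p₄ <;>
      by_cases h₅ : p₅ <;> by_cases h' : p <;> simp only [h₁, h₂, h₃, h₄, h₅, h', if_true,
        if_false, or_false] at this ⊢ <;> first | linarith | linarith [h h']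
  · rw [if_neg hq', mul_zero]
    have hn : ∀ (p : Prop) [Decidable p], (0 : ℝ) ≤ if p then 1 else 0 := fun p _ => by
      split_ifs <;> simp
    have n5 : (0 : ℝ) ≤ if p₅ then (if p then 1 else 0) else 0 := by split_ifs <;> simp
    linarith [hn p₁, hn p₂, hn p₃, hn p₄]

lemma expect_bad_le (hE : Ordered E) {g : I × I → X → X → ℝ}
    (hg : ∀ e ∈ E, ∀ x y, 0 ≤ g e x y ∧ g e x y ≤ 1) {τ γ ε : ℝ} (hτ : 0 ≤ τ) (hγ : 0 ≤ γ)
    (hε : 0 < ε)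
    (P : Finpartition (univ : Finset (I × X))) (hP : P.IsEquipartition)
    (hu : P.IsUniform (weightGraph E hE g τ) ε) {l : ℕ} (hl : 0 < l) (hlP : l ≤ #P.parts)
    (hPX : #P.parts ≤ Fintype.card I * Fintype.card X)
    {e : I × I} (he : e ∈ E) (hX : 0 < Fintype.card X) :
    𝔼 x, 𝔼 y, g e x y *
      (if BadPair hE g τ γ ε e (P.part (e.1, x)) (P.part (e.2, y)) then 1 else 0) ≤
      2 * (Fintype.card I : ℝ) / l + 4 * ε * Fintype.card I ^ 2 + 2 * γ * Fintype.card I +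
        2 * τ := by
  set G := weightGraph E hE g τ with hG
  have hX' : (0 : ℝ) < Fintype.card X := by exact_mod_cast hX
  have hpt : ∀ x y, g e x y *
      (if BadPair hE g τ γ ε e (P.part (e.1, x)) (P.part (e.2, y)) then 1 else 0) ≤
      (if P.part (e.1, x) = P.part (e.2, y) then 1 else 0) +
      (if P.part (e.1, x) ≠ P.part (e.2, y) ∧ ¬G.IsUniform ε (P.part (e.1, x)) (P.part (e.2, y))
        then 1 else 0) +
      (if (#(slice (P.part (e.1, x)) e.1) : ℝ) < γ * #(P.part (e.1, x)) then (1 : ℝ) else 0) +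
      (if (#(slice (P.part (e.2, y)) e.2) : ℝ) < γ * #(P.part (e.2, y)) then (1 : ℝ) else 0) +
      (τ + if ((weightGraph E hE g τ).edgeDensity ({e.1} ×ˢ slice (P.part (e.1, x)) e.1)
        ({e.2} ×ˢ slice (P.part (e.2, y)) e.2) : ℝ) < τ then
        (if τ ≤ g e x y then (1 : ℝ) else 0) else 0) := fun x y => by
    exact mul_ite_or_le _ _ _ _ _
      (q := BadPair hE g τ γ ε e (P.part (e.1, x)) (P.part (e.2, y))) (fun h => h)
      (hg e he x y).1 (hg e he x y).2 hτ fun h => (not_le.1 h).le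
  refine (expect_le_expect fun x _ => expect_le_expect fun y _ => hpt x y).trans ?_
  have hV : (#(univ : Finset (I × X)) : ℝ) = Fintype.card I * Fintype.card X := by simp
  have b1 : ∑ x, ∑ y, (if P.part (e.1, x) = P.part (e.2, y) then (1 : ℝ) else 0) ≤
      2 * Fintype.card I / l * (Fintype.card X * Fintype.card X) := by
    have : ∀ x, ∑ y, (if P.part (e.1, x) = P.part (e.2, y) then (1 : ℝ) else 0) ≤
        2 * Fintype.card I / l * Fintype.card X := fun x => by
      have c1 : ∑ y, (if P.part (e.1, x) = P.part (e.2, y) then (1 : ℝ) else 0) ≤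
          #(P.part (e.1, x)) := by
        rw [sum_boole]
        refine le_trans ?_ (Nat.cast_le.2 (card_slice_le (P.part (e.1, x)) e.2))
        refine Nat.cast_le.2 (card_le_card fun y hy => ?_)
        rw [mem_slice, (mem_filter.1 hy).2]
        exact P.mem_part (mem_univ _)
      have c2 := hP.card_part_le_average_add_one (P.part_mem.2 (mem_univ (e.1, x)))
      have c3 : 1 ≤ #(univ : Finset (I × X)) / #P.parts := by
        rw [Nat.one_le_div_iff (hl.trans_le hlP)]
        simpa using hPX
      have c4 : (#(P.part (e.1, x)) : ℝ) ≤ 2 * (Fintype.card I * Fintype.card X / l) := by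
        have d1 : (#(P.part (e.1, x)) : ℝ) ≤ ((2 * (#(univ : Finset (I × X)) / #P.parts) : ℕ) : ℝ) :=
          Nat.cast_le.2 (by omega)
        refine d1.trans ?_
        push_cast
        refine mul_le_mul_of_nonneg_left ?_ zero_le_two
        refine Nat.cast_div_le.trans ?_
        rw [hV]
        have : (0 : ℝ) < l := by exact_mod_cast hl
        gcongr
      refine c1.trans (c4.trans_eq (by ring))
    refine (sum_le_sum fun x _ => this x).trans_eq ?_
    rw [sum_const, card_univ, nsmul_eq_mul]
    ring
  have b2 : ∑ x, ∑ y, (if P.part (e.1, x) ≠ P.part (e.2, y) ∧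
      ¬G.IsUniform ε (P.part (e.1, x)) (P.part (e.2, y)) then (1 : ℝ) else 0) ≤
      4 * ε * Fintype.card I ^ 2 * (Fintype.card X * Fintype.card X) := by
    have hne : (univ : Finset (I × X)).Nonempty := by
      obtain ⟨x⟩ := Fintype.card_pos_iff.1 hX
      exact ⟨(e.1, x), mem_univ _⟩
    have c1 := hP.sum_nonUniforms_lt hne hε hu
    rw [hV] at c1
    have c2 : ∑ x, ∑ y, (if P.part (e.1, x) ≠ P.part (e.2, y) ∧
      ¬G.IsUniform ε (P.part (e.1, x)) (P.part (e.2, y)) then (1 : ℝ) else 0) =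
      #({p : X × X | P.part (e.1, p.1) ≠ P.part (e.2, p.2) ∧
        ¬G.IsUniform ε (P.part (e.1, p.1)) (P.part (e.2, p.2))} : Finset (X × X)) := by
      rw [card_filter]
      push_cast
      rw [Fintype.sum_prod_type]
    rw [c2]
    refine le_trans (Nat.cast_le.2 (card_le_card_of_injOn (fun p => ((e.1, p.1), (e.2, p.2)))
      (t := (P.nonUniforms G ε).biUnion fun (U, V) => U ×ˢ V) (fun p hp => ?_) ?_))
      (c1.le.trans_eq (by ring))
    · have hp := (mem_filter.1 hp).2
      refine mem_biUnion.2 ⟨(P.part (e.1, p.1), P.part (e.2, p.2)), ?_, ?_⟩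
      · rw [Finpartition.mk_mem_nonUniforms]
        exact ⟨P.part_mem.2 (mem_univ _), P.part_mem.2 (mem_univ _), hp.1, hp.2⟩
      · exact mem_product.2 ⟨P.mem_part (mem_univ _), P.mem_part (mem_univ _)⟩
    · intro p _ q _ h
      simp only [Prod.mk.injEq, true_and] at h
      exact Prod.ext h.1 h.2
  have b3 := sum_small_slice_le P e.1 hγ
  have b4 := sum_small_slice_le P e.2 hγ
  have b5 := sum_sparse_le hE P g hτ he
  have hXX : (0 : ℝ) < Fintype.card X * Fintype.card X := by positivity
  have hne : Nonempty X := Fintype.card_pos_iff.1 hX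
  simp only [expect_add_distrib, expect_const univ_nonempty]
  have r2 : ∀ F : X → X → ℝ, ∀ K, ∑ x, ∑ y, F x y ≤ K * (Fintype.card X * Fintype.card X) →
      𝔼 x, 𝔼 y, F x y ≤ K := fun F K h => by
    simp only [Fintype.expect_eq_sum_div_card, ← sum_div, div_div]
    rwa [div_le_iff₀ hXX]
  have r1 : ∀ F : X → ℝ, ∀ K, ∑ x, F x ≤ K * (Fintype.card I * Fintype.card X) →
      𝔼 x, F x ≤ K * Fintype.card I := fun F K h => by
    simp only [Fintype.expect_eq_sum_div_card]
    rw [div_le_iff₀ hX', mul_assoc]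
    exact h
  have t1 := r2 _ _ b1
  have t2 := r2 _ _ b2
  have t3 := r1 _ _ b3
  have t4 := r1 _ _ b4
  have t5 := r2 _ _ b5
  linarith

end DenseRemoval

end PrimeProduct

namespace PrimeProduct

open Finset Function
open scoped BigOperators Classical

section DenseRemoval

variable {I : Type} [LinearOrder I] [Fintype I] {E : Finset (I × I)}

lemma le_expect_of_not_bad {X : Type} [Fintype X] (hE : Ordered E)
    (hcov : ∀ i, ∃ e ∈ E, e.1 = i ∨ e.2 = i) {g : I × I → X → X → ℝ}
    (hg : ∀ e ∈ E, ∀ x y, 0 ≤ g e x y ∧ g e x y ≤ 1) {τ γ ε β : ℝ} (hτ : 0 < τ) (hγ : 0 < γ)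
    (hγ1 : γ ≤ 1) (hε : 0 < ε) (hεE : #E * (3 * ε / γ) ≤ τ ^ #E / 2) (hβ : 0 ≤ β)
    (P : Finpartition (univ : Finset (I × X)))
    (hP : ∀ U ∈ P.parts, β * Fintype.card X ≤ #U) (hX : 0 < Fintype.card X)
    (x : I → X) (hx : ∀ e ∈ E, ¬BadPair hE g τ γ ε e (P.part (e.1, x e.1)) (P.part (e.2, x e.2))) :
    τ ^ #E * (τ ^ #E / 2) * (γ * β) ^ Fintype.card I ≤ 𝔼 x, prodOn g E x := by
  set U : I → Finset (I × X) := fun i => P.part (i, x i) with hU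
  have hb : ∀ e ∈ E, U e.1 ≠ U e.2 ∧ (weightGraph E hE g τ).IsUniform ε (U e.1) (U e.2) ∧
      γ * #(U e.1) ≤ #(slice (U e.1) e.1) ∧ γ * #(U e.2) ≤ #(slice (U e.2) e.2) ∧
      τ ≤ ((weightGraph E hE g τ).edgeDensity ({e.1} ×ˢ slice (U e.1) e.1)
        ({e.2} ×ˢ slice (U e.2) e.2) : ℝ) := by
    intro e he
    have := hx e he
    simp only [BadPair, not_or, not_and, not_not, not_lt] at this
    exact ⟨this.1, this.2.1 this.1, this.2.2.1, this.2.2.2.1, this.2.2.2.2⟩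
  have hsl : ∀ i, γ * #(U i) ≤ #(slice (U i) i) := by
    intro i
    obtain ⟨e, he, rfl | rfl⟩ := hcov i
    · exact (hb e he).2.2.1
    · exact (hb e he).2.2.2.1
  refine le_trans ?_ (le_expect_of_regular (ε := 3 * ε / γ) hE hg hτ (fun i => slice (U i) i)
    (fun e => ((weightGraph E hE g τ).edgeDensity ({e.1} ×ˢ slice (U e.1) e.1)
        ({e.2} ×ˢ slice (U e.2) e.2) : ℝ)) (fun e he => ⟨(hb e he).2.2.2.2, ?_⟩)
        (fun e he S hS T hT => ?_) hεE)
  · rw [show (γ * β) ^ Fintype.card I = ∏ _i : I, γ * β by simp]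
    refine mul_le_mul_of_nonneg_left (prod_le_prod (fun _ _ => by positivity) fun i _ => ?_)
      (by positivity)
    · have h1 := hP (U i) (P.part_mem.2 (mem_univ _))
      have h2 : (0 : ℝ) < Fintype.card X := by exact_mod_cast hX
      rw [le_div_iff₀ h2]
      nlinarith [hsl i]
  · exact_mod_cast (weightGraph E hE g τ).edgeDensity_le_one _ _
  · exact sum_le_of_uniform hE g hγ hγ1 hε he (hb e he).2.1 (slice_subset _ _) (slice_subset _ _)
      (hb e he).2.2.1 (hb e he).2.2.2.1 hS hT

/-- Removal lemma for bounded multipartite weights, with the removed set measurable with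
respect to a partition of bounded complexity. -/
theorem dense_removal [Nonempty I] (hE : Ordered E) (hcov : ∀ i, ∃ e ∈ E, e.1 = i ∨ e.2 = i)
    {η : ℝ} (hη : 0 < η) :
    ∃ c : ℝ, 0 < c ∧ ∃ M N₀ : ℕ, ∀ (X : Type) [Fintype X], N₀ ≤ Fintype.card X →
      0 < Fintype.card X → ∀ g : I × I → X → X → ℝ,
      (∀ e ∈ E, ∀ x y, 0 ≤ g e x y ∧ g e x y ≤ 1) → c ≤ 𝔼 x, prodOn g E x ∨
      ∃ (Q : Type) (_ : Fintype Q) (_ : DecidableEq Q), Fintype.card Q ≤ M ∧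
        ∃ (q : I → X → Q) (B : I × I → Q → Q → Prop),
          (∀ e ∈ E, 𝔼 x, 𝔼 y, g e x y * (if B e (q e.1 x) (q e.2 y) then 1 else 0) ≤ η) ∧
          ∀ x : I → X, ∃ e ∈ E, B e (q e.1 (x e.1)) (q e.2 (x e.2)) := by
  set h : ℝ := ((Fintype.card I : ℕ) : ℝ) with hh
  have hh1 : 1 ≤ h := by
    rw [hh]; exact_mod_cast Fintype.card_pos
  set θ : ℝ := min η 1 with hθ
  have hθ0 : 0 < θ := by rw [hθ]; positivity
  have hθ1 : θ ≤ 1 := min_le_right _ _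
  set τ : ℝ := θ / (16 * h ^ 2) with hτdef
  have hτ : 0 < τ := by positivity
  have hτh : τ * h ^ 2 = θ / 16 := by rw [hτdef]; field_simp
  have hτ1 : τ ≤ 1 := by nlinarith [sq_nonneg (h - 1)]
  obtain ⟨l, hl⟩ := exists_nat_gt (16 * h / θ)
  have hl0 : 0 < (l : ℝ) := lt_of_le_of_lt (by positivity) hl
  set ε : ℝ := min τ (τ ^ #E / 2 * τ / (3 * (#E + 1))) with hεdef
  have hε : 0 < ε := by rw [hεdef]; positivity
  have hε1 : ε ≤ τ := min_le_left _ _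
  have hε2 : #E * (3 * ε / τ) ≤ τ ^ #E / 2 := by
    have h1 : ε ≤ τ ^ #E / 2 * τ / (3 * (#E + 1)) := min_le_right _ _
    rw [le_div_iff₀ (by positivity)] at h1
    rw [mul_div_assoc', div_le_iff₀ hτ]
    nlinarith
  set K := SzemerediRegularity.bound ε l with hK
  have hK0 : 0 < K := SzemerediRegularity.bound_pos _ _
  refine ⟨τ ^ #E * (τ ^ #E / 2) * (τ * (1 / (2 * K))) ^ Fintype.card I, by positivity, K,
    max l K, ?_⟩
  intro X _ hX hX0 g hg
  have hIX : Fintype.card X ≤ Fintype.card (I × X) := by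
    rw [Fintype.card_prod]
    exact Nat.le_mul_of_pos_left _ Fintype.card_pos
  obtain ⟨P, hPe, hPl, hPK, hPu⟩ := szemeredi_regularity (weightGraph E hE g τ) hε
    (l := l) (((le_max_left _ _).trans hX).trans hIX)
  by_cases hall : ∀ x : I → X, ∃ e ∈ E,
      BadPair hE g τ τ ε e (P.part (e.1, x e.1)) (P.part (e.2, x e.2))
  · right
    refine ⟨{U // U ∈ P.parts}, inferInstance, inferInstance, by simpa using hPK,
      fun i x => ⟨P.part (i, x), P.part_mem.2 (mem_univ _)⟩,
      fun e U V => BadPair hE g τ τ ε e U.1 V.1, fun e he => ?_, hall⟩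
    have h1 := expect_bad_le (γ := τ) hE hg hτ.le hτ.le hε P hPe hPu (by exact_mod_cast hl0) hPl
      (by
        refine hPK.trans (((le_max_right _ _).trans hX).trans (hIX.trans ?_))
        rw [Fintype.card_prod]) he hX0
    refine h1.trans ((?_ : _ ≤ θ).trans (min_le_left _ _))
    rw [← hh]
    have h2 : 2 * h / l ≤ θ / 8 := by
      rw [div_lt_iff₀ hθ0] at hl
      rw [div_le_iff₀ hl0]
      nlinarith
    have h3 : ε * h ^ 2 ≤ τ * h ^ 2 := by gcongr
    have h4 : τ * h ≤ τ * h ^ 2 := by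
      gcongr; nlinarith
    have h5 : τ ≤ τ * h ^ 2 := by nlinarith
    linarith
  · left
    push Not at hall
    obtain ⟨x, hx⟩ := hall
    refine le_expect_of_not_bad hE hcov hg hτ hτ hτ1 hε hε2 (by positivity) P ?_ hX0 x hx
    intro U hU
    have h1 := hPe.average_le_card_part hU
    have hpos : 0 < #P.parts := lt_of_lt_of_le (by exact_mod_cast hl0) hPl
    have hcard : #(univ : Finset (I × X)) = Fintype.card (I × X) := rfl
    rw [hcard] at h1
    have hKX : #P.parts ≤ Fintype.card (I × X) :=
      hPK.trans (((le_max_right _ _).trans hX).trans hIX)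
    have h2 : Fintype.card (I × X) < #P.parts * (Fintype.card (I × X) / #P.parts + 1) :=
      Nat.lt_mul_div_succ _ hpos
    have h3 : 1 ≤ Fintype.card (I × X) / #P.parts := (Nat.one_le_div_iff hpos).2 hKX
    have h4 : Fintype.card X ≤ K * (2 * #U) := by
      calc _ ≤ _ := hIX
        _ ≤ _ := h2.le
        _ ≤ K * (2 * #U) := Nat.mul_le_mul hPK (by omega)
    have h5 : (Fintype.card X : ℝ) ≤ K * (2 * #U) := by exact_mod_cast h4
    have hK0' : (0 : ℝ) < K := by exact_mod_cast hK0
    rw [one_div, inv_mul_le_iff₀ (by positivity)]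
    linarith

end DenseRemoval

end PrimeProduct

namespace PrimeProduct

open Finset Function
open scoped BigOperators Classical

section SparseRemoval

variable {I : Type} [LinearOrder I] [Fintype I] {E : Finset (I × I)}

/-- Removal lemma relative to a majorant satisfying the linear forms condition. -/
theorem sparse_removal [Nonempty I] (hE : Ordered E) (hcov : ∀ i, ∃ e ∈ E, e.1 = i ∨ e.2 = i)
    {η : ℝ} (hη : 0 < η) :
    ∃ c : ℝ, 0 < c ∧ ∃ δ : ℝ, 0 < δ ∧ ∃ N₀ : ℕ, ∀ (X : Type) [Fintype X], N₀ ≤ Fintype.card X →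
      0 < Fintype.card X → ∀ ν f : I × I → X → X → ℝ,
      (∀ e ∈ E, ∀ x y, 0 ≤ f e x y ∧ f e x y ≤ ν e x y) → LFC E ν δ →
      c ≤ 𝔼 x, prodOn f E x ∨ ∃ R : I × I → X → X → Prop,
        (∀ e ∈ E, 𝔼 x, 𝔼 y, f e x y * (if R e x y then 1 else 0) ≤ η) ∧
          ∀ x : I → X, ∃ e ∈ E, R e (x e.1) (x e.2) := by
  obtain ⟨c, hc, M, N₀, hM⟩ := dense_removal hE hcov (half_pos hη)
  obtain ⟨δ₁, hδ₁, hcount⟩ := exists_count hE (half_pos hc)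
  set ε : ℝ := min δ₁ (η / (2 * (M ^ 2 + 1))) with hε'
  have hε : 0 < ε := by rw [hε']; positivity
  obtain ⟨δ₂, hδ₂, hmodel⟩ := exists_dense_model hε
  refine ⟨c / 2, by positivity, min δ₁ (δ₂ ^ 4 / 16), by positivity, N₀, ?_⟩
  intro X _ hX hX0 ν f hf hL
  have hg : ∀ e : I × I, ∃ g : X → X → ℝ, e ∈ E → (∀ x y, 0 ≤ g x y ∧ g x y ≤ 1) ∧
      CutLe (fun x y => f e x y - g x y) ε := by
    intro e
    by_cases he : e ∈ E
    · obtain ⟨g, h1, h2⟩ := hmodel X (ν e) (f e) (hf e he)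
        (cutLe_sub_one hL hE he hδ₂.le (by linarith [min_le_right δ₁ (δ₂ ^ 4 / 16)]))
      exact ⟨g, fun _ => ⟨h1, h2⟩⟩
    · exact ⟨0, fun h => absurd h he⟩
  choose g hg using hg
  have hcnt := hcount X ν f g hf (fun e he => (hg e he).1) (hL.mono (min_le_left _ _))
    (fun e he => (hg e he).2.mono (min_le_left _ _))
  rcases hM X hX hX0 g (fun e he => (hg e he).1) with h | ⟨Q, _, _, hQ, q, B, hB, hcovB⟩
  · left
    have := (abs_le.1 hcnt).1
    linarith
  · right
    refine ⟨fun e x y => B e (q e.1 x) (q e.2 y), fun e he => ?_, hcovB⟩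
    have h1 := expect_mul_step_le (hg e he).2 (q e.1) (q e.2)
      (fun i j => if B e i j then (1 : ℝ) else 0) (C := 1)
      (fun i j => by split_ifs <;> norm_num)
    simp only [sub_mul, expect_sub_distrib] at h1
    have h2 : (Fintype.card Q : ℝ) ^ 2 * (1 * ε) ≤ η / 2 := by
      have h3 : (Fintype.card Q : ℝ) ≤ M := by exact_mod_cast hQ
      have h4 : ε ≤ η / (2 * (M ^ 2 + 1)) := min_le_right _ _
      rw [le_div_iff₀ (by positivity)] at h4
      have h5 : (Fintype.card Q : ℝ) ^ 2 ≤ M ^ 2 := by gcongr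
      nlinarith
    linarith [hB e he, (abs_le.1 h1).2]

end SparseRemoval

end PrimeProduct

namespace PrimeProduct

open Finset Function
open scoped BigOperators

section Selberg

/-- The Euler function of the product of a set of primes. -/
noncomputable def phi (D : Finset ℕ) : ℝ := ∏ p ∈ D, ((p : ℝ) - 1)

/-- The sets of elements of `P` with product at most `R`. -/
def fam (P : Finset ℕ) (R : ℕ) : Finset (Finset ℕ) := {D ∈ P.powerset | ∏ p ∈ D, p ≤ R}

/-- The normalising sum of the Selberg sieve. -/
noncomputable def selH (P : Finset ℕ) (R : ℕ) : ℝ := ∑ D ∈ fam P R, (phi D)⁻¹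

/-- The weights of the Selberg sieve. -/
noncomputable def selW (P : Finset ℕ) (R : ℕ) (D : Finset ℕ) : ℝ :=
  (-1) ^ #D * (∏ p ∈ D, (p : ℝ)) / selH P R * ∑ M ∈ fam P R with D ⊆ M, (phi M)⁻¹

variable {P : Finset ℕ} {R : ℕ}

lemma phi_pos {D : Finset ℕ} (h : ∀ p ∈ D, 2 ≤ p) : 0 < phi D :=
  prod_pos fun p hp => by
    have : (2 : ℝ) ≤ p := by exact_mod_cast h p hp
    linarith

lemma subset_of_mem_fam {D : Finset ℕ} (h : D ∈ fam P R) : D ⊆ P :=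
  mem_powerset.1 (mem_filter.1 h).1

lemma mem_fam_of_subset (hP : ∀ p ∈ P, 2 ≤ p) {D M : Finset ℕ} (hM : M ∈ fam P R) (h : D ⊆ M) :
    D ∈ fam P R := by
  have hMP := subset_of_mem_fam hM
  refine mem_filter.2 ⟨mem_powerset.2 (h.trans hMP), le_trans ?_ (mem_filter.1 hM).2⟩
  exact prod_le_prod_of_subset_of_one_le' h fun p hp _ => (hP p (hMP hp)).trans' (by norm_num)

lemma empty_mem_fam (hR : 1 ≤ R) : ∅ ∈ fam P R := by simp [fam, hR]

lemma phi_inv_nonneg (hP : ∀ p ∈ P, 2 ≤ p) {D : Finset ℕ} (h : D ⊆ P) : 0 ≤ (phi D)⁻¹ :=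
  (inv_pos.2 (phi_pos fun p hp => hP p (h hp))).le

lemma one_le_selH (hP : ∀ p ∈ P, 2 ≤ p) (hR : 1 ≤ R) : 1 ≤ selH P R := by
  have := single_le_sum (f := fun D => (phi D)⁻¹)
    (fun D hD => phi_inv_nonneg hP (subset_of_mem_fam hD)) (empty_mem_fam (P := P) hR)
  simpa [phi, selH] using this

lemma selW_empty (hP : ∀ p ∈ P, 2 ≤ p) (hR : 1 ≤ R) : selW P R ∅ = 1 := by
  have h := one_le_selH hP hR
  have h2 : ∑ M ∈ fam P R with ∅ ⊆ M, (phi M)⁻¹ = selH P R := by simp [selH]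
  rw [selW, h2]
  simp
  field_simp

lemma selW_eq_zero (hP : ∀ p ∈ P, 2 ≤ p) {D : Finset ℕ} (h : D ∉ fam P R) : selW P R D = 0 := by
  have : ({M ∈ fam P R | D ⊆ M} : Finset (Finset ℕ)) = ∅ :=
    filter_eq_empty_iff.2 fun M hM hD => h (mem_fam_of_subset hP hM hD)
  rw [selW, this]
  simp

lemma abs_selW_le (hP : ∀ p ∈ P, 2 ≤ p) (hR : 1 ≤ R) (D : Finset ℕ) : |selW P R D| ≤ R := by
  by_cases h : D ∈ fam P R
  · have hH := one_le_selH hP hR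
    have hD : (∏ p ∈ D, (p : ℝ)) ≤ R := by
      rw [← Nat.cast_prod]
      exact Nat.cast_le.2 (mem_filter.1 h).2
    have hs : ∑ M ∈ fam P R with D ⊆ M, (phi M)⁻¹ ≤ selH P R :=
      sum_le_sum_of_subset_of_nonneg (filter_subset _ _)
        fun M hM _ => phi_inv_nonneg hP (subset_of_mem_fam hM)
    have hs0 : 0 ≤ ∑ M ∈ fam P R with D ⊆ M, (phi M)⁻¹ :=
      sum_nonneg fun M hM => phi_inv_nonneg hP (subset_of_mem_fam (mem_filter.1 hM).1)
    rw [selW, abs_mul, abs_div, abs_mul, abs_pow, abs_neg, abs_one, one_pow, one_mul,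
      abs_of_nonneg hs0, abs_of_nonneg (by positivity : 0 ≤ ∏ p ∈ D, (p : ℝ)),
      abs_of_pos (by linarith)]
    rw [div_mul_eq_mul_div, div_le_iff₀ (by linarith)]
    gcongr
  · rw [selW_eq_zero hP h]
    simp

/-- The diagonalised partial sums of the Selberg weights. -/
noncomputable def selY (P : Finset ℕ) (R : ℕ) (Q A E : Finset ℕ) : ℝ :=
  ∑ D ∈ P.powerset with D ∩ Q = A ∧ E ⊆ D, selW P R D * ∏ p ∈ D \ Q, (p : ℝ)⁻¹

lemma sum_neg_one_pow_eq {Q A E M : Finset ℕ} (hM : M ⊆ P) (hA : A ⊆ Q) (hE : Disjoint E Q) :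
    ∑ D ∈ P.powerset with (D ∩ Q = A ∧ E ⊆ D) ∧ D ⊆ M, (-1 : ℝ) ^ #D =
      if A ⊆ M ∧ M \ Q = E then (-1) ^ (#A + #E) else 0 := by
  by_cases hAE : A ∪ E ⊆ M
  · have hEA : Disjoint A E := (hE.mono_right hA).symm
    have hAM : A ⊆ M := subset_union_left.trans hAE
    have hEM : E ⊆ M := subset_union_right.trans hAE
    have h1 : ({D ∈ P.powerset | (D ∩ Q = A ∧ E ⊆ D) ∧ D ⊆ M} : Finset (Finset ℕ)) =
        ((M \ Q) \ E).powerset.image (A ∪ E ∪ ·) := by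
      ext D
      simp only [mem_filter, mem_powerset, mem_image]
      constructor
      · rintro ⟨_, ⟨h2, h3⟩, h4⟩
        refine ⟨(D \ Q) \ E, by gcongr, ?_⟩
        ext p
        have := Finset.ext_iff.1 h2 p
        have := @h3 p
        simp only [mem_union, mem_sdiff, mem_inter] at *
        tauto
      · rintro ⟨B, hB, rfl⟩
        have hBM : B ⊆ M := hB.trans (sdiff_subset.trans sdiff_subset)
        have hU : A ∪ E ∪ B ⊆ M := union_subset hAE hBM
        refine ⟨hU.trans hM, ⟨?_, ?_⟩, hU⟩
        · ext p
          have := @hB p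
          have := @hA p
          have : p ∈ E → p ∉ Q := fun h => disjoint_left.1 hE h
          simp only [mem_union, mem_sdiff, mem_inter] at *
          tauto
        · exact subset_union_right.trans subset_union_left
    have hdis : ∀ B ∈ ((M \ Q) \ E).powerset, Disjoint (A ∪ E) B := by
      intro B hB
      rw [disjoint_left]
      intro p hp hpB
      have := mem_powerset.1 hB hpB
      have := @hA p
      simp only [mem_union, mem_sdiff] at *
      tauto
    rw [h1, sum_image]
    · rw [sum_congr rfl fun B hB => by
        rw [card_union_of_disjoint (hdis B hB), card_union_of_disjoint hEA, pow_add]]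
      rw [← mul_sum]
      have h2 := sum_powerset_neg_one_pow_card (x := (M \ Q) \ E)
      have h3 : ∑ m ∈ ((M \ Q) \ E).powerset, (-1 : ℝ) ^ #m =
        if (M \ Q) \ E = ∅ then 1 else 0 := by exact_mod_cast h2
      rw [h3]
      have h4 : (M \ Q) \ E = ∅ ↔ A ⊆ M ∧ M \ Q = E := by
        rw [sdiff_eq_empty_iff_subset]
        refine ⟨fun h => ⟨hAM, h.antisymm ?_⟩, fun h => h.2.le⟩
        exact subset_sdiff.2 ⟨hEM, hE⟩
      simp only [h4]
      split_ifs <;> simp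
    · intro B hB B' hB' h
      have e1 := union_sdiff_cancel_left (hdis B hB)
      have e2 := union_sdiff_cancel_left (hdis B' hB')
      dsimp only at h
      rw [← e1, ← e2, h]
  · rw [if_neg, filter_eq_empty_iff.2, sum_empty]
    · rintro D _ ⟨⟨h2, h3⟩, h4⟩
      refine hAE (union_subset ?_ (h3.trans h4))
      rw [← h2]
      exact inter_subset_left.trans h4
    · rintro ⟨h1, h2⟩
      refine hAE (union_subset h1 ?_)
      rw [← h2]
      exact sdiff_subset

lemma selY_eq (hP : ∀ p ∈ P, 2 ≤ p) {Q A E : Finset ℕ} (hA : A ⊆ Q) (hE : Disjoint E Q) :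
    selY P R Q A E = (-1) ^ (#A + #E) * (∏ p ∈ A, (p : ℝ)) / selH P R *
      ∑ M ∈ fam P R with A ⊆ M ∧ M \ Q = E, (phi M)⁻¹ := by
  have h1 : ∀ D ∈ ({D ∈ P.powerset | D ∩ Q = A ∧ E ⊆ D} : Finset (Finset ℕ)),
      selW P R D * ∏ p ∈ D \ Q, (p : ℝ)⁻¹ = ∑ M ∈ fam P R, (∏ p ∈ A, (p : ℝ)) / selH P R *
        (phi M)⁻¹ * if D ⊆ M then (-1) ^ #D else 0 := by
    intro D hD
    obtain ⟨hDP, hDA, hED⟩ := mem_filter.1 hD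
    have h2 : (∏ p ∈ D, (p : ℝ)) * ∏ p ∈ D \ Q, (p : ℝ)⁻¹ = ∏ p ∈ A, (p : ℝ) := by
      rw [← hDA, ← prod_inter_mul_prod_sdiff D Q, mul_assoc, ← prod_mul_distrib]
      rw [prod_congr rfl (g := fun _ => (1 : ℝ)) fun p hp => mul_inv_cancel₀ ?_]
      · simp
      · have := hP p (mem_powerset.1 hDP (mem_sdiff.1 hp).1)
        positivity
    rw [← h2, selW, sum_filter, mul_sum, sum_mul]
    refine sum_congr rfl fun M _ => ?_
    split_ifs <;> ring
  rw [selY, sum_congr rfl h1, sum_comm, sum_filter, mul_sum]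
  refine sum_congr rfl fun M hM => ?_
  rw [← mul_sum, ← sum_filter, filter_filter, sum_neg_one_pow_eq (subset_of_mem_fam hM) hA hE]
  split_ifs <;> ring

end Selberg

end PrimeProduct

namespace PrimeProduct

open Finset Function
open scoped BigOperators

section Selberg

variable {P : Finset ℕ} {R : ℕ}

lemma prod_mul_phi_inv_le (hP : ∀ p ∈ P, 2 ≤ p) {Q A E M : Finset ℕ} (hM : M ⊆ P) (hA : A ⊆ Q)
    (hAM : A ⊆ M) (hME : M \ Q = E) : (∏ p ∈ A, (p : ℝ)) * (phi M)⁻¹ ≤ 2 ^ #Q * (phi E)⁻¹ := by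
  have h2 : ∀ p ∈ M, (2 : ℝ) ≤ p := fun p hp => by exact_mod_cast hP p (hM hp)
  have hE0 : 0 < phi E := phi_pos fun p hp => by
    rw [← hME] at hp
    exact hP p (hM (mem_sdiff.1 hp).1)
  have hI0 : 0 < phi (M ∩ Q) := phi_pos fun p hp => hP p (hM (mem_inter.1 hp).1)
  have h1 : phi M = phi (M ∩ Q) * phi E := by
    rw [← hME, phi, phi, phi, prod_inter_mul_prod_sdiff]
  have h3 : ∏ p ∈ A, (p : ℝ) ≤ 2 ^ #Q * phi (M ∩ Q) := by
    calc ∏ p ∈ A, (p : ℝ) ≤ ∏ p ∈ A, (2 * ((p : ℝ) - 1)) :=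
          prod_le_prod (fun p _ => by positivity) fun p hp => by linarith [h2 p (hAM hp)]
      _ = 2 ^ #A * phi A := by rw [prod_mul_distrib, prod_const, phi]
      _ ≤ 2 ^ #Q * phi (M ∩ Q) := by
        have : phi A ≤ phi (M ∩ Q) := by
          refine prod_le_prod_of_subset_of_one_le (subset_inter hAM hA) (fun p hp => ?_)
            fun p hp _ => ?_
          · linarith [h2 p (hAM hp)]
          · linarith [h2 p (mem_inter.1 hp).1]
        have hA0 : 0 < phi A := phi_pos fun p hp => hP p (hM (hAM hp))
        gcongr
        · norm_num
  rw [h1, mul_inv, ← mul_assoc]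
  refine mul_le_mul_of_nonneg_right ?_ (inv_pos.2 hE0).le
  rw [← div_eq_mul_inv, div_le_iff₀ hI0]
  exact h3

lemma abs_selY_le (hP : ∀ p ∈ P, 2 ≤ p) (hR : 1 ≤ R) {Q A E : Finset ℕ} (hA : A ⊆ Q)
    (hE : Disjoint E Q) :
    |selY P R Q A E| ≤ if E ∈ fam P R then 4 ^ #Q * (phi E)⁻¹ / selH P R else 0 := by
  have hH := one_le_selH hP hR
  have hH0 : 0 < selH P R := by linarith
  rw [selY_eq hP hA hE]
  split_ifs with h
  · have hs0 : 0 ≤ ∑ M ∈ fam P R with A ⊆ M ∧ M \ Q = E, (phi M)⁻¹ :=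
      sum_nonneg fun M hM => phi_inv_nonneg hP (subset_of_mem_fam (mem_filter.1 hM).1)
    rw [abs_mul, abs_div, abs_mul, abs_pow, abs_neg, abs_one, one_pow, one_mul,
      abs_of_nonneg hs0, abs_of_nonneg (by positivity : 0 ≤ ∏ p ∈ A, (p : ℝ)),
      abs_of_pos hH0, div_mul_eq_mul_div]
    refine div_le_div_of_nonneg_right ?_ hH0.le
    have hcard : #{M ∈ fam P R | A ⊆ M ∧ M \ Q = E} ≤ 2 ^ #Q := by
      rw [← card_powerset]
      refine card_le_card_of_injOn (· ∩ Q) (fun M _ => by simp) fun M hM M' hM' h => ?_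
      have h1 := (mem_filter.1 hM).2.2
      have h2 := (mem_filter.1 hM').2.2
      dsimp only at h
      rw [← sdiff_union_inter M Q, ← sdiff_union_inter M' Q, h, h1, h2]
    have hE0 : 0 ≤ (phi E)⁻¹ := phi_inv_nonneg hP (subset_of_mem_fam h)
    rw [mul_sum]
    calc ∑ M ∈ fam P R with A ⊆ M ∧ M \ Q = E, (∏ p ∈ A, (p : ℝ)) * (phi M)⁻¹
        ≤ ∑ M ∈ fam P R with A ⊆ M ∧ M \ Q = E, 2 ^ #Q * (phi E)⁻¹ :=
          sum_le_sum fun M hM => by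
            obtain ⟨h1, h2, h3⟩ := mem_filter.1 hM
            exact prod_mul_phi_inv_le hP (subset_of_mem_fam h1) hA h2 h3
      _ ≤ 2 ^ #Q * (2 ^ #Q * (phi E)⁻¹) := by
        rw [sum_const, nsmul_eq_mul]
        refine mul_le_mul_of_nonneg_right ?_ (by positivity)
        exact_mod_cast hcard
      _ = 4 ^ #Q * (phi E)⁻¹ := by
        rw [← mul_assoc, ← mul_pow]
        norm_num
  · rw [filter_eq_empty_iff.2, sum_empty]
    · simp
    · rintro M hM ⟨_, h2⟩
      exact h (mem_fam_of_subset hP hM (h2 ▸ sdiff_subset))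

/-- The Selberg quadratic form localised at prescribed traces on `Q`. -/
noncomputable def selS (P : Finset ℕ) (R : ℕ) (Q A A' : Finset ℕ) : ℝ :=
  ∑ D ∈ P.powerset with D ∩ Q = A, ∑ D' ∈ P.powerset with D' ∩ Q = A',
    selW P R D * selW P R D' * ∏ p ∈ (D ∪ D') \ Q, (p : ℝ)⁻¹

lemma selS_eq (hP : ∀ p ∈ P, 2 ≤ p) (Q A A' : Finset ℕ) :
    selS P R Q A A' = ∑ E ∈ (P \ Q).powerset, phi E * selY P R Q A E * selY P R Q A' E := by
  have h1 : ∀ D ∈ P.powerset, ∀ D' ∈ P.powerset, selW P R D * selW P R D' *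
      ∏ p ∈ (D ∪ D') \ Q, (p : ℝ)⁻¹ = ∑ E ∈ (P \ Q).powerset, phi E *
        (if E ⊆ D then selW P R D * ∏ p ∈ D \ Q, (p : ℝ)⁻¹ else 0) *
        (if E ⊆ D' then selW P R D' * ∏ p ∈ D' \ Q, (p : ℝ)⁻¹ else 0) := by
    intro D hD D' hD'
    have hDP := mem_powerset.1 hD
    have h2 := prod_union_inter (s₁ := D \ Q) (s₂ := D' \ Q) (f := fun p : ℕ => (p : ℝ)⁻¹)
    rw [← union_sdiff_distrib] at h2
    have h3 : (∏ p ∈ (D \ Q) ∩ (D' \ Q), (p : ℝ)⁻¹) * ∏ p ∈ (D \ Q) ∩ (D' \ Q), (p : ℝ) = 1 := by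
      rw [← prod_mul_distrib]
      refine prod_eq_one fun p hp => inv_mul_cancel₀ ?_
      have := hP p (hDP (mem_sdiff.1 (mem_inter.1 hp).1).1)
      positivity
    have h4 : ∏ p ∈ (D \ Q) ∩ (D' \ Q), (p : ℝ) =
        ∑ E ∈ (P \ Q).powerset, if E ⊆ D ∧ E ⊆ D' then phi E else 0 := by
      have h5 : ∏ p ∈ (D \ Q) ∩ (D' \ Q), (p : ℝ) =
          ∏ p ∈ (D \ Q) ∩ (D' \ Q), (((p : ℝ) - 1) + 1) := by simp
      rw [h5, prod_add_one, ← sum_filter]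
      refine sum_congr ?_ fun _ _ => rfl
      ext E
      simp only [mem_powerset, mem_filter, subset_inter_iff, subset_sdiff]
      constructor
      · rintro ⟨⟨h1, h2⟩, h3, h4⟩
        exact ⟨⟨h1.trans hDP, h2⟩, h1, h3⟩
      · rintro ⟨⟨h1, h2⟩, h3, h4⟩
        exact ⟨⟨h3, h2⟩, h4, h2⟩
    have h6 : ∏ p ∈ (D ∪ D') \ Q, (p : ℝ)⁻¹ = (∏ p ∈ D \ Q, (p : ℝ)⁻¹) *
        (∏ p ∈ D' \ Q, (p : ℝ)⁻¹) * ∏ p ∈ (D \ Q) ∩ (D' \ Q), (p : ℝ) := by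
      rw [← h2, mul_assoc, h3, mul_one]
    rw [h6, h4, mul_sum, mul_sum]
    refine sum_congr rfl fun E _ => ?_
    by_cases hE : E ⊆ D <;> by_cases hE' : E ⊆ D' <;> simp [hE, hE']
    ring
  rw [selS, sum_congr rfl fun D hD => sum_congr rfl fun D' hD' =>
    h1 D (mem_filter.1 hD).1 D' (mem_filter.1 hD').1]
  rw [sum_congr rfl fun D _ => sum_comm, sum_comm]
  refine sum_congr rfl fun E _ => ?_
  simp only [← mul_sum]
  rw [← sum_mul, ← mul_sum]
  simp only [selY, ← sum_filter, filter_filter]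

lemma sum_phi_mul_sq_le (hP : ∀ p ∈ P, 2 ≤ p) (hR : 1 ≤ R) (Q : Finset ℕ) :
    ∑ E ∈ (P \ Q).powerset, phi E * (if E ∈ fam P R then (phi E)⁻¹ / selH P R else 0) ^ 2 ≤
      (selH P R)⁻¹ := by
  have hH0 : 0 < selH P R := by linarith [one_le_selH hP hR]
  have h1 : ∀ E ∈ P.powerset, phi E * (if E ∈ fam P R then (phi E)⁻¹ / selH P R else 0) ^ 2 =
      if E ∈ fam P R then (phi E)⁻¹ / selH P R ^ 2 else 0 := by
    intro E hE
    have hE0 : 0 < phi E := phi_pos fun p hp => hP p (mem_powerset.1 hE hp)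
    split_ifs
    · field_simp
    · simp
  calc ∑ E ∈ (P \ Q).powerset, phi E * (if E ∈ fam P R then (phi E)⁻¹ / selH P R else 0) ^ 2
      ≤ ∑ E ∈ P.powerset, phi E * (if E ∈ fam P R then (phi E)⁻¹ / selH P R else 0) ^ 2 := by
        refine sum_le_sum_of_subset_of_nonneg (powerset_mono.2 sdiff_subset) fun E hE _ => ?_
        have hE0 : 0 < phi E := phi_pos fun p hp => hP p (mem_powerset.1 hE hp)
        positivity
    _ = (selH P R)⁻¹ := by
      rw [sum_congr rfl h1, ← sum_filter]
      have : ({E ∈ P.powerset | E ∈ fam P R} : Finset (Finset ℕ)) = fam P R := by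
        ext E
        simp [fam]
      rw [this, ← sum_div, ← selH]
      field_simp

lemma abs_selS_le (hP : ∀ p ∈ P, 2 ≤ p) (hR : 1 ≤ R) {Q A A' : Finset ℕ} (hA : A ⊆ Q)
    (hA' : A' ⊆ Q) : |selS P R Q A A'| ≤ 16 ^ #Q / selH P R := by
  rw [selS_eq hP]
  refine (abs_sum_le_sum_abs _ _).trans ?_
  calc ∑ E ∈ (P \ Q).powerset, |phi E * selY P R Q A E * selY P R Q A' E|
      ≤ ∑ E ∈ (P \ Q).powerset, 16 ^ #Q *
        (phi E * (if E ∈ fam P R then (phi E)⁻¹ / selH P R else 0) ^ 2) := by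
        refine sum_le_sum fun E hE => ?_
        have hE' := subset_sdiff.1 (mem_powerset.1 hE)
        have hE0 : 0 < phi E := phi_pos fun p hp => hP p (hE'.1 hp)
        have h1 := abs_selY_le hP hR hA hE'.2
        have h2 := abs_selY_le hP hR hA' hE'.2
        rw [abs_mul, abs_mul, abs_of_pos hE0, mul_assoc]
        refine (mul_le_mul_of_nonneg_left (mul_le_mul h1 h2 (abs_nonneg _)
          ((abs_nonneg _).trans h1)) hE0.le).trans_eq ?_
        have h16 : (16 : ℝ) ^ #Q = 4 ^ #Q * 4 ^ #Q := by rw [← mul_pow]; norm_num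
        split_ifs
        · rw [h16]; ring
        · ring
    _ ≤ 16 ^ #Q * (selH P R)⁻¹ := by
      rw [← mul_sum]
      exact mul_le_mul_of_nonneg_left (sum_phi_mul_sq_le hP hR Q) (by positivity)
    _ = 16 ^ #Q / selH P R := by rw [div_eq_mul_inv]

lemma selS_empty (hP : ∀ p ∈ P, 2 ≤ p) (hR : 1 ≤ R) : selS P R ∅ ∅ ∅ = (selH P R)⁻¹ := by
  have hH0 : 0 < selH P R := by linarith [one_le_selH hP hR]
  rw [selS_eq hP, sdiff_empty]
  have h1 : ∀ E ∈ P.powerset, phi E * selY P R ∅ ∅ E * selY P R ∅ ∅ E =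
      if E ∈ fam P R then (phi E)⁻¹ / selH P R ^ 2 else 0 := by
    intro E hE
    have hE0 : 0 < phi E := phi_pos fun p hp => hP p (mem_powerset.1 hE hp)
    rw [selY_eq hP (Subset.refl _) (disjoint_empty_right E)]
    have h2 : ({M ∈ fam P R | ∅ ⊆ M ∧ M \ ∅ = E} : Finset (Finset ℕ)) =
        if E ∈ fam P R then {E} else ∅ := by
      simp [filter_eq']
    rw [h2]
    split_ifs
    · have h3 : ((-1 : ℝ) ^ #E) * (-1) ^ #E = 1 := by rw [← mul_pow]; simp
      simp only [card_empty, zero_add, prod_empty, mul_one, sum_singleton]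
      rw [show phi E * ((-1) ^ #E / selH P R * (phi E)⁻¹) * ((-1) ^ #E / selH P R * (phi E)⁻¹) =
        ((-1 : ℝ) ^ #E * (-1) ^ #E) * (phi E * (phi E)⁻¹ * (phi E)⁻¹ / selH P R ^ 2) by ring, h3,
        mul_inv_cancel₀ hE0.ne']
      ring
    · simp
  rw [sum_congr rfl h1, ← sum_filter]
  have : ({E ∈ P.powerset | E ∈ fam P R} : Finset (Finset ℕ)) = fam P R := by
    ext E
    simp [fam]
  rw [this, ← sum_div, ← selH]
  field_simp

end Selberg

end PrimeProduct

namespace PrimeProduct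

open Finset Function
open scoped BigOperators

section SelbergCorrelation

variable {P : Finset ℕ} {R : ℕ} {S : Type} [Fintype S]

/-- The indices at which a tuple of pairs of sets involves `p`. -/
def hit (σ : S → Finset ℕ × Finset ℕ) (p : ℕ) : Finset S := {s | p ∈ (σ s).1 ∪ (σ s).2}

/-- The trace on `Q` of a tuple of pairs of sets. -/
def trace (Q : Finset ℕ) (σ : S → Finset ℕ × Finset ℕ) (s : S) : Finset ℕ × Finset ℕ :=
  ((σ s).1 ∩ Q, (σ s).2 ∩ Q)

lemma hit_trace {Q : Finset ℕ} (σ : S → Finset ℕ × Finset ℕ) {p : ℕ} (hp : p ∈ Q) :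
    hit (trace Q σ) p = hit σ p := by
  ext s
  simp [hit, trace, hp]

variable [DecidableEq S]

/-- All tuples of pairs of subsets of `P`. -/
def tuples (S : Type) [Fintype S] [DecidableEq S] (P : Finset ℕ) :
    Finset (S → Finset ℕ × Finset ℕ) :=
  Fintype.piFinset fun _ => P.powerset ×ˢ P.powerset

lemma mem_tuples {σ : S → Finset ℕ × Finset ℕ} :
    σ ∈ tuples S P ↔ ∀ s, (σ s).1 ⊆ P ∧ (σ s).2 ⊆ P := by
  simp [tuples]

lemma card_tuples : #(tuples S P) = (4 ^ #P) ^ Fintype.card S := by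
  simp only [tuples, Fintype.card_piFinset, card_product, card_powerset, prod_const, card_univ]
  rw [← mul_pow]
  norm_num

lemma prod_inv_pow_hit {σ : S → Finset ℕ × Finset ℕ} (hσ : σ ∈ tuples S P) (Q : Finset ℕ) :
    ∏ p ∈ P \ Q, ((p : ℝ)⁻¹) ^ #(hit σ p) =
      ∏ s, ∏ p ∈ ((σ s).1 ∪ (σ s).2) \ Q, (p : ℝ)⁻¹ := by
  have h1 : ∀ p : ℕ, ((p : ℝ)⁻¹) ^ #(hit σ p) =
      ∏ s, if p ∈ (σ s).1 ∪ (σ s).2 then (p : ℝ)⁻¹ else 1 := fun p => by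
    rw [hit, ← prod_const, prod_filter]
  simp only [h1]
  rw [prod_comm]
  refine prod_congr rfl fun s _ => ?_
  rw [← prod_filter]
  refine prod_congr ?_ fun _ _ => rfl
  have := mem_tuples.1 hσ s
  ext p
  have h2 := @this.1 p
  have h3 := @this.2 p
  simp only [mem_filter, mem_sdiff, mem_union]
  tauto

lemma sum_fiber_eq (Q : Finset ℕ) (t : S → Finset ℕ × Finset ℕ) :
    ∑ σ ∈ tuples S P with trace Q σ = t, ∏ s, (selW P R (σ s).1 * selW P R (σ s).2 *
      ∏ p ∈ ((σ s).1 ∪ (σ s).2) \ Q, (p : ℝ)⁻¹) = ∏ s, selS P R Q (t s).1 (t s).2 := by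
  have h1 : ({σ ∈ tuples S P | trace Q σ = t} : Finset (S → Finset ℕ × Finset ℕ)) =
      Fintype.piFinset fun s => ({D ∈ P.powerset | D ∩ Q = (t s).1} : Finset (Finset ℕ)) ×ˢ
        ({D ∈ P.powerset | D ∩ Q = (t s).2} : Finset (Finset ℕ)) := by
    ext σ
    simp only [mem_filter, mem_tuples, Fintype.mem_piFinset, mem_product, mem_powerset,
      funext_iff, trace, Prod.ext_iff]
    rw [← forall_and]
    refine forall_congr' fun s => ?_
    tauto
  rw [h1, ← prod_univ_sum (fun s => ({D ∈ P.powerset | D ∩ Q = (t s).1} : Finset (Finset ℕ)) ×ˢ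
        ({D ∈ P.powerset | D ∩ Q = (t s).2} : Finset (Finset ℕ)))
        (fun _ d => selW P R d.1 * selW P R d.2 * ∏ p ∈ (d.1 ∪ d.2) \ Q, (p : ℝ)⁻¹)]
  refine prod_congr rfl fun s _ => ?_
  rw [sum_product, selS]

lemma sum_tuples_eq (Q : Finset ℕ) (c : ℕ → Finset S → ℝ) :
    ∑ σ ∈ tuples S P, (∏ s, (selW P R (σ s).1 * selW P R (σ s).2 *
      ∏ p ∈ ((σ s).1 ∪ (σ s).2) \ Q, (p : ℝ)⁻¹)) * ∏ p ∈ Q, c p (hit σ p) =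
    ∑ t ∈ tuples S Q, (∏ p ∈ Q, c p (hit t p)) * ∏ s, selS P R Q (t s).1 (t s).2 := by
  rw [← sum_fiberwise_of_maps_to (t := tuples S Q) (g := trace Q)
    (fun σ _ => mem_tuples.2 fun s => ⟨inter_subset_right, inter_subset_right⟩)]
  refine sum_congr rfl fun t _ => ?_
  rw [← sum_fiber_eq, mul_sum]
  refine sum_congr rfl fun σ hσ => ?_
  rw [mul_comm, ← (mem_filter.1 hσ).2]
  congr 1
  exact prod_congr rfl fun p hp => by rw [hit_trace σ hp]

/-- The correlation sums of the Selberg weights are close to their expected value. -/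
theorem abs_sum_tuples_sub_one_le (hP : ∀ p ∈ P, 2 ≤ p) (hR : 1 ≤ R) (α : ℕ → Finset S → ℝ)
    (hα0 : ∀ p ∈ P, α p ∅ = 1) (hα1 : ∀ p ∈ P, ∀ s, α p {s} = (p : ℝ)⁻¹)
    (hα2 : ∀ p ∈ P, ∀ T, 2 ≤ #T → 0 ≤ α p T ∧ α p T ≤ ((p : ℝ)⁻¹) ^ 2) :
    |selH P R ^ Fintype.card S * ∑ σ ∈ tuples S P, (∏ s, (selW P R (σ s).1 * selW P R (σ s).2)) *
      ∏ p ∈ P, α p (hit σ p) - 1| ≤ ∏ p ∈ P, (1 + 64 ^ Fintype.card S * ((p : ℝ)⁻¹) ^ 2) - 1 := by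
  have hH0 : 0 < selH P R := by linarith [one_le_selH hP hR]
  set K := Fintype.card S with hK
  set β : ℕ → Finset S → ℝ := fun p T => α p T - ((p : ℝ)⁻¹) ^ #T with hβ
  have hβle : ∀ p ∈ P, ∀ T, |β p T| ≤ ((p : ℝ)⁻¹) ^ 2 := by
    intro p hp T
    have hp2 : (p : ℝ)⁻¹ ≤ 1 := inv_le_one_of_one_le₀ (by exact_mod_cast (hP p hp).trans' (by norm_num))
    have hp0 : 0 ≤ (p : ℝ)⁻¹ := by positivity
    simp only [hβ]
    rcases Nat.lt_or_ge (#T) 2 with h | h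
    · have : #T = 0 ∨ #T = 1 := by omega
      rcases this with h | h
      · rw [card_eq_zero.1 h, hα0 p hp]
        simp
      · obtain ⟨s, rfl⟩ := card_eq_one.1 h
        rw [hα1 p hp]
        simp
    · have h1 := hα2 p hp T h
      have h2 : ((p : ℝ)⁻¹) ^ #T ≤ ((p : ℝ)⁻¹) ^ 2 := pow_le_pow_of_le_one hp0 hp2 h
      have h3 : 0 ≤ ((p : ℝ)⁻¹) ^ #T := by positivity
      rw [abs_le]
      constructor <;> linarith
  set B : Finset ℕ → ℝ := fun Q => selH P R ^ K *
    ∑ t ∈ tuples S Q, (∏ p ∈ Q, β p (hit t p)) * ∏ s, selS P R Q (t s).1 (t s).2 with hB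
  have hsum : selH P R ^ K * ∑ σ ∈ tuples S P, (∏ s, (selW P R (σ s).1 * selW P R (σ s).2)) *
      ∏ p ∈ P, α p (hit σ p) = ∑ Q ∈ P.powerset, B Q := by
    simp only [hB, ← mul_sum]
    congr 1
    simp only [← sum_tuples_eq]
    rw [sum_comm]
    refine sum_congr rfl fun σ hσ => ?_
    have h1 : ∏ p ∈ P, α p (hit σ p) =
        ∏ p ∈ P, (β p (hit σ p) + ((p : ℝ)⁻¹) ^ #(hit σ p)) := by simp [hβ]
    rw [h1, prod_add, mul_sum]
    refine sum_congr rfl fun Q _ => ?_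
    rw [prod_inv_pow_hit hσ]
    simp only [prod_mul_distrib]
    ring
  have hB0 : B ∅ = 1 := by
    have : tuples S ∅ = {fun _ => (∅, ∅)} := by
      ext σ
      simp [mem_tuples, subset_empty, funext_iff, Prod.ext_iff]
    simp only [hB, this, sum_singleton, prod_empty, selS_empty hP hR, prod_const, card_univ]
    rw [← hK, one_mul, ← mul_pow, mul_inv_cancel₀ hH0.ne', one_pow]
  have hBle : ∀ Q ∈ P.powerset, |B Q| ≤ ∏ p ∈ Q, (64 ^ K * ((p : ℝ)⁻¹) ^ 2) := by
    intro Q hQ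
    simp only [hB]
    rw [abs_mul, abs_of_pos (by positivity)]
    have h1 : ∀ t ∈ tuples S Q, |(∏ p ∈ Q, β p (hit t p)) * ∏ s, selS P R Q (t s).1 (t s).2| ≤
        (∏ p ∈ Q, ((p : ℝ)⁻¹) ^ 2) * (16 ^ #Q / selH P R) ^ K := by
      intro t ht
      rw [abs_mul, abs_prod, abs_prod]
      refine mul_le_mul (prod_le_prod (fun _ _ => abs_nonneg _) fun p hp =>
        hβle p (mem_powerset.1 hQ hp) _) ?_ (prod_nonneg fun _ _ => abs_nonneg _)
        (prod_nonneg fun _ _ => by positivity)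
      rw [hK, ← card_univ, ← prod_const]
      exact prod_le_prod (fun _ _ => abs_nonneg _) fun s _ =>
        abs_selS_le hP hR (mem_tuples.1 ht s).1 (mem_tuples.1 ht s).2
    calc selH P R ^ K * |∑ t ∈ tuples S Q, (∏ p ∈ Q, β p (hit t p)) *
          ∏ s, selS P R Q (t s).1 (t s).2|
        ≤ selH P R ^ K * ∑ t ∈ tuples S Q, (∏ p ∈ Q, ((p : ℝ)⁻¹) ^ 2) *
          (16 ^ #Q / selH P R) ^ K :=
          mul_le_mul_of_nonneg_left ((abs_sum_le_sum_abs _ _).trans (sum_le_sum h1))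
            (by positivity)
      _ = ∏ p ∈ Q, (64 ^ K * ((p : ℝ)⁻¹) ^ 2) := by
        rw [sum_const, nsmul_eq_mul, card_tuples, ← hK, prod_mul_distrib, prod_const, div_pow]
        push_cast
        have h64 : ((64 : ℝ) ^ K) ^ #Q = (4 ^ #Q) ^ K * (16 ^ #Q) ^ K := by
          rw [← mul_pow, ← mul_pow, ← pow_mul, ← pow_mul, mul_comm]
          norm_num
        rw [h64]
        field_simp
  rw [hsum, prod_one_add, ← add_sum_erase _ _ (empty_mem_powerset P), hB0,
    ← add_sum_erase _ _ (empty_mem_powerset P)]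
  simp only [prod_empty, add_sub_cancel_left]
  exact (abs_sum_le_sum_abs _ _).trans (sum_le_sum fun Q hQ => hBle Q (mem_of_mem_erase hQ))

end SelbergCorrelation

end PrimeProduct

namespace PrimeProduct

open Finset Function
open scoped BigOperators

section Equidistribution

variable {V : Type} [Fintype V] [DecidableEq V]

lemma abs_card_residue_sub_le (N q : ℕ) [NeZero q] (hN : 0 < N) (c : ZMod q) :
    |(#{x : Fin N | ((x : ℕ) : ZMod q) = c} : ℝ) * q / N - 1| ≤ q / N := by
  have hq : 0 < q := Nat.pos_of_ne_zero (NeZero.ne q)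
  have h1 : #{x : Fin N | ((x : ℕ) : ZMod q) = c} = N.count (· ≡ c.val [MOD q]) := by
    rw [Nat.count_eq_card_filter_range, card_filter, card_filter,
      Fin.sum_univ_eq_sum_range (fun i => if ((i : ℕ) : ZMod q) = c then 1 else 0) N]
    refine sum_congr rfl fun i _ => ?_
    congr 1
    rw [← ZMod.natCast_eq_natCast_iff, ZMod.natCast_zmod_val]
  rw [h1, Nat.count_modEq_card _ hq]
  have h2 := Nat.div_add_mod N q
  have h3 := Nat.mod_lt N hq
  have h2' : (q : ℝ) * (N / q : ℕ) + (N % q : ℕ) = N := by exact_mod_cast h2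
  have h3' : ((N % q : ℕ) : ℝ) ≤ q := by exact_mod_cast h3.le
  have h4' : (0 : ℝ) ≤ ((N % q : ℕ) : ℝ) := by positivity
  have hN' : (0 : ℝ) < N := by exact_mod_cast hN
  rw [div_sub_one hN'.ne', abs_div, abs_of_pos hN']
  refine div_le_div_of_nonneg_right ?_ hN'.le
  push_cast
  rw [abs_le]
  split_ifs <;> constructor <;> nlinarith

lemma expect_comp_eq {X Y : Type} [Fintype X] [Fintype Y] [DecidableEq Y] (π : X → Y)
    (hX : 0 < Fintype.card X) (hY : 0 < Fintype.card Y) (F : (V → Y) → ℝ) :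
    𝔼 x : V → X, F (fun v => π (x v)) = 𝔼 c : V → Y, F c *
      ∏ v, ((#{x | π x = c v} : ℝ) * Fintype.card Y / Fintype.card X) := by
  have hX' : (Fintype.card X : ℝ) ≠ 0 := by exact_mod_cast hX.ne'
  have hY' : (Fintype.card Y : ℝ) ≠ 0 := by exact_mod_cast hY.ne'
  rw [Fintype.expect_eq_sum_div_card, Fintype.expect_eq_sum_div_card,
    ← sum_fiberwise (s := univ) (g := fun x : V → X => fun v => π (x v)), sum_div, sum_div]
  refine sum_congr rfl fun c _ => ?_
  have h1 : ∑ x ∈ (univ : Finset (V → X)) with (fun v => π (x v)) = c, F (fun v => π (x v)) =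
      (∏ v, (#{x | π x = c v} : ℝ)) * F c := by
    rw [sum_congr rfl (g := fun _ => F c) fun x hx => by rw [(mem_filter.1 hx).2], sum_const,
      nsmul_eq_mul]
    congr 1
    have : ({x ∈ (univ : Finset (V → X)) | (fun v => π (x v)) = c} : Finset (V → X)) =
        Fintype.piFinset fun v => {x | π x = c v} := by
      ext x
      simp [funext_iff]
    rw [this, Fintype.card_piFinset]
    push_cast
    rfl
  rw [h1]
  simp only [Fintype.card_fun]
  push_cast
  rw [prod_div_distrib, prod_mul_distrib, prod_const, prod_const, card_univ]
  field_simp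

lemma abs_expect_box_sub_le (N q : ℕ) [NeZero q] (hN : 0 < N) (F : (V → ZMod q) → ℝ)
    (hF : ∀ c, |F c| ≤ 1) :
    |𝔼 x : V → Fin N, F (fun v => ((x v : ℕ) : ZMod q)) - 𝔼 c, F c| ≤
      Real.exp (Fintype.card V * (q / N)) - 1 := by
  have hq : 0 < q := Nat.pos_of_ne_zero (NeZero.ne q)
  rw [expect_comp_eq (fun x : Fin N => ((x : ℕ) : ZMod q)) (by simpa using hN)
    (by rw [ZMod.card]; exact hq), ← expect_sub_distrib]
  refine (abs_expect_le _ _).trans ?_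
  refine expect_le univ_nonempty fun c _ => ?_
  rw [← mul_sub_one, abs_mul]
  have h1 := norm_prod_one_add_sub_one_le (univ : Finset V)
    fun v => (#{x : Fin N | ((x : ℕ) : ZMod q) = c v} : ℝ) * q / N - 1
  simp only [add_sub_cancel, Real.norm_eq_abs] at h1
  rw [ZMod.card, Fintype.card_fin]
  refine (mul_le_of_le_one_left (abs_nonneg _) (hF c)).trans (h1.trans ?_)
  gcongr
  calc ∑ v, |(#{x : Fin N | ((x : ℕ) : ZMod q) = c v} : ℝ) * q / N - 1|
      ≤ ∑ v : V, (q : ℝ) / N := sum_le_sum fun v _ => abs_card_residue_sub_le N q hN (c v)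
    _ = Fintype.card V * (q / N) := by simp

lemma expect_pi_prod {ι : Type} [Fintype ι] [DecidableEq ι] {Y : ι → Type} [∀ i, Fintype (Y i)]
    (g : ∀ i, Y i → ℝ) : 𝔼 w : ∀ i, Y i, ∏ i, g i (w i) = ∏ i, 𝔼 y, g i y := by
  simp only [Fintype.expect_eq_sum_div_card]
  rw [prod_div_distrib, prod_univ_sum, Fintype.piFinset_univ, Fintype.card_pi]
  push_cast
  rfl

lemma expect_crt {ι : Type} [Fintype ι] [DecidableEq ι] (a : ι → ℕ) [∀ i, NeZero (a i)]
    [NeZero (∏ i, a i)] (ha : Pairwise (Nat.Coprime on a)) (g : ∀ i, (V → ZMod (a i)) → ℝ) :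
    𝔼 c : V → ZMod (∏ i, a i), ∏ i, g i (fun v =>
      ZMod.castHom (dvd_prod_of_mem a (mem_univ i)) (ZMod (a i)) (c v)) = ∏ i, 𝔼 z, g i z := by
  rw [← expect_pi_prod]
  have hc : ∀ (c : ZMod (∏ i, a i)) (i : ι),
      ZMod.castHom (dvd_prod_of_mem a (mem_univ i)) (ZMod (a i)) c = ZMod.prodEquivPi a ha c i := by
    intro c i
    have : ZMod.castHom (dvd_prod_of_mem a (mem_univ i)) (ZMod (a i)) =
        (Pi.evalRingHom (fun i => ZMod (a i)) i).comp (ZMod.prodEquivPi a ha).toRingHom :=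
      Subsingleton.elim _ _
    rw [this]
    rfl
  refine Fintype.expect_equiv
    (((Equiv.refl V).arrowCongr (ZMod.prodEquivPi a ha).toEquiv).trans (Equiv.piComm _)) _ _ ?_
  intro c
  refine prod_congr rfl fun i _ => ?_
  congr 1
  ext v
  exact hc (c v) i

/-- Equidistribution of a box modulo pairwise coprime moduli. -/
theorem abs_expect_box_prod_sub_le {ι : Type} [Fintype ι] [DecidableEq ι] (a : ι → ℕ)
    [∀ i, NeZero (a i)] (ha : Pairwise (Nat.Coprime on a)) (g : ∀ i, (V → ZMod (a i)) → ℝ)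
    (hg : ∀ i z, |g i z| ≤ 1) (N : ℕ) (hN : 0 < N) :
    |𝔼 x : V → Fin N, ∏ i, g i (fun v => ((x v : ℕ) : ZMod (a i))) - ∏ i, 𝔼 z, g i z| ≤
      Real.exp (Fintype.card V * ((∏ i, a i : ℕ) / N)) - 1 := by
  have : NeZero (∏ i, a i) := ⟨prod_ne_zero_iff.2 fun i _ => NeZero.ne _⟩
  rw [← expect_crt a ha]
  have h := abs_expect_box_sub_le (V := V) N (∏ i, a i) hN (fun c => ∏ i, g i (fun v =>
    ZMod.castHom (dvd_prod_of_mem a (mem_univ i)) (ZMod (a i)) (c v))) fun c => by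
      rw [abs_prod]
      exact prod_le_one (fun _ _ => abs_nonneg _) fun i _ => hg i _
  simpa only [map_natCast] using h

end Equidistribution

end PrimeProduct

namespace PrimeProduct

open Finset Function
open scoped BigOperators

section LocalDensity

variable {V S : Type}

/-- The linear form `b + m s * (z (i s) - z (j s))`. -/
def lin {A : Type} [CommRing A] (b : ℤ) (m : S → ℤ) (i j : S → V) (z : V → A) (s : S) : A :=
  b + m s * (z (i s) - z (j s))

lemma map_lin {A B : Type} [CommRing A] [CommRing B] (f : A →+* B) (b : ℤ) (m : S → ℤ)
    (i j : S → V) (z : V → A) (s : S) :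
    f (lin b m i j z s) = lin b m i j (fun v => f (z v)) s := by
  simp [lin]

/-- The density of the common zeros of the forms in `T` modulo `p`. -/
noncomputable def dens [Fintype V] (b : ℤ) (m : S → ℤ) (i j : S → V) (p : ℕ) (T : Finset S) : ℝ :=
  Nat.card {z : V → ZMod p // ∀ s ∈ T, lin b m i j z s = 0} / (p : ℝ) ^ Fintype.card V

variable [DecidableEq V] {b : ℤ} {m : S → ℤ} {i j : S → V} {p : ℕ}

lemma lin_update {s : S} {v : V} (h1 : v ≠ i s) (h2 : v ≠ j s) {A : Type} [CommRing A] (z : V → A)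
    (u : A) : lin b m i j (update z v u) s = lin b m i j z s := by
  simp [lin, h1.symm, h2.symm]

lemma expect_affine_eq_zero [Fact p.Prime] (k n : ZMod p) (hn : n ≠ 0) :
    𝔼 u : ZMod p, (if k + n * u = 0 then (1 : ℝ) else 0) = (p : ℝ)⁻¹ := by
  have h : ∀ u, k + n * u = 0 ↔ u = -k / n := fun u => by
    rw [eq_div_iff hn, eq_neg_iff_add_eq_zero, add_comm, mul_comm]
  simp only [h]
  rw [Fintype.expect_eq_sum_div_card, ZMod.card]
  simp

lemma expect_update_lin [Fact p.Prime] {s : S} (hm : ((m s : ℤ) : ZMod p) ≠ 0) (hij : i s ≠ j s)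
    {v : V} (hv : v = i s ∨ v = j s) (z : V → ZMod p) :
    𝔼 u : ZMod p, (if lin b m i j (update z v u) s = 0 then (1 : ℝ) else 0) = (p : ℝ)⁻¹ := by
  rcases hv with rfl | rfl
  · rw [← expect_affine_eq_zero ((b : ZMod p) - (m s : ZMod p) * z (j s)) _ hm]
    refine expect_congr rfl fun u _ => ?_
    have : lin b m i j (update z (i s) u) s = b - m s * z (j s) + m s * u := by
      simp [lin, hij.symm]
      ring
    rw [this]
  · rw [← expect_affine_eq_zero ((b : ZMod p) + (m s : ZMod p) * z (i s)) _ (neg_ne_zero.2 hm)]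
    refine expect_congr rfl fun u _ => ?_
    have : lin b m i j (update z (j s) u) s = b + m s * z (i s) + -m s * u := by
      simp [lin, hij]
      ring
    rw [this]

variable [Fintype V]

lemma dens_eq [NeZero p] (T : Finset S) :
    dens b m i j p T = 𝔼 z : V → ZMod p, if ∀ s ∈ T, lin b m i j z s = 0 then (1 : ℝ) else 0 := by
  rw [Fintype.expect_eq_sum_div_card, dens, Nat.card_eq_fintype_card, Fintype.card_subtype,
    sum_boole, Fintype.card_fun, ZMod.card]
  push_cast
  rfl

lemma dens_empty [NeZero p] : dens b m i j p ∅ = 1 := by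
  rw [dens_eq]
  simp [expect_const univ_nonempty]

lemma dens_singleton [Fact p.Prime] {s : S} (hm : ((m s : ℤ) : ZMod p) ≠ 0) (hij : i s ≠ j s) :
    dens b m i j p {s} = (p : ℝ)⁻¹ := by
  rw [dens_eq]
  simp only [mem_singleton, forall_eq]
  rw [← expect_update (fun z : V → ZMod p => if lin b m i j z s = 0 then (1 : ℝ) else 0) (i s),
    expect_comm]
  simp only [expect_update_lin hm hij (Or.inl rfl)]
  exact expect_const univ_nonempty _

lemma dens_le [Fact p.Prime] (hm : ∀ s, ((m s : ℤ) : ZMod p) ≠ 0) (hij : ∀ s, i s ≠ j s)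
    (hdist : ∀ s t, s ≠ t → ∃ v, (v = i s ∨ v = j s) ∧ v ≠ i t ∧ v ≠ j t) {T : Finset S}
    (hT : 2 ≤ #T) : 0 ≤ dens b m i j p T ∧ dens b m i j p T ≤ ((p : ℝ)⁻¹) ^ 2 := by
  refine ⟨by rw [dens]; positivity, ?_⟩
  obtain ⟨s, hs, t, ht, hst⟩ := one_lt_card.1 hT
  obtain ⟨v, hv, hv1, hv2⟩ := hdist s t hst
  obtain ⟨w, hw, hw1, hw2⟩ := hdist t s hst.symm
  have hvw : v ≠ w := by
    rintro rfl
    rcases hv with h | h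
    · exact hw1 h
    · exact hw2 h
  rw [dens_eq]
  set f : S → (V → ZMod p) → ℝ := fun s z => if lin b m i j z s = 0 then 1 else 0 with hf
  calc 𝔼 z : V → ZMod p, (if ∀ s ∈ T, lin b m i j z s = 0 then (1 : ℝ) else 0)
      ≤ 𝔼 z, f s z * f t z := by
        refine expect_le_expect fun z _ => ?_
        by_cases h : ∀ s ∈ T, lin b m i j z s = 0
        · rw [if_pos h]
          simp [hf, h s hs, h t ht]
        · rw [if_neg h]
          simp only [hf]
          positivity
    _ = 𝔼 u, 𝔼 u', 𝔼 z, f s (update z v u) * f t (update z w u') := by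
      rw [← expect_update₂ _ v w]
      refine expect_congr rfl fun u _ => expect_congr rfl fun u' _ => expect_congr rfl fun z _ => ?_
      have h1 : f s (update (update z v u) w u') = f s (update z v u) := by
        simp only [hf]
        rw [lin_update hw1 hw2]
      have h2 : f t (update (update z v u) w u') = f t (update z w u') := by
        simp only [hf]
        rw [update_comm hvw, lin_update hv1 hv2]
      rw [h1, h2]
    _ = 𝔼 z, (𝔼 u, f s (update z v u)) * 𝔼 u', f t (update z w u') := by
      simp only [expect_mul_expect]
      rw [expect_congr rfl fun u _ => expect_comm _ _ _, expect_comm]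
    _ = ((p : ℝ)⁻¹) ^ 2 := by
      simp only [hf, expect_update_lin (hm s) (hij s) hv, expect_update_lin (hm t) (hij t) hw]
      rw [expect_const univ_nonempty, sq]

end LocalDensity

end PrimeProduct

namespace PrimeProduct

open Finset Function
open scoped BigOperators

section Majorant

variable {P : Finset ℕ} {R : ℕ}

lemma card_fam_le (hP : ∀ p ∈ P, p.Prime) : #(fam P R) ≤ R := by
  have h : #(fam P R) ≤ #(Icc 1 R) := by
    refine card_le_card_of_injOn (fun D => ∏ p ∈ D, p) (fun D hD => ?_) fun D hD D' hD' h => ?_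
    · have hDP := subset_of_mem_fam hD
      exact mem_coe.2 (mem_Icc.2 ⟨prod_pos fun p hp => (hP p (hDP hp)).pos, (mem_filter.1 hD).2⟩)
    · dsimp only at h
      rw [← Nat.primeFactors_prod fun p hp => hP p (subset_of_mem_fam hD hp), h,
        Nat.primeFactors_prod fun p hp => hP p (subset_of_mem_fam hD' hp)]
  simpa using h

lemma selH_le (hP : ∀ p ∈ P, p.Prime) : selH P R ≤ R := by
  have h : selH P R ≤ #(fam P R) * 1 := by
    rw [← nsmul_eq_mul]
    refine sum_le_card_nsmul _ _ _ fun D hD => inv_le_one_of_one_le₀ ?_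
    have h1 : ∏ p ∈ D, (1 : ℝ) ≤ phi D := prod_le_prod (fun _ _ => zero_le_one) fun p hp => by
      have : (2 : ℝ) ≤ p := by exact_mod_cast (hP p (subset_of_mem_fam hD hp)).two_le
      linarith
    simpa using h1
  have : (#(fam P R) : ℝ) ≤ R := by exact_mod_cast card_fam_le hP
  linarith

/-- The truncated divisor sum of the Selberg sieve. -/
noncomputable def selL (P : Finset ℕ) (R : ℕ) (z : ℤ) : ℝ :=
  ∑ D ∈ fam P R, selW P R D * if ∀ p ∈ D, (p : ℤ) ∣ z then 1 else 0

/-- The normalised Selberg majorant. -/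
noncomputable def selNu (P : Finset ℕ) (R : ℕ) (z : ℤ) : ℝ := selH P R * selL P R z ^ 2

variable {V S : Type} [Fintype S] [DecidableEq S]

lemma prod_selNu (y : S → ℤ) :
    ∏ s, selNu P R (y s) = selH P R ^ Fintype.card S *
      ∑ σ ∈ Fintype.piFinset fun _ : S => fam P R ×ˢ fam P R,
        (∏ s, (selW P R (σ s).1 * selW P R (σ s).2)) *
          ∏ p ∈ P, if ∀ s ∈ hit σ p, (p : ℤ) ∣ y s then 1 else 0 := by
  simp only [selNu]
  rw [prod_mul_distrib, prod_const, card_univ]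
  congr 1
  have h1 : ∀ s, selL P R (y s) ^ 2 = ∑ d ∈ fam P R ×ˢ fam P R, selW P R d.1 * selW P R d.2 *
      if ∀ p ∈ d.1 ∪ d.2, (p : ℤ) ∣ y s then 1 else 0 := by
    intro s
    rw [sq, selL, sum_mul_sum, sum_product]
    refine sum_congr rfl fun D _ => sum_congr rfl fun D' _ => ?_
    simp only [mem_union, or_imp, forall_and]
    by_cases h : ∀ p ∈ D, (p : ℤ) ∣ y s
    · by_cases h' : ∀ p ∈ D', (p : ℤ) ∣ y s
      · rw [if_pos h, if_pos h', if_pos ⟨h, h'⟩]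
        ring
      · rw [if_neg h', if_neg fun hh : (∀ p ∈ D, (p : ℤ) ∣ y s) ∧ _ => h' hh.2]
        ring
    · rw [if_neg h, if_neg fun hh : (∀ p ∈ D, (p : ℤ) ∣ y s) ∧ (∀ p ∈ D', (p : ℤ) ∣ y s) => h hh.1]
      ring
  simp only [h1]
  rw [prod_univ_sum (fun _ : S => fam P R ×ˢ fam P R)]
  refine sum_congr rfl fun σ hσ => ?_
  rw [prod_mul_distrib, prod_boole, prod_boole]
  congr 1
  have hσ' : ∀ s, ∀ p ∈ (σ s).1 ∪ (σ s).2, p ∈ P := by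
    intro s
    have h2 := mem_product.1 (Fintype.mem_piFinset.1 hσ s)
    exact fun p hp => union_subset (subset_of_mem_fam h2.1) (subset_of_mem_fam h2.2) hp
  have h3 : (∀ s ∈ univ, ∀ p ∈ (σ s).1 ∪ (σ s).2, (p : ℤ) ∣ y s) ↔
      ∀ p ∈ P, ∀ s ∈ hit σ p, (p : ℤ) ∣ y s :=
    ⟨fun h p _ s hs => h s (mem_univ _) p (mem_filter.1 hs).2,
      fun h s _ p hp => h p (hσ' s p hp) s (mem_filter.2 ⟨mem_univ _, hp⟩)⟩
  by_cases h : ∀ p ∈ P, ∀ s ∈ hit σ p, (p : ℤ) ∣ y s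
  · rw [if_pos h, if_pos (h3.2 h)]
  · rw [if_neg h, if_neg fun hh => h (h3.1 hh)]

lemma prod_hit_le (hP : ∀ p ∈ P, p.Prime) {σ : S → Finset ℕ × Finset ℕ}
    (hσ : σ ∈ Fintype.piFinset fun _ : S => fam P R ×ˢ fam P R) :
    ∏ p ∈ P with (hit σ p).Nonempty, p ≤ R ^ (2 * Fintype.card S) := by
  have hσ' : ∀ s, (σ s).1 ∈ fam P R ∧ (σ s).2 ∈ fam P R :=
    fun s => mem_product.1 (Fintype.mem_piFinset.1 hσ s)
  have h1 : ∀ p ∈ P, ∀ D : Finset ℕ, 1 ≤ if p ∈ D then p else 1 := fun p hp D => by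
    split_ifs
    · exact (hP p hp).one_le
    · exact le_rfl
  calc ∏ p ∈ P with (hit σ p).Nonempty, p
      = ∏ p ∈ P, if (hit σ p).Nonempty then p else 1 := by rw [prod_filter]
    _ ≤ ∏ p ∈ P, ∏ s, ((if p ∈ (σ s).1 then p else 1) * if p ∈ (σ s).2 then p else 1) := by
      refine prod_le_prod' fun p hp => ?_
      have h2 : ∀ s, 1 ≤ (if p ∈ (σ s).1 then p else 1) * if p ∈ (σ s).2 then p else 1 :=
        fun s => Nat.mul_pos (h1 p hp _) (h1 p hp _)
      split_ifs with h
      · obtain ⟨s, hs⟩ := h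
        refine le_trans ?_ (single_le_prod' (fun s _ => h2 s) (mem_univ s))
        have := mem_union.1 (mem_filter.1 hs).2
        rcases this with h | h
        · rw [if_pos h]
          exact Nat.le_mul_of_pos_right _ (h1 p hp _)
        · rw [if_pos h]
          exact Nat.le_mul_of_pos_left _ (h1 p hp _)
      · exact one_le_prod' fun s _ => h2 s
    _ = ∏ s, (∏ p ∈ (σ s).1, p) * ∏ p ∈ (σ s).2, p := by
      rw [prod_comm]
      refine prod_congr rfl fun s _ => ?_
      rw [prod_mul_distrib, ← prod_filter, ← prod_filter, filter_mem_eq_inter, filter_mem_eq_inter,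
        inter_eq_right.2 (subset_of_mem_fam (hσ' s).1),
        inter_eq_right.2 (subset_of_mem_fam (hσ' s).2)]
    _ ≤ ∏ _s : S, R * R := prod_le_prod' fun s _ =>
        Nat.mul_le_mul (mem_filter.1 (hσ' s).1).2 (mem_filter.1 (hσ' s).2).2
    _ = R ^ (2 * Fintype.card S) := by
      rw [prod_const, card_univ, ← sq, ← pow_mul]

variable [Fintype V] [DecidableEq V] {b : ℤ} {m : S → ℤ} {i j : S → V}

lemma abs_expect_hit_sub_le (hP : ∀ p ∈ P, p.Prime) {σ : S → Finset ℕ × Finset ℕ}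
    (hσ : σ ∈ Fintype.piFinset fun _ : S => fam P R ×ˢ fam P R) {N : ℕ} (hN : 0 < N) :
    |𝔼 x : V → Fin N, (∏ p ∈ P, if ∀ s ∈ hit σ p,
        (p : ℤ) ∣ lin b m i j (fun v => ((x v : ℕ) : ℤ)) s then (1 : ℝ) else 0) -
      ∏ p ∈ P, dens b m i j p (hit σ p)| ≤
      Real.exp (Fintype.card V * (R ^ (2 * Fintype.card S) / N)) - 1 := by
  set U : Finset ℕ := {p ∈ P | (hit σ p).Nonempty} with hU
  have hUP : ∀ p ∈ U, p.Prime := fun p hp => hP p (mem_filter.1 hp).1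
  have (p : U) : NeZero p.1 := ⟨(hUP p.1 p.2).ne_zero⟩
  have h := abs_expect_box_prod_sub_le (V := V) (fun p : U => p.1)
    (fun p q hpq => (Nat.coprime_primes (hUP _ p.2) (hUP _ q.2)).2 fun h => hpq (Subtype.ext h))
    (fun p z => if ∀ s ∈ hit σ p.1, lin b m i j z s = 0 then 1 else 0)
    (fun p z => by split_ifs <;> simp) N hN
  have h1 : ∀ x : V → Fin N, (∏ p ∈ P, if ∀ s ∈ hit σ p,
      (p : ℤ) ∣ lin b m i j (fun v => ((x v : ℕ) : ℤ)) s then (1 : ℝ) else 0) =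
      ∏ p : U, if ∀ s ∈ hit σ p.1,
        lin b m i j (fun v => ((x v : ℕ) : ZMod p.1)) s = 0 then (1 : ℝ) else 0 := by
    intro x
    rw [prod_coe_sort U (fun p : ℕ => if ∀ s ∈ hit σ p,
        lin b m i j (fun v => ((x v : ℕ) : ZMod p)) s = 0 then (1 : ℝ) else 0), hU, prod_filter]
    refine prod_congr rfl fun p _ => ?_
    have h2 : ∀ s, lin b m i j (fun v => ((x v : ℕ) : ZMod p)) s = 0 ↔
        (p : ℤ) ∣ lin b m i j (fun v => ((x v : ℕ) : ℤ)) s := fun s => by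
      rw [← ZMod.intCast_zmod_eq_zero_iff_dvd]
      have := map_lin (Int.castRingHom (ZMod p)) b m i j (fun v => ((x v : ℕ) : ℤ)) s
      simp only [eq_intCast, Int.cast_natCast] at this
      rw [this]
    simp only [h2]
    by_cases h3 : (hit σ p).Nonempty
    · rw [if_pos h3]
    · rw [if_neg h3, not_nonempty_iff_eq_empty.1 h3]
      simp
  have h2 : ∏ p ∈ P, dens b m i j p (hit σ p) = ∏ p : U, 𝔼 z : V → ZMod p.1,
      if ∀ s ∈ hit σ p.1, lin b m i j z s = 0 then (1 : ℝ) else 0 := by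
    have h3 : ∀ p : U, (𝔼 z : V → ZMod p.1,
        if ∀ s ∈ hit σ p.1, lin b m i j z s = 0 then (1 : ℝ) else 0) =
        dens b m i j p.1 (hit σ p.1) := fun p => by
      rw [dens_eq]
      refine expect_congr rfl fun z _ => ?_
      by_cases h4 : ∀ s ∈ hit σ p.1, lin b m i j z s = 0
      · rw [if_pos h4, if_pos h4]
      · rw [if_neg h4, if_neg h4]
    simp only [h3]
    rw [prod_coe_sort U (fun p : ℕ => dens b m i j p (hit σ p)), hU, prod_filter]
    refine prod_congr rfl fun p hp => ?_
    have : NeZero p := ⟨(hP p hp).ne_zero⟩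
    split_ifs with h3
    · rfl
    · rw [not_nonempty_iff_eq_empty.1 h3, dens_empty]
  simp only [h1, h2]
  refine h.trans ?_
  have h3 : ((∏ p : U, p.1 : ℕ) : ℝ) ≤ R ^ (2 * Fintype.card S) := by
    rw [prod_coe_sort U (fun p : ℕ => p)]
    exact_mod_cast prod_hit_le hP hσ
  gcongr

/-- The linear forms estimate for the Selberg majorant on a box. -/
theorem abs_expect_prod_selNu_sub_one_le (hP : ∀ p ∈ P, p.Prime) (hR : 1 ≤ R)
    (hm : ∀ p ∈ P, ∀ s, ((m s : ℤ) : ZMod p) ≠ 0) (hij : ∀ s, i s ≠ j s)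
    (hdist : ∀ s t, s ≠ t → ∃ v, (v = i s ∨ v = j s) ∧ v ≠ i t ∧ v ≠ j t) {N : ℕ} (hN : 0 < N) :
    |𝔼 x : V → Fin N, ∏ s, selNu P R (lin b m i j (fun v => ((x v : ℕ) : ℤ)) s) - 1| ≤
      (∏ p ∈ P, (1 + 64 ^ Fintype.card S * ((p : ℝ)⁻¹) ^ 2) - 1) + R ^ (5 * Fintype.card S) *
        (Real.exp (Fintype.card V * (R ^ (2 * Fintype.card S) / N)) - 1) := by
  have hP2 : ∀ p ∈ P, 2 ≤ p := fun p hp => (hP p hp).two_le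
  have hH0 : 0 < selH P R := by linarith [one_le_selH hP2 hR]
  set K := Fintype.card S with hK
  set err := Real.exp (Fintype.card V * (R ^ (2 * K) / N)) - 1 with herr
  have herr0 : 0 ≤ err := by
    rw [herr, sub_nonneg]
    exact Real.one_le_exp (by positivity)
  set F : Finset (S → Finset ℕ × Finset ℕ) := Fintype.piFinset fun _ => fam P R ×ˢ fam P R with hF
  set w : (S → Finset ℕ × Finset ℕ) → ℝ := fun σ => ∏ s, (selW P R (σ s).1 * selW P R (σ s).2)
    with hw
  set G : (S → Finset ℕ × Finset ℕ) → ℝ := fun σ => 𝔼 x : V → Fin N, (∏ p ∈ P,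
    if ∀ s ∈ hit σ p, (p : ℤ) ∣ lin b m i j (fun v => ((x v : ℕ) : ℤ)) s then (1 : ℝ) else 0)
    with hG
  have h1 : 𝔼 x : V → Fin N, ∏ s, selNu P R (lin b m i j (fun v => ((x v : ℕ) : ℤ)) s) =
      selH P R ^ K * ∑ σ ∈ F, w σ * G σ := by
    simp only [prod_selNu]
    rw [← mul_expect, expect_sum_comm]
    simp only [← mul_expect]
    rfl
  have h2 := abs_sum_tuples_sub_one_le (S := S) hP2 hR (dens b m i j)
    (fun p hp => by
      have : NeZero p := ⟨(hP p hp).ne_zero⟩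
      exact dens_empty)
    (fun p hp s => by
      have : Fact p.Prime := ⟨hP p hp⟩
      exact dens_singleton (hm p hp s) (hij s))
    (fun p hp T hT => by
      have : Fact p.Prime := ⟨hP p hp⟩
      exact dens_le (hm p hp) hij hdist hT)
  have h3 : ∑ σ ∈ tuples S P, (∏ s, (selW P R (σ s).1 * selW P R (σ s).2)) *
      ∏ p ∈ P, dens b m i j p (hit σ p) = ∑ σ ∈ F, w σ * ∏ p ∈ P, dens b m i j p (hit σ p) := by
    refine (sum_subset (fun σ hσ => ?_) fun σ _ hσ => ?_).symm
    · refine mem_tuples.2 fun s => ?_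
      have := mem_product.1 (Fintype.mem_piFinset.1 hσ s)
      exact ⟨subset_of_mem_fam this.1, subset_of_mem_fam this.2⟩
    · rw [hF, Fintype.mem_piFinset] at hσ
      push Not at hσ
      obtain ⟨s, hs⟩ := hσ
      have h4 : selW P R (σ s).1 * selW P R (σ s).2 = 0 := by
        by_cases h5 : (σ s).1 ∈ fam P R
        · rw [selW_eq_zero hP2 fun h => hs (mem_product.2 ⟨h5, h⟩), mul_zero]
        · rw [selW_eq_zero hP2 h5, zero_mul]
      rw [prod_eq_zero (mem_univ s) h4, zero_mul]
  rw [h3, ← hK] at h2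
  have h4 : |selH P R ^ K * ∑ σ ∈ F, w σ * G σ -
      selH P R ^ K * ∑ σ ∈ F, w σ * ∏ p ∈ P, dens b m i j p (hit σ p)| ≤ R ^ (5 * K) * err := by
    rw [← mul_sub, ← sum_sub_distrib, abs_mul, abs_of_pos (by positivity)]
    have h5 : ∀ σ ∈ F, |w σ * G σ - w σ * ∏ p ∈ P, dens b m i j p (hit σ p)| ≤
        ((R : ℝ) * R) ^ K * err := by
      intro σ hσ
      rw [← mul_sub, abs_mul]
      refine mul_le_mul ?_ (abs_expect_hit_sub_le hP hσ hN) (abs_nonneg _) (by positivity)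
      rw [hw, abs_prod, hK, ← card_univ, ← prod_const]
      refine prod_le_prod (fun _ _ => abs_nonneg _) fun s _ => ?_
      rw [abs_mul]
      exact mul_le_mul (abs_selW_le hP2 hR _) (abs_selW_le hP2 hR _) (abs_nonneg _) (by positivity)
    have hcard : (#F : ℝ) ≤ ((R : ℝ) * R) ^ K := by
      rw [hF, Fintype.card_piFinset, prod_const, card_univ, card_product, ← hK]
      have : (#(fam P R) : ℝ) ≤ R := by exact_mod_cast card_fam_le hP
      push_cast
      gcongr
    calc selH P R ^ K * |∑ σ ∈ F, (w σ * G σ - w σ * ∏ p ∈ P, dens b m i j p (hit σ p))|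
        ≤ R ^ K * ∑ σ ∈ F, ((R : ℝ) * R) ^ K * err := by
          have := selH_le (R := R) hP
          refine mul_le_mul ?_ ((abs_sum_le_sum_abs _ _).trans (sum_le_sum h5)) (abs_nonneg _)
            (by positivity)
          gcongr
      _ ≤ R ^ K * (((R : ℝ) * R) ^ K * (((R : ℝ) * R) ^ K * err)) := by
        rw [sum_const, nsmul_eq_mul]
        gcongr
      _ = R ^ (5 * K) * err := by ring
  rw [h1]
  have h5 := abs_add_le (selH P R ^ K * ∑ σ ∈ F, w σ * G σ -
    selH P R ^ K * ∑ σ ∈ F, w σ * ∏ p ∈ P, dens b m i j p (hit σ p))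
    (selH P R ^ K * ∑ σ ∈ F, w σ * ∏ p ∈ P, dens b m i j p (hit σ p) - 1)
  rw [sub_add_sub_cancel] at h5
  linarith

end Majorant

end PrimeProduct

namespace PrimeProduct

open Finset Function
open scoped BigOperators

section LinearForms

variable {I : Type} [LinearOrder I] [Fintype I] {E : Finset (I × I)} {P : Finset ℕ} {R N : ℕ}

lemma exists_variable_of_ne (hE : Ordered E) {s t : (I × I) × Bool × Bool} (hs : s.1 ∈ E)
    (ht : t.1 ∈ E) (hst : s ≠ t) : ∃ v, (v = (s.2.1, s.1.1) ∨ v = (s.2.2, s.1.2)) ∧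
      v ≠ (t.2.1, t.1.1) ∧ v ≠ (t.2.2, t.1.2) := by
  have h1 := hE _ hs
  have h2 := hE _ ht
  obtain ⟨⟨s1, s2⟩, s3, s4⟩ := s
  obtain ⟨⟨t1, t2⟩, t3, t4⟩ := t
  dsimp only at h1 h2 ⊢
  by_contra! h
  have h3 := h _ (Or.inl rfl)
  have h4 := h _ (Or.inr rfl)
  simp only [ne_eq, Prod.mk.injEq] at h3 h4 hst
  have h5 : s1 = t2 → s2 = t1 → False := fun h5 h6 => by
    rw [h5, h6] at h1
    exact h1.not_gt h2
  by_cases h6 : s3 = t3 ∧ s1 = t1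
  · by_cases h7 : s4 = t3 ∧ s2 = t1
    · exact h1.ne (h6.2.trans h7.2.symm)
    · have := h4 h7
      tauto
  · have h7 := h3 h6
    by_cases h8 : s4 = t3 ∧ s2 = t1
    · exact h5 h7.2 h8.2
    · exact h1.ne (h7.2.trans (h4 h8).2.symm)

lemma abs_expect_mon_sub_one_le (hE : Ordered E) (hP : ∀ p ∈ P, p.Prime) (hR : 1 ≤ R) (hN : 0 < N)
    (b : ℤ) (m : I × I → ℤ) (hm : ∀ p ∈ P, ∀ e ∈ E, ((m e : ℤ) : ZMod p) ≠ 0)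
    (S : Finset ((I × I) × Bool × Bool)) (hS : ∀ s ∈ S, s.1 ∈ E) :
    |𝔼 z : Bool × I → Fin N, mon (fun e (x y : Fin N) => selNu P R
        (b + m e * (((x : ℕ) : ℤ) - ((y : ℕ) : ℤ)))) S z - 1| ≤
      (∏ p ∈ P, (1 + 64 ^ #S * ((p : ℝ)⁻¹) ^ 2) - 1) + R ^ (5 * #S) *
        (Real.exp (Fintype.card (Bool × I) * (R ^ (2 * #S) / N)) - 1) := by
  have h := abs_expect_prod_selNu_sub_one_le (V := Bool × I) (S := S) (P := P) (R := R)
    (b := b) (m := fun s => m s.1.1) (i := fun s => (s.1.2.1, s.1.1.1))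
    (j := fun s => (s.1.2.2, s.1.1.2)) hP hR (fun p hp s => hm p hp _ (hS s.1 s.2))
    (fun s h => by
      have := hE _ (hS s.1 s.2)
      rw [(Prod.mk.inj h).2] at this
      exact this.false)
    (fun s t hst => exists_variable_of_ne hE (hS _ s.2) (hS _ t.2) fun h => hst (Subtype.ext h))
    hN
  rw [Fintype.card_coe] at h
  refine le_trans (le_of_eq ?_) h
  congr 2
  refine expect_congr rfl fun z _ => ?_
  rw [mon, ← prod_coe_sort]
  rfl

lemma lfc_selNu (hE : Ordered E) (hP : ∀ p ∈ P, p.Prime) (hR : 1 ≤ R) (hN : 0 < N)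
    (b : ℤ) (m : I × I → ℤ) (hm : ∀ p ∈ P, ∀ e ∈ E, ((m e : ℤ) : ZMod p) ≠ 0) {K : ℕ}
    (hK : Fintype.card ((I × I) × Bool × Bool) ≤ K) :
    LFC E (fun e (x y : Fin N) => selNu P R (b + m e * (((x : ℕ) : ℤ) - ((y : ℕ) : ℤ))))
      ((∏ p ∈ P, (1 + 64 ^ K * ((p : ℝ)⁻¹) ^ 2) - 1) + R ^ (5 * K) *
        (Real.exp (Fintype.card (Bool × I) * (R ^ (2 * K) / N)) - 1)) := by
  intro S hS
  refine (abs_expect_mon_sub_one_le hE hP hR hN b m hm S hS).trans ?_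
  have hSK : #S ≤ K := (card_le_univ S).trans hK
  have hR' : (1 : ℝ) ≤ R := by exact_mod_cast hR
  have h1 : (0 : ℝ) ≤ Real.exp (Fintype.card (Bool × I) * (R ^ (2 * #S) / N)) - 1 := by
    rw [sub_nonneg]
    exact Real.one_le_exp (by positivity)
  have h2 : (0 : ℝ) ≤ (Fintype.card (Bool × I) : ℝ) := Nat.cast_nonneg _
  generalize (Fintype.card (Bool × I) : ℝ) = v at *
  gcongr
  · norm_num

lemma prod_one_add_le {w : ℕ} (hw : 0 < w) {c : ℝ} (hc : 0 ≤ c) (hP : ∀ p ∈ P, w < p) :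
    ∏ p ∈ P, (1 + c * ((p : ℝ)⁻¹) ^ 2) ≤ Real.exp (c / w) := by
  have h1 : ∑ p ∈ P, ((p : ℝ)⁻¹) ^ 2 ≤ 1 / w := by
    have h2 : ∀ n : ℕ, ∑ p ∈ Ioc w (w + n), ((p : ℝ)⁻¹) ^ 2 ≤ 1 / w - 1 / (w + n : ℕ) := by
      intro n
      induction n with
      | zero => simp
      | succ n ih =>
        rw [← add_assoc, sum_Ioc_succ_top (by omega)]
        have h3 : (0 : ℝ) < (w + n : ℕ) := by exact_mod_cast (by omega)
        have h4 : (((w + n + 1 : ℕ) : ℝ)⁻¹) ^ 2 ≤ 1 / (w + n : ℕ) - 1 / (w + n + 1 : ℕ) := by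
          rw [Nat.cast_add (w + n), Nat.cast_one, div_sub_div _ _ h3.ne' (by positivity), inv_pow,
            inv_eq_one_div, div_le_div_iff₀ (by positivity) (by positivity)]
          nlinarith
        linarith
    obtain ⟨M, hM⟩ := P.exists_nat_subset_range
    have h3 : P ⊆ Ioc w (w + M) := fun p hp => mem_Ioc.2 ⟨hP p hp, by
      have := mem_range.1 (hM hp)
      omega⟩
    refine (sum_le_sum_of_subset_of_nonneg h3 fun _ _ _ => by positivity).trans ((h2 M).trans ?_)
    have : (0 : ℝ) ≤ 1 / (w + M : ℕ) := by positivity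
    linarith
  calc ∏ p ∈ P, (1 + c * ((p : ℝ)⁻¹) ^ 2) ≤ ∏ p ∈ P, Real.exp (c * ((p : ℝ)⁻¹) ^ 2) :=
        prod_le_prod (fun _ _ => by positivity) fun p _ => by
          rw [add_comm]
          exact Real.add_one_le_exp _
    _ = Real.exp (c * ∑ p ∈ P, ((p : ℝ)⁻¹) ^ 2) := by rw [← Real.exp_sum, mul_sum]
    _ ≤ Real.exp (c / w) := by
      rw [Real.exp_le_exp, div_eq_mul_one_div]
      gcongr

lemma pow_mul_exp_sub_one_le {v : ℝ} (hv : 0 ≤ v) {K A : ℕ} (hA : 7 * K + 1 ≤ A) (hR : 1 ≤ R)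
    (hvR : v ≤ R) :
    R ^ (5 * K) * (Real.exp (v * (R ^ (2 * K) / (R ^ A : ℕ))) - 1) ≤ 2 * v / R := by
  have hR' : (1 : ℝ) ≤ R := by exact_mod_cast hR
  have hR0 : (0 : ℝ) < R := by linarith
  have h1 : v * ((R : ℝ) ^ (2 * K) / (R ^ A : ℕ)) ≤ v / R / R ^ (5 * K) := by
    have h2 : v * ((R : ℝ) ^ (2 * K) / (R ^ (7 * K + 1) : ℕ)) = v / R / R ^ (5 * K) := by
      rw [show 7 * K + 1 = 2 * K + 5 * K + 1 by ring]
      push_cast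
      rw [pow_add, pow_add]
      field_simp
    rw [← h2]
    gcongr
  refine le_trans (b := (R : ℝ) ^ (5 * K) * (Real.exp (v / R / R ^ (5 * K)) - 1)) (by gcongr) ?_
  set x := v / R / (R : ℝ) ^ (5 * K) with hx
  have hx0 : 0 ≤ x := by positivity
  have hx1 : x ≤ 1 := by
    rw [hx]
    refine div_le_one_of_le₀ (le_trans ?_ (one_le_pow₀ hR')) (by positivity)
    exact div_le_one_of_le₀ hvR hR0.le
  have h2 : Real.exp x - 1 ≤ 2 * x := by
    have := Real.abs_exp_sub_one_le (x := x) (by rwa [abs_of_nonneg hx0])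
    rw [abs_of_nonneg hx0] at this
    exact (le_abs_self _).trans this
  calc (R : ℝ) ^ (5 * K) * (Real.exp x - 1) ≤ R ^ (5 * K) * (2 * x) := by gcongr
    _ = 2 * v / R := by
      rw [hx]
      field_simp

/-- The Selberg majorants satisfy the linear forms condition once the sieving parameters are
large enough. -/
theorem exists_lfc_selNu (hE : Ordered E) {A : ℕ}
    (hA : 7 * Fintype.card ((I × I) × Bool × Bool) + 1 ≤ A) {δ : ℝ} (hδ : 0 < δ) :
    ∃ w₀ R₀ : ℕ, ∀ w ≥ w₀, ∀ R ≥ R₀, ∀ P : Finset ℕ, (∀ p ∈ P, p.Prime ∧ w < p) →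
      ∀ (b : ℤ) (m : I × I → ℤ), (∀ p ∈ P, ∀ e ∈ E, ((m e : ℤ) : ZMod p) ≠ 0) →
        LFC E (fun e (x y : Fin (R ^ A)) => selNu P R
          (b + m e * (((x : ℕ) : ℤ) - ((y : ℕ) : ℤ)))) δ := by
  set K := Fintype.card ((I × I) × Bool × Bool) with hK
  set v : ℝ := (Fintype.card (Bool × I) : ℝ) with hv
  have hv0 : 0 ≤ v := hv ▸ Nat.cast_nonneg _
  obtain ⟨ε, hε, hε'⟩ : ∃ ε > 0, Real.exp ε - 1 ≤ δ / 2 := by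
    refine ⟨Real.log (1 + δ / 2), Real.log_pos (by linarith), ?_⟩
    rw [Real.exp_log (by linarith)]
    linarith
  refine ⟨⌈(64 : ℝ) ^ K / ε⌉₊ + 1, ⌈v⌉₊ + ⌈4 * v / δ⌉₊ + 1,
    fun w hw R hR P hP b m hm => ?_⟩
  have hR1 : 1 ≤ R := by omega
  have hw0 : 0 < w := by omega
  have hR0 : (0 : ℝ) < R := by exact_mod_cast hR1
  have hw0' : (0 : ℝ) < w := by exact_mod_cast hw0
  intro S hS
  refine (lfc_selNu (N := R ^ A) hE (fun p hp => (hP p hp).1) hR1 (by positivity) b m hm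
    hK.ge S hS).trans ?_
  have hvR : v ≤ R := (Nat.le_ceil v).trans (by exact_mod_cast (by omega))
  have h1 := pow_mul_exp_sub_one_le hv0 hA hR1 hvR
  have h2 : 2 * v / R ≤ δ / 2 := by
    have h3 : 4 * v / δ ≤ R := (Nat.le_ceil _).trans (by exact_mod_cast (by omega))
    rw [div_le_iff₀ hδ] at h3
    rw [div_le_iff₀ hR0]
    linarith
  have h3 := prod_one_add_le (c := 64 ^ K) hw0 (by positivity) fun p hp => (hP p hp).2
  have h4 : Real.exp (64 ^ K / w) ≤ Real.exp ε := by
    rw [Real.exp_le_exp, div_le_iff₀ hw0']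
    have h5 : (64 : ℝ) ^ K / ε ≤ w := (Nat.le_ceil _).trans (Nat.cast_le.2 (by omega))
    rw [div_le_iff₀ hε] at h5
    linarith
  linarith

end LinearForms

end PrimeProduct

namespace PrimeProduct

open Finset Function
open scoped BigOperators

section SieveSum

lemma sum_inv_le_of_factored {D T : Finset ℕ} (hD : ∀ p ∈ D, p.Prime)
    (hT : ∀ m ∈ T, m ∈ Nat.factoredNumbers D) :
    ∑ m ∈ T, (m : ℝ)⁻¹ ≤ ∏ p ∈ D, (1 - (p : ℝ)⁻¹)⁻¹ := by
  set f : ℕ →* ℝ := (invMonoidHom (α := ℝ)).comp (Nat.castRingHom ℝ).toMonoidHom with hf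
  have hf1 : ∀ n : ℕ, f n = (n : ℝ)⁻¹ := fun n => rfl
  have h := (EulerProduct.summable_and_hasSum_factoredNumbers_prod_filter_prime_geometric (f := f)
    (fun {p} hp => by
      rw [hf1, norm_inv, Real.norm_natCast]
      exact inv_lt_one_of_one_lt₀ (by exact_mod_cast hp.one_lt)) D).2
  rw [filter_true_of_mem hD] at h
  have h1 := sum_le_hasSum (T.subtype (· ∈ Nat.factoredNumbers D))
    (fun m _ => by rw [hf1]; positivity) h
  simp only [hf1] at h1
  rwa [sum_subtype_of_mem (fun m : ℕ => (m : ℝ)⁻¹) hT] at h1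

lemma mem_fam_primeFactors {P : Finset ℕ} {R n : ℕ} (hn : n ∈ Icc 1 R) :
    n.primeFactors ∩ P ∈ fam P R := by
  have h := mem_Icc.1 hn
  refine mem_filter.2 ⟨mem_powerset.2 inter_subset_right, ?_⟩
  exact (Nat.le_of_dvd h.1 ((prod_dvd_prod_of_subset _ _ _ inter_subset_left).trans
    (Nat.prod_primeFactors_dvd n))).trans h.2

lemma log_mul_le_selH {P Q : Finset ℕ} {R : ℕ} (hP : ∀ p ∈ P, p.Prime) (hQ : ∀ p ∈ Q, p.Prime)
    (hPQ : Disjoint P Q) (hR : ∀ p, p.Prime → p ≤ R → p ∈ P ∨ p ∈ Q) :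
    Real.log (R + 1) * ∏ p ∈ Q, (1 - (p : ℝ)⁻¹) ≤ selH P R := by
  have hinv : ∀ p : ℕ, p.Prime → (0 : ℝ) < 1 - (p : ℝ)⁻¹ := fun p hp => by
    rw [sub_pos]
    exact inv_lt_one_of_one_lt₀ (by exact_mod_cast hp.one_lt)
  have h1 : Real.log (R + 1) ≤ ∑ n ∈ Icc 1 R, (n : ℝ)⁻¹ := by
    have := log_add_one_le_harmonic R
    rw [harmonic_eq_sum_Icc] at this
    push_cast at this
    exact this
  have h2 : ∀ D ∈ fam P R, ∑ n ∈ Icc 1 R with n.primeFactors ∩ P = D, (n : ℝ)⁻¹ ≤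
      (phi D)⁻¹ * ∏ p ∈ Q, (1 - (p : ℝ)⁻¹)⁻¹ := by
    intro D hD
    have hDP := subset_of_mem_fam hD
    have hDp : ∀ p ∈ D, p.Prime := fun p hp => hP p (hDP hp)
    set d := ∏ p ∈ D, p with hd
    have hd0 : 0 < d := prod_pos fun p hp => (hDp p hp).pos
    have hdvd : ∀ n ∈ ({n ∈ Icc 1 R | n.primeFactors ∩ P = D} : Finset ℕ), d ∣ n := by
      intro n hn
      rw [hd, ← (mem_filter.1 hn).2]
      exact (prod_dvd_prod_of_subset _ _ _ inter_subset_left).trans (Nat.prod_primeFactors_dvd n)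
    have h3 : ∑ n ∈ Icc 1 R with n.primeFactors ∩ P = D, (n : ℝ)⁻¹ =
        (d : ℝ)⁻¹ * ∑ m ∈ ({n ∈ Icc 1 R | n.primeFactors ∩ P = D} : Finset ℕ).image (· / d),
          (m : ℝ)⁻¹ := by
      rw [sum_image, mul_sum]
      · refine sum_congr rfl fun n hn => ?_
        obtain ⟨m, rfl⟩ := hdvd n hn
        rw [Nat.mul_div_cancel_left _ hd0]
        push_cast
        rw [mul_inv]
      · intro n hn n' hn' h
        rw [← Nat.div_mul_cancel (hdvd n hn), ← Nat.div_mul_cancel (hdvd n' hn')]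
        exact congrArg (· * d) h
    have h4 : ∑ m ∈ ({n ∈ Icc 1 R | n.primeFactors ∩ P = D} : Finset ℕ).image (· / d),
        (m : ℝ)⁻¹ ≤ ∏ p ∈ D ∪ Q, (1 - (p : ℝ)⁻¹)⁻¹ := by
      refine sum_inv_le_of_factored (fun p hp => ?_) fun m hm => ?_
      · rcases mem_union.1 hp with h | h
        · exact hDp p h
        · exact hQ p h
      · obtain ⟨n, hn, rfl⟩ := mem_image.1 hm
        have hn' := mem_filter.1 hn
        have hn0 := mem_Icc.1 hn'.1
        rw [Nat.mem_factoredNumbers']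
        intro p hp hpn
        have hpn' : p ∣ n := hpn.trans (Nat.div_dvd_of_dvd (hdvd n hn))
        refine mem_union.2 ?_
        rcases hR p hp ((Nat.le_of_dvd hn0.1 hpn').trans hn0.2) with h | h
        · left
          rw [← hn'.2]
          exact mem_inter.2 ⟨Nat.mem_primeFactors.2 ⟨hp, hpn', by omega⟩, h⟩
        · exact Or.inr h
    rw [h3]
    refine (mul_le_mul_of_nonneg_left h4 (by positivity)).trans (le_of_eq ?_)
    rw [prod_union (disjoint_of_subset_left hDP hPQ), ← mul_assoc]
    congr 1
    rw [hd, Nat.cast_prod, phi, ← prod_inv_distrib, ← prod_inv_distrib, ← prod_mul_distrib]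
    refine prod_congr rfl fun p hp => ?_
    have hp0 : (0 : ℝ) < p := by exact_mod_cast (hDp p hp).pos
    rw [← mul_inv, mul_sub, mul_one, mul_inv_cancel₀ hp0.ne']
  have h5 : Real.log (R + 1) ≤ selH P R * ∏ p ∈ Q, (1 - (p : ℝ)⁻¹)⁻¹ := by
    refine h1.trans ?_
    rw [← sum_fiberwise_of_maps_to (t := fam P R) (g := fun n => n.primeFactors ∩ P)
      fun n hn => mem_fam_primeFactors hn, selH, sum_mul]
    exact sum_le_sum h2
  have hQ0 : 0 < ∏ p ∈ Q, (1 - (p : ℝ)⁻¹) := prod_pos fun p hp => hinv p (hQ p hp)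
  rwa [prod_inv_distrib, ← div_eq_mul_inv, le_div_iff₀ hQ0] at h5

lemma primeFactors_factorial_sq (w : ℕ) :
    (w.factorial ^ 2).primeFactors = {p ∈ range (w + 1) | p.Prime} := by
  ext p
  rw [Nat.primeFactors_pow _ two_ne_zero, Nat.mem_primeFactors, mem_filter, mem_range]
  constructor
  · rintro ⟨hp, h, -⟩
    exact ⟨Nat.lt_succ_of_le ((hp.dvd_factorial).1 h), hp⟩
  · rintro ⟨h, hp⟩
    exact ⟨hp, (hp.dvd_factorial).2 (Nat.le_of_lt_succ h), Nat.factorial_ne_zero w⟩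

lemma log_mul_totient_le (w R : ℕ) :
    Real.log (R + 1) * ((w.factorial ^ 2).totient : ℝ) ≤
      selH {p ∈ Ioc w R | p.Prime} R * (w.factorial ^ 2 : ℕ) := by
  set Q : Finset ℕ := {p ∈ range (w + 1) | p.Prime} with hQ
  have h := log_mul_le_selH (P := {p ∈ Ioc w R | p.Prime}) (Q := Q) (R := R)
    (fun p hp => (mem_filter.1 hp).2) (fun p hp => (mem_filter.1 hp).2)
    (disjoint_left.2 fun p hp hp' => by
      have h1 := (mem_Ioc.1 (mem_filter.1 hp).1).1
      have h2 := mem_range.1 (mem_filter.1 hp').1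
      omega)
    (fun p hp hpR => by
      by_cases h : p ≤ w
      · exact Or.inr (mem_filter.2 ⟨mem_range.2 (by omega), hp⟩)
      · exact Or.inl (mem_filter.2 ⟨mem_Ioc.2 ⟨by omega, hpR⟩, hp⟩))
  have h1 := Nat.totient_eq_mul_prod_factors (w.factorial ^ 2)
  rw [primeFactors_factorial_sq] at h1
  have h2 : ((w.factorial ^ 2).totient : ℝ) =
      (w.factorial ^ 2 : ℕ) * ∏ p ∈ Q, (1 - (p : ℝ)⁻¹) := by
    have h3 := congrArg (fun q : ℚ => (q : ℝ)) h1
    push_cast at h3 ⊢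
    exact h3
  rw [h2]
  have h3 : (0 : ℝ) ≤ (w.factorial ^ 2 : ℕ) := Nat.cast_nonneg _
  nlinarith [mul_le_mul_of_nonneg_left h h3]

end SieveSum

end PrimeProduct

namespace PrimeProduct

open Finset Function
open scoped BigOperators

section Progression

lemma eventually_log_le {c : ℝ} (hc : 0 < c) : ∀ᶠ n : ℕ in Filter.atTop, Real.log n ≤ c * n := by
  have h := (Real.isLittleO_log_id_atTop.comp_tendsto tendsto_natCast_atTop_atTop).bound hc
  filter_upwards [h] with n hn
  simp only [Function.comp_apply, id, Real.norm_eq_abs, Nat.abs_cast] at hn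
  exact (le_abs_self _).trans hn

lemma eventually_div_log_le_primeCounting :
    ∀ᶠ n : ℕ in Filter.atTop, (n : ℝ) / (2 * Real.log n) ≤ n.primeCounting := by
  filter_upwards [eventually_log_le (c := 1 / 20) (by norm_num), Filter.eventually_ge_atTop 20]
    with n hn hn20
  have hn20' : (20 : ℝ) ≤ n := by exact_mod_cast hn20
  have hlog : 0 < Real.log n := Real.log_pos (by linarith)
  refine le_trans ?_ (Chebyshev.pi_ge n)
  rw [div_le_div_iff₀ (by positivity) hlog]
  have h1 : Real.log (n + 1) ≤ Real.log n + Real.log 2 := by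
    rw [← Real.log_mul (by positivity) (by norm_num)]
    exact Real.log_le_log (by positivity) (by linarith)
  have h2 := Real.log_two_gt_d9
  have h3 := Real.log_two_lt_d9
  have h4 : (n : ℝ) * (1 / 2) ≤ n * Real.log 2 - Real.log (n + 1) := by nlinarith
  nlinarith

lemma exists_residue_class {W : ℕ} (hW : 0 < W) (M R : ℕ) :
    ∃ b : ℕ, b.Coprime W ∧ (Nat.primeCounting' (W * M) : ℝ) ≤
      W.totient * #{u ∈ range M | (b + W * u).Prime ∧ R < b + W * u} + W + R := by
  set T : Finset ℕ := {p ∈ range (W * M) | p.Prime ∧ W < p ∧ R < p} with hT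
  have h1 : Nat.primeCounting' (W * M) ≤ #T + W + R := by
    rw [Nat.primeCounting', Nat.count_eq_card_filter_range]
    have h2 : ({p ∈ range (W * M) | p.Prime} : Finset ℕ) ⊆ T ∪ Icc 1 W ∪ Icc 1 R := by
      intro p hp
      have hp' := mem_filter.1 hp
      have := hp'.2.pos
      simp only [hT, mem_union, mem_filter, mem_Icc]
      by_cases h3 : W < p
      · by_cases h4 : R < p
        · exact Or.inl (Or.inl ⟨hp'.1, hp'.2, h3, h4⟩)
        · exact Or.inr ⟨this, by omega⟩
      · exact Or.inl (Or.inr ⟨this, by omega⟩)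
    refine (card_le_card h2).trans ((card_union_le _ _).trans ?_)
    have := card_union_le T (Icc 1 W)
    simp only [Nat.card_Icc] at this ⊢
    omega
  have hφ : (0 : ℝ) < W.totient := by exact_mod_cast Nat.totient_pos.2 hW
  set B : Finset ℕ := {b ∈ range W | W.Coprime b} with hB
  have hBc : #B = W.totient := rfl
  obtain ⟨b, hb, hbT⟩ := exists_le_card_fiber_of_nsmul_le_card_of_maps_to (s := T) (t := B)
    (f := (· % W)) (b := (#T : ℝ) / W.totient) (fun p hp => by
      obtain ⟨-, hp1, hp2, -⟩ := mem_filter.1 hp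
      refine mem_filter.2 ⟨mem_range.2 (Nat.mod_lt _ hW), ?_⟩
      have : p.Coprime W := ((hp1.coprime_iff_not_dvd).2 fun h => (Nat.le_of_dvd hW h).not_gt hp2)
      rw [Nat.coprime_iff_gcd_eq_one, Nat.gcd_comm, ← Nat.gcd_rec, Nat.gcd_comm]
      exact this)
    (card_pos.1 (by rw [hBc]; exact Nat.totient_pos.2 hW))
    (by rw [hBc, nsmul_eq_mul, mul_div_cancel₀ _ hφ.ne'])
  refine ⟨b, (mem_filter.1 hb).2.symm, ?_⟩
  have h2 : #{p ∈ T | p % W = b} ≤ #{u ∈ range M | (b + W * u).Prime ∧ R < b + W * u} := by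
    refine card_le_card_of_injOn (· / W) (fun p hp => ?_) fun p hp q hq h => ?_
    · obtain ⟨hp1, hp2⟩ := mem_filter.1 hp
      obtain ⟨hp3, hp4, -, hp5⟩ := mem_filter.1 hp1
      have : b + W * (p / W) = p := by rw [← hp2, Nat.mod_add_div]
      simp only [coe_filter, Set.mem_ofPred_eq, this, mem_range]
      exact ⟨Nat.div_lt_of_lt_mul (mem_range.1 hp3), hp4, hp5⟩
    · dsimp only at h
      rw [← Nat.mod_add_div p W, ← Nat.mod_add_div q W, (mem_filter.1 hp).2, (mem_filter.1 hq).2, h]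
  have h3 : (#T : ℝ) ≤
      W.totient * #{u ∈ range M | (b + W * u).Prime ∧ R < b + W * u} := by
    rw [div_le_iff₀ hφ] at hbT
    refine hbT.trans ?_
    rw [mul_comm]
    gcongr
  have h4 : (Nat.primeCounting' (W * M) : ℝ) ≤ #T + W + R := by exact_mod_cast h1
  linarith

/-- Some reduced residue class modulo `w! ^ 2` contains many primes, on the scale of the
normalising sum of the sieve. -/
lemma exists_dense_progression {r A : ℕ} (hr : 0 < r) (hA : 2 ≤ A) (w : ℕ) :
    ∃ R₁ : ℕ, ∀ R ≥ R₁, ∃ b : ℕ, b.Coprime (w.factorial ^ 2) ∧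
      1 / (32 * r * (A + 1)) * (R ^ A : ℕ) ≤ selH {p ∈ Ioc w R | p.Prime} R *
        #{u ∈ range (R ^ A / (2 * r)) |
          (b + w.factorial ^ 2 * u).Prime ∧ R < b + w.factorial ^ 2 * u} := by
  set W := w.factorial ^ 2 with hW
  have hW0 : 0 < W := by positivity
  obtain ⟨n₀, hn₀⟩ := Filter.eventually_atTop.1 eventually_div_log_le_primeCounting
  have hr' : (0 : ℝ) < r := by exact_mod_cast hr
  obtain ⟨R₂, hR₂⟩ := Filter.eventually_atTop.1
    (eventually_log_le (c := 1 / (64 * r * (A + 1))) (by positivity))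
  refine ⟨W + 2 + 8 * r * (n₀ + 2) + R₂, fun R hR => ?_⟩
  have hRlog := hR₂ R (by omega)
  have hRW : W ≤ R := by
    have : 0 ≤ 8 * r * (n₀ + 2) := Nat.zero_le _
    omega
  have hR2 : 2 ≤ R := by
    have : 0 ≤ 8 * r * (n₀ + 2) := Nat.zero_le _
    omega
  have hRr : 8 * r * (n₀ + 2) ≤ R := by omega
  set N := R ^ A with hN
  set M := N / (2 * r) with hM
  have hNR : R * R ≤ N := by
    rw [hN, ← sq]
    exact Nat.pow_le_pow_right (by omega) hA
  have hN4 : 4 * r * (n₀ + 2) * 2 ≤ N := by nlinarith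
  have hM1 : N ≤ 4 * r * M := by
    have h1 : N < 2 * r * (M + 1) := by
      rw [mul_comm]
      exact Nat.lt_mul_of_div_lt (Nat.lt_succ_self _) (by omega)
    have h2 : 1 ≤ M := (Nat.one_le_div_iff (by omega)).2 (by nlinarith)
    nlinarith
  have hMn : 2 * (n₀ + 2) ≤ M := by nlinarith
  have hMN : M ≤ N := Nat.div_le_self _ _
  obtain ⟨b, hb, hbS⟩ := exists_residue_class hW0 M R
  refine ⟨b, hb, ?_⟩
  set S := #{u ∈ range M | (b + W * u).Prime ∧ R < b + W * u} with hS
  obtain ⟨n, hn⟩ : ∃ n, W * M = n + 1 := ⟨W * M - 1, by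
    have : 0 < W * M := Nat.mul_pos hW0 (by omega)
    omega⟩
  have hWM : M ≤ W * M := Nat.le_mul_of_pos_left _ hW0
  have hnn : n₀ ≤ n := by omega
  have hpi := hn₀ n hnn
  rw [hn] at hbS
  change (n.primeCounting : ℝ) ≤ _ at hbS
  set l := Real.log R with hl
  have hR2' : (2 : ℝ) ≤ R := by exact_mod_cast hR2
  have hl0 : 0 < l := Real.log_pos (by linarith)
  have hn2 : (2 : ℝ) ≤ n := by exact_mod_cast (by omega)
  have hlogn : Real.log n ≤ (A + 1) * l := by
    have h1 : n ≤ R ^ (A + 1) := by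
      rw [pow_succ', ← hN]
      have := Nat.mul_le_mul hRW hMN
      omega
    have h2 : (n : ℝ) ≤ (R : ℝ) ^ (A + 1) := by exact_mod_cast h1
    calc Real.log n ≤ Real.log ((R : ℝ) ^ (A + 1)) := Real.log_le_log (by linarith) h2
      _ = (A + 1) * l := by
        rw [Real.log_pow]
        push_cast
        rfl
  have hlogn0 : 0 < Real.log n := Real.log_pos (by linarith)
  have hφ : (0 : ℝ) ≤ W.totient := Nat.cast_nonneg _
  have hW0' : (0 : ℝ) < W := by exact_mod_cast hW0
  have hN0 : (0 : ℝ) ≤ N := Nat.cast_nonneg _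
  have h1 : (W : ℝ) * N / (8 * r) ≤ n := by
    rw [div_le_iff₀ (by positivity)]
    have h2 : W * N ≤ 8 * r * n := by
      have h3 : W * N ≤ W * (4 * r * M) := Nat.mul_le_mul_left _ hM1
      have h4 : W * (4 * r * M) = 4 * r * (n + 1) := by rw [← hn]; ring
      have h5 : 1 ≤ n := by omega
      nlinarith
    have : (W : ℝ) * N ≤ 8 * r * n := by exact_mod_cast h2
    linarith
  have h2 : (W : ℝ) * N / (16 * r * (A + 1) * l) ≤ n.primeCounting := by
    refine le_trans ?_ hpi
    calc (W : ℝ) * N / (16 * r * (A + 1) * l) = W * N / (8 * r) / (2 * ((A + 1) * l)) := by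
          rw [div_div]
          congr 1
          ring
      _ ≤ n / (2 * Real.log n) := by gcongr
  have h3 : (W : ℝ) + R ≤ W * N / (32 * r * (A + 1) * l) := by
    rw [le_div_iff₀ (by positivity)]
    have h4 : 64 * r * (A + 1) * l ≤ R := by
      rw [div_mul_eq_mul_div, one_mul, le_div_iff₀ (by positivity)] at hRlog
      linarith
    have h5 : (R : ℝ) * R ≤ W * N := by
      have : R * R ≤ W * N := hNR.trans (Nat.le_mul_of_pos_left _ hW0)
      exact_mod_cast this
    have h6 : (W : ℝ) ≤ R := by exact_mod_cast hRW
    have h7 : 0 ≤ 32 * r * (A + 1) * l := by positivity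
    nlinarith
  have h4 : (W : ℝ) * N / (16 * r * (A + 1) * l) = 2 * (W * N / (32 * r * (A + 1) * l)) := by
    field_simp
    ring
  have h5 : (W : ℝ) * N / (32 * r * (A + 1) * l) ≤ W.totient * S := by linarith
  have h6 : l * W.totient ≤ selH {p ∈ Ioc w R | p.Prime} R * W := by
    refine le_trans ?_ (log_mul_totient_le w R)
    have : l ≤ Real.log (R + 1) := Real.log_le_log (by linarith) (by linarith)
    gcongr
  have h7 : (W : ℝ) * (1 / (32 * r * (A + 1)) * N) ≤ W * (selH {p ∈ Ioc w R | p.Prime} R * S) := by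
    calc (W : ℝ) * (1 / (32 * r * (A + 1)) * N) = l * (W * N / (32 * r * (A + 1) * l)) := by
          field_simp
      _ ≤ l * (W.totient * S) := by gcongr
      _ = l * W.totient * S := by ring
      _ ≤ selH {p ∈ Ioc w R | p.Prime} R * W * S := by gcongr
      _ = W * (selH {p ∈ Ioc w R | p.Prime} R * S) := by ring
  exact le_of_mul_le_mul_left h7 hW0'

end Progression

end PrimeProduct

namespace PrimeProduct

open Finset Function
open scoped BigOperators

section Box

variable {X : Type} [Fintype X] [Nonempty X]

lemma expect_pow_le {Y : Type} [Fintype Y] [Nonempty Y] (f : Y → ℝ) (hf : ∀ y, 0 ≤ f y) (n : ℕ) :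
    (𝔼 y, f y) ^ n ≤ 𝔼 y, f y ^ n := by
  have h := Real.pow_arith_mean_le_arith_mean_pow univ (fun _ : Y => (Fintype.card Y : ℝ)⁻¹) f
    (fun _ _ => by positivity) (by simp) (fun y _ => hf y) n
  rw [Fintype.expect_eq_sum_div_card, Fintype.expect_eq_sum_div_card, div_eq_inv_mul,
    div_eq_inv_mul, mul_sum, mul_sum]
  exact h

lemma expect_fin_succ {r : ℕ} {Y : Type} [Fintype Y] (f : (Fin (r + 1) → Y) → ℝ) :
    𝔼 x, f x = 𝔼 a : Y, 𝔼 x : Fin r → Y, f (Fin.cons a x) := by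
  rw [← expect_prod_univ (f := fun p : Y × (Fin r → Y) => f (Fin.cons p.1 p.2))]
  exact (Fintype.expect_equiv (Fin.consEquiv fun _ => Y) _ _ fun _ => rfl).symm

lemma expect_pow_univ {Y : Type} [Fintype Y] (f : Y → ℝ) (n : ℕ) :
    (𝔼 y, f y) ^ n = 𝔼 z : Fin n → Y, ∏ i, f (z i) := by
  rw [expect_pow, Fintype.piFinset_univ]

/-- The box inequality for functions of several variables. -/
theorem pow_expect_le_expect_box (n : ℕ) : ∀ (r : ℕ) (F : (Fin r → X) → ℝ), (∀ x, 0 ≤ F x) →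
    (𝔼 x, F x) ^ n ^ r ≤
      𝔼 y : Fin r → Fin n → X, ∏ s : Fin r → Fin n, F fun c => y c (s c) := by
  intro r
  induction r with
  | zero =>
    intro F _
    refine le_of_eq ?_
    simp only [pow_zero, pow_one]
    have h1 : ∀ x : Fin 0 → X, F x = F default := fun x => congrArg F (Subsingleton.elim _ _)
    simp only [h1, Fintype.prod_unique]
    rw [expect_const univ_nonempty, expect_const univ_nonempty]
  | succ r ih =>
    intro F hF
    rw [expect_fin_succ, expect_comm, pow_succ', pow_mul]
    calc ((𝔼 x : Fin r → X, 𝔼 a, F (Fin.cons a x)) ^ n) ^ n ^ r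
        ≤ (𝔼 x : Fin r → X, (𝔼 a, F (Fin.cons a x)) ^ n) ^ n ^ r := by
          refine pow_le_pow_left₀ (pow_nonneg (expect_nonneg fun _ _ => expect_nonneg
            fun _ _ => hF _) _) (expect_pow_le _ (fun _ => expect_nonneg fun _ _ => hF _) _) _
      _ = (𝔼 z : Fin n → X, 𝔼 x : Fin r → X, ∏ i, F (Fin.cons (z i) x)) ^ n ^ r := by
        rw [expect_comm]
        simp only [expect_pow_univ]
      _ ≤ 𝔼 z : Fin n → X, (𝔼 x : Fin r → X, ∏ i, F (Fin.cons (z i) x)) ^ n ^ r :=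
        expect_pow_le _ (fun _ => expect_nonneg fun _ _ => prod_nonneg fun _ _ => hF _) _
      _ ≤ 𝔼 z : Fin n → X, 𝔼 y : Fin r → Fin n → X, ∏ s : Fin r → Fin n, ∏ i,
          F (Fin.cons (z i) fun c => y c (s c)) :=
        expect_le_expect fun z _ => ih _ fun x => prod_nonneg fun _ _ => hF _
      _ = 𝔼 y : Fin (r + 1) → Fin n → X, ∏ s : Fin (r + 1) → Fin n, F fun c => y c (s c) := by
        rw [expect_fin_succ]
        refine expect_congr rfl fun z _ => expect_congr rfl fun y _ => ?_
        rw [prod_comm, ← Fintype.prod_prod_type']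
        refine Fintype.prod_equiv (Fin.consEquiv fun _ => Fin n) _ _ fun p => ?_
        congr 1
        funext c
        refine Fin.cases ?_ (fun c => ?_) c <;> simp [Fin.consEquiv]

open Classical in
lemma expect_not_injective_le (r n : ℕ) :
    𝔼 y : Fin r → Fin n → X, (if ∀ c, Injective (y c) then (0 : ℝ) else 1) ≤
      r * n ^ 2 / Fintype.card X := by
  have h1 : ∀ y : Fin r → Fin n → X, (if ∀ c, Injective (y c) then (0 : ℝ) else 1) ≤
      ∑ c : Fin r, ∑ i : Fin n, ∑ j : Fin n, if i ≠ j ∧ y c i = y c j then (1 : ℝ) else 0 := by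
    intro y
    split_ifs with h
    · exact sum_nonneg fun _ _ => sum_nonneg fun _ _ => sum_nonneg fun _ _ => by split_ifs <;> simp
    · push Not at h
      obtain ⟨c, hc⟩ := h
      rw [Injective] at hc
      push Not at hc
      obtain ⟨i, j, h1, h2⟩ := hc
      have h3 : (1 : ℝ) ≤ if i ≠ j ∧ y c i = y c j then (1 : ℝ) else 0 := by rw [if_pos ⟨h2, h1⟩]
      refine h3.trans ?_
      have h0 : ∀ c i j, (0 : ℝ) ≤ if i ≠ j ∧ y c i = y c j then (1 : ℝ) else 0 := fun _ _ _ => by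
        split_ifs <;> simp
      refine (single_le_sum (f := fun j => if i ≠ j ∧ y c i = y c j then (1 : ℝ) else 0)
        (fun j _ => h0 c i j) (mem_univ j)).trans ?_
      refine (single_le_sum (f := fun i => ∑ j, if i ≠ j ∧ y c i = y c j then (1 : ℝ) else 0)
        (fun i _ => sum_nonneg fun j _ => h0 c i j) (mem_univ i)).trans ?_
      exact single_le_sum (f := fun c => ∑ i, ∑ j, if i ≠ j ∧ y c i = y c j then (1 : ℝ) else 0)
        (fun c _ => sum_nonneg fun i _ => sum_nonneg fun j _ => h0 c i j) (mem_univ c)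
  have h2 : ∀ (c : Fin r) (i j : Fin n), 𝔼 y : Fin r → Fin n → X,
      (if i ≠ j ∧ y c i = y c j then (1 : ℝ) else 0) ≤ (Fintype.card X : ℝ)⁻¹ := by
    intro c i j
    by_cases hij : i = j
    · simp [hij]
    · rw [← expect_update (fun y : Fin r → Fin n → X =>
        if i ≠ j ∧ y c i = y c j then (1 : ℝ) else 0) c]
      have h3 : ∀ z : Fin n → X, 𝔼 u : X, (if update z i u i = update z i u j then (1 : ℝ) else 0) =
          (Fintype.card X : ℝ)⁻¹ := by
        intro z
        rw [Fintype.expect_eq_sum_div_card]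
        simp [Ne.symm hij]
      refine le_of_eq ?_
      simp only [update_self, ne_eq, hij, not_false_eq_true, true_and]
      simp only [expect_const univ_nonempty]
      rw [← expect_update (fun z : Fin n → X => if z i = z j then (1 : ℝ) else 0) i, expect_comm]
      simp only [h3]
      rw [expect_const univ_nonempty]
  calc 𝔼 y : Fin r → Fin n → X, (if ∀ c, Injective (y c) then (0 : ℝ) else 1)
      ≤ 𝔼 y : Fin r → Fin n → X, ∑ c : Fin r, ∑ i : Fin n, ∑ j : Fin n,
          if i ≠ j ∧ y c i = y c j then (1 : ℝ) else 0 := expect_le_expect fun y _ => h1 y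
    _ = ∑ c : Fin r, ∑ i : Fin n, ∑ j : Fin n, 𝔼 y : Fin r → Fin n → X,
          if i ≠ j ∧ y c i = y c j then (1 : ℝ) else 0 := by
      simp only [expect_sum_comm]
    _ ≤ ∑ _c : Fin r, ∑ _i : Fin n, ∑ _j : Fin n, (Fintype.card X : ℝ)⁻¹ :=
      sum_le_sum fun c _ => sum_le_sum fun i _ => sum_le_sum fun j _ => h2 c i j
    _ = r * n ^ 2 / Fintype.card X := by
      simp
      ring

/-- A sufficiently dense family of tuples contains a complete box with distinct entries. -/
theorem exists_box {r n : ℕ} (T : (Fin r → X) → Prop) [DecidablePred T]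
    (h : (r : ℝ) * n ^ 2 / Fintype.card X < (𝔼 x, if T x then (1 : ℝ) else 0) ^ n ^ r) :
    ∃ y : Fin r → Fin n → X, (∀ c, Injective (y c)) ∧ ∀ s : Fin r → Fin n, T fun c => y c (s c) := by
  classical
  by_contra! hc
  have h1 := pow_expect_le_expect_box n r (fun x : Fin r → X => if T x then (1 : ℝ) else 0)
    fun x => by split_ifs <;> simp
  have h2 : ∀ y : Fin r → Fin n → X, ∏ s : Fin r → Fin n, (if T fun c => y c (s c) then (1 : ℝ)
      else 0) ≤ if ∀ c, Injective (y c) then (0 : ℝ) else 1 := by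
    intro y
    split_ifs with hy
    · obtain ⟨s, hs⟩ := hc y hy
      rw [prod_eq_zero (mem_univ s) (if_neg hs)]
    · exact prod_le_one (fun s _ => by split_ifs <;> simp) fun s _ => by split_ifs <;> simp
  have h3 := expect_not_injective_le (X := X) r n
  have h4 : 𝔼 y : Fin r → Fin n → X, ∏ s : Fin r → Fin n, (if T fun c => y c (s c) then (1 : ℝ)
      else 0) ≤ 𝔼 y : Fin r → Fin n → X, (if ∀ c, Injective (y c) then (0 : ℝ) else 1) :=
    expect_le_expect fun y _ => h2 y
  linarith

end Box

end PrimeProduct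

namespace PrimeProduct

open Finset Function
open scoped BigOperators Classical

section Assembly

lemma selNu_nonneg {P : Finset ℕ} {R : ℕ} (hP : ∀ p ∈ P, 2 ≤ p) (hR : 1 ≤ R) (z : ℤ) :
    0 ≤ selNu P R z :=
  mul_nonneg (zero_le_one.trans (one_le_selH hP hR)) (sq_nonneg _)

lemma selNu_of_prime {P : Finset ℕ} {R : ℕ} (hP : ∀ p ∈ P, 2 ≤ p ∧ p ≤ R) (hR : 1 ≤ R) {z : ℤ}
    (hz : z.natAbs.Prime) (hzR : R < z.natAbs) : selNu P R z = selH P R := by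
  have h1 : selL P R z = selW P R ∅ * 1 := by
    rw [selL, sum_eq_single_of_mem ∅ (empty_mem_fam hR)]
    · simp
    · intro D hD hD0
      obtain ⟨p, hp⟩ := nonempty_iff_ne_empty.2 hD0
      have hpP := hP p (subset_of_mem_fam hD hp)
      rw [if_neg, mul_zero]
      intro h
      have h2 : p ∣ z.natAbs := Int.natCast_dvd.1 (h p hp)
      rcases (Nat.dvd_prime hz).1 h2 with h3 | h3 <;> omega
  rw [selNu, h1, selW_empty (fun p hp => (hP p hp).1) hR]
  ring

lemma card_mul_le_of_relations {r N : ℕ} [NeZero N] {E : Finset (Fin r × Fin r)}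
    (hE : Ordered E) {S : Finset ℕ} (hS : S ⊆ range (N / (2 * r))) {κ η : ℝ}
    {f : Fin r × Fin r → Fin N → Fin N → ℝ} (hf0 : ∀ e ∈ E, ∀ x y, 0 ≤ f e x y)
    (hf : ∀ e ∈ E, ∀ u ∈ S, ∀ x y : Fin N, (y : ℤ) - (x : ℤ) = (((e.2 : ℕ) : ℤ) - (e.1 : ℕ)) * u →
      f e x y = κ)
    {Q : Fin r × Fin r → Fin N → Fin N → Prop}
    (hQ : ∀ e ∈ E, 𝔼 x, 𝔼 y, f e x y * (if Q e x y then 1 else 0) ≤ η)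
    (hcov : ∀ x : Fin r → Fin N, ∃ e ∈ E, Q e (x e.1) (x e.2)) :
    κ * #S * (N / 2 : ℕ) ≤ #E * (η * (N : ℝ) ^ 2) := by
  set g : Fin r × Fin r → Fin N → Fin N → ℝ := fun e x y => f e x y * (if Q e x y then 1 else 0)
    with hg
  have hg0 : ∀ e ∈ E, ∀ x y, 0 ≤ g e x y := fun e he x y =>
    mul_nonneg (hf0 e he x y) (by split_ifs <;> simp)
  set L : ℕ × ℕ → Fin r → Fin N := fun p c => Fin.ofNat N (p.1 + c * p.2) with hL
  have hLv : ∀ p ∈ range (N / 2) ×ˢ S, ∀ c, (L p c : ℕ) = p.1 + c * p.2 := by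
    intro p hp c
    obtain ⟨h1, h2⟩ := mem_product.1 hp
    have h1 := mem_range.1 h1
    have h2 := mem_range.1 (hS h2)
    have h3 : (c : ℕ) * p.2 ≤ r * (N / (2 * r)) := Nat.mul_le_mul c.2.le h2.le
    have h4 : r * (N / (2 * r)) ≤ N / 2 := by
      rw [← Nat.div_div_eq_div_mul]
      exact Nat.mul_div_le _ _
    have h5 : p.1 + c * p.2 < N := by omega
    exact Nat.mod_eq_of_lt h5
  have h1 : ∀ e ∈ E, ∑ p ∈ range (N / 2) ×ˢ S, g e (L p e.1) (L p e.2) ≤ η * (N : ℝ) ^ 2 := by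
    intro e he
    have hlt := hE e he
    have h2 : ∑ p ∈ range (N / 2) ×ˢ S, g e (L p e.1) (L p e.2) ≤
        ∑ q : Fin N × Fin N, g e q.1 q.2 := by
      rw [← sum_image (s := range (N / 2) ×ˢ S) (g := fun p => (L p e.1, L p e.2))
        (f := fun q : Fin N × Fin N => g e q.1 q.2)]
      · exact sum_le_sum_of_subset_of_nonneg (subset_univ _) fun q _ _ => hg0 e he _ _
      · intro p hp q hq hpq
        have h3 := congrArg (fun z => (z.1 : ℕ)) hpq
        have h4 := congrArg (fun z => (z.2 : ℕ)) hpq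
        simp only [hLv p hp, hLv q hq] at h3 h4
        obtain ⟨d, hd⟩ : ∃ d, (e.2 : ℕ) = e.1 + (d + 1) := ⟨e.2 - e.1 - 1, by
          have : (e.1 : ℕ) < e.2 := hlt
          omega⟩
        have h5 : (d + 1) * p.2 = (d + 1) * q.2 := by
          rw [hd, add_mul (e.1 : ℕ) (d + 1) p.2, add_mul (e.1 : ℕ) (d + 1) q.2] at h4
          omega
        have h6 := Nat.eq_of_mul_eq_mul_left (Nat.succ_pos d) h5
        rw [h6] at h3
        exact Prod.ext (by omega) h6
    have h3 := hQ e he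
    have hN : (0 : ℝ) < N := by exact_mod_cast NeZero.pos N
    simp only [Fintype.expect_eq_sum_div_card, Fintype.card_fin] at h3
    rw [← sum_div, div_div, div_le_iff₀ (by positivity)] at h3
    rw [Fintype.sum_prod_type] at h2
    refine h2.trans (h3.trans (le_of_eq ?_))
    ring
  calc κ * #S * (N / 2 : ℕ) = ∑ p ∈ range (N / 2) ×ˢ S, κ := by
        rw [sum_const, card_product, card_range, nsmul_eq_mul]
        push_cast
        ring
    _ ≤ ∑ p ∈ range (N / 2) ×ˢ S, ∑ e ∈ E, g e (L p e.1) (L p e.2) := by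
      refine sum_le_sum fun p hp => ?_
      obtain ⟨e, he, hQe⟩ := hcov (L p)
      refine le_trans (le_of_eq ?_) (single_le_sum (fun e he => hg0 e he _ _) he)
      rw [hg]
      dsimp only
      rw [if_pos hQe, mul_one, hf e he p.2 (mem_product.1 hp).2]
      rw [hLv p hp, hLv p hp]
      push_cast
      ring
    _ = ∑ e ∈ E, ∑ p ∈ range (N / 2) ×ˢ S, g e (L p e.1) (L p e.2) := sum_comm
    _ ≤ ∑ e ∈ E, η * (N : ℝ) ^ 2 := sum_le_sum h1
    _ = #E * (η * (N : ℝ) ^ 2) := by rw [sum_const, nsmul_eq_mul]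

lemma weight_lt_of_density {δ N M t e : ℝ} (hδ : 0 < δ) (hN : 0 < N) (hM : N ≤ 4 * M)
    (he : 0 ≤ e) (ht : δ * N ≤ t) : e * (δ / (16 * (e + 1)) * N ^ 2) < t * M := by
  have h1 : e / (e + 1) ≤ 1 := div_le_one_of_le₀ (by linarith) (by positivity)
  have h2 : 0 < δ * N * N := by positivity
  have h3 : 0 ≤ M := by linarith
  calc e * (δ / (16 * (e + 1)) * N ^ 2) = e / (e + 1) * (δ * N * N / 16) := by
        field_simp
    _ ≤ 1 * (δ * N * N / 16) := by gcongr
    _ < δ * N * N / 4 := by linarith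
    _ ≤ δ * N * (4 * M) / 4 := by gcongr
    _ = δ * N * M := by ring
    _ ≤ t * M := by gcongr

/-- There are arbitrarily large multipartite configurations all of whose normalised cross
differences are primes. -/
theorem exists_prime_box {r : ℕ} (hr : 2 ≤ r) (n : ℕ) :
    ∃ w : ℕ, r ≤ w ∧ ∃ (b N : ℕ) (y : Fin r → Fin n → Fin N), (∀ c, Injective (y c)) ∧
      ∀ c c' : Fin r, c < c' → ∀ i j, ((b : ℤ) - ((w.factorial ^ 2 / (c' - c : ℕ) : ℕ) : ℤ) *
        ((y c i : ℕ) - (y c' j : ℕ))).natAbs.Prime := by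
  have : Nontrivial (Fin r) := Fin.nontrivial_iff_two_le.2 hr
  have : Nonempty (Fin r) := ⟨⟨0, by omega⟩⟩
  set E : Finset (Fin r × Fin r) := univ.filter fun e => e.1 < e.2 with hEdef
  have hmem : ∀ c c' : Fin r, c < c' → (c, c') ∈ E := fun c c' h => mem_filter.2 ⟨mem_univ _, h⟩
  have hE : Ordered E := fun e he => (mem_filter.1 he).2
  have hcov : ∀ i, ∃ e ∈ E, e.1 = i ∨ e.2 = i := by
    intro i
    obtain ⟨j, hj⟩ := exists_ne i
    rcases lt_or_gt_of_ne hj with h | h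
    · exact ⟨_, hmem _ _ h, Or.inr rfl⟩
    · exact ⟨_, hmem _ _ h, Or.inl rfl⟩
  set K := Fintype.card ((Fin r × Fin r) × Bool × Bool) with hK
  set A := 7 * K + 1 + (#E * n ^ r + 2) with hA
  set δ₀ : ℝ := 1 / (32 * r * (A + 1)) with hδ₀
  have hr0 : (0 : ℝ) < r := by exact_mod_cast (by omega)
  have hδ₀0 : 0 < δ₀ := by positivity
  obtain ⟨c, hc, δ, hδ, N₀, hrem⟩ := sparse_removal hE hcov (η := δ₀ / (16 * (#E + 1)))
    (by positivity)
  obtain ⟨w₀, R₀, hlfc⟩ := exists_lfc_selNu hE (A := A) (by omega) hδ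
  set w := w₀ + r with hw
  obtain ⟨R₁, hprog⟩ := exists_dense_progression (r := r) (A := A) (by omega) (by omega) w
  set B : ℝ := r * n ^ 2 / c ^ n ^ r with hB
  set R := R₀ + R₁ + N₀ + 2 + ⌈B⌉₊ with hR
  have hR2 : 2 ≤ R := by omega
  have hR2' : (2 : ℝ) ≤ R := by exact_mod_cast hR2
  obtain ⟨b, hb, hdens⟩ := hprog R (by omega)
  set W := w.factorial ^ 2 with hW
  set N := R ^ A with hN
  have hNR : R ≤ N := Nat.le_self_pow (by omega) R
  have : NeZero N := ⟨by omega⟩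
  set P : Finset ℕ := {p ∈ Ioc w R | p.Prime} with hP
  set m : Fin r × Fin r → ℤ := fun e => -((W / (e.2 - e.1 : ℕ) : ℕ) : ℤ) with hm
  have hPp : ∀ p ∈ P, p.Prime ∧ w < p :=
    fun p hp => ⟨(mem_filter.1 hp).2, (mem_Ioc.1 (mem_filter.1 hp).1).1⟩
  have hP2 : ∀ p ∈ P, 2 ≤ p := fun p hp => (hPp p hp).1.two_le
  have hdvd : ∀ e ∈ E, (e.2 - e.1 : ℕ) ∣ W := by
    intro e he
    have h1 : (e.1 : ℕ) < e.2 := hE e he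
    have h2 := e.2.2
    exact (Nat.dvd_factorial (by omega) (by omega)).trans (dvd_pow_self _ two_ne_zero)
  have hmp : ∀ p ∈ P, ∀ e ∈ E, ((m e : ℤ) : ZMod p) ≠ 0 := by
    intro p hp e he h
    rw [hm, Int.cast_neg, neg_eq_zero, Int.cast_natCast, ZMod.natCast_eq_zero_iff] at h
    have h1 := (hPp p hp).1.dvd_of_dvd_pow (h.trans (Nat.div_dvd_of_dvd (hdvd e he)))
    have := ((hPp p hp).1.dvd_factorial).1 h1
    have := (hPp p hp).2
    omega
  have hL := hlfc w (by omega) R (by omega) P hPp (b : ℤ) m hmp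
  set z : Fin r × Fin r → Fin N → Fin N → ℤ :=
    fun e x y => (b : ℤ) + m e * (((x : ℕ) : ℤ) - ((y : ℕ) : ℤ)) with hz
  set H := selH P R with hH
  have hH1 : 1 ≤ H := one_le_selH hP2 (by omega)
  have hHR : H ≤ R := selH_le fun p hp => (hPp p hp).1
  set f : Fin r × Fin r → Fin N → Fin N → ℝ := fun e x y =>
    if (z e x y).natAbs.Prime ∧ R < (z e x y).natAbs then H else 0 with hf
  have hf0 : ∀ e ∈ E, ∀ x y, 0 ≤ f e x y := fun e _ x y => by
    rw [hf]
    dsimp only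
    split_ifs <;> linarith
  have hfν : ∀ e ∈ E, ∀ x y, 0 ≤ f e x y ∧ f e x y ≤ selNu P R (z e x y) := by
    refine fun e he x y => ⟨hf0 e he x y, ?_⟩
    rw [hf]
    dsimp only
    split_ifs with h
    · exact (selNu_of_prime (fun p hp => ⟨hP2 p hp, (mem_Ioc.1 (mem_filter.1 hp).1).2⟩)
        (by omega) h.1 h.2).ge
    · exact selNu_nonneg hP2 (by omega) _
  have hN0 : (0 : ℝ) < N := by exact_mod_cast NeZero.pos N
  rcases hrem (Fin N) (by rw [Fintype.card_fin]; omega) (by rw [Fintype.card_fin]; omega) _ f hfν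
    hL with h | ⟨Q, hQ1, hQ2⟩
  · set T : (Fin r → Fin N) → Prop := fun x => ∀ e ∈ E, (z e (x e.1) (x e.2)).natAbs.Prime with hT
    have h1 : ∀ x, prodOn f E x ≤ R ^ #E * if T x then (1 : ℝ) else 0 := by
      intro x
      split_ifs with hx
      · rw [mul_one, prodOn, ← prod_const]
        refine prod_le_prod (fun e he => hf0 e he _ _) fun e he => ?_
        rw [hf]
        dsimp only
        split_ifs <;> linarith
      · rw [hT] at hx
        push Not at hx
        obtain ⟨e, he, hx⟩ := hx
        rw [mul_zero, prodOn, prod_eq_zero he]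
        exact if_neg fun h => hx h.1
    have h2 : c ≤ R ^ #E * 𝔼 x, if T x then (1 : ℝ) else 0 := by
      rw [mul_expect]
      exact h.trans (expect_le_expect fun x _ => h1 x)
    have h3 : c / R ^ #E ≤ 𝔼 x, if T x then (1 : ℝ) else 0 := by
      rw [div_le_iff₀ (by positivity)]
      linarith
    obtain ⟨y, hy1, hy2⟩ := exists_box (n := n) T (by
      rw [Fintype.card_fin]
      refine lt_of_lt_of_le ?_ (pow_le_pow_left₀ (by positivity) h3 _)
      rw [div_pow, ← pow_mul, div_lt_div_iff₀ hN0 (by positivity)]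
      have hBR : B < R := lt_of_le_of_lt (Nat.le_ceil B) (by exact_mod_cast (by omega))
      rw [hB, div_lt_iff₀ (by positivity)] at hBR
      calc (r : ℝ) * n ^ 2 * R ^ (#E * n ^ r) < R * c ^ n ^ r * R ^ (#E * n ^ r) := by gcongr
        _ = c ^ n ^ r * R ^ (#E * n ^ r + 1) := by ring
        _ ≤ c ^ n ^ r * N := by
          rw [hN, Nat.cast_pow]
          gcongr
          · linarith
          · omega)
    refine ⟨w, by omega, b, N, y, hy1, fun c c' hcc i j => ?_⟩
    have h4 := hy2 (fun d => if d = c then i else j) (c, c') (hmem c c' hcc)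
    simp only [hz, hm, if_pos, if_neg hcc.ne'] at h4
    rwa [neg_mul, ← sub_eq_add_neg] at h4
  · exfalso
    have h1 := card_mul_le_of_relations hE (filter_subset _ _) hf0 (κ := H)
      (S := {u ∈ range (N / (2 * r)) | (b + W * u).Prime ∧ R < b + W * u})
      (fun e he u hu x y hxy => by
        have h2 : z e x y = ((b + W * u : ℕ) : ℤ) := by
          have h3 : (e.1 : ℕ) < e.2 := hE e he
          have h4 : ((W / (e.2 - e.1 : ℕ) : ℕ) : ℤ) * (((e.2 : ℕ) : ℤ) - (e.1 : ℕ)) = W := by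
            rw [← Nat.cast_sub h3.le]
            exact_mod_cast Nat.div_mul_cancel (hdvd e he)
          rw [hz, hm]
          dsimp only
          rw [Nat.cast_add, Nat.cast_mul]
          linear_combination ((W / (e.2 - e.1 : ℕ) : ℕ) : ℤ) * hxy + (u : ℤ) * h4
        rw [hf]
        dsimp only
        rw [h2, Int.natAbs_natCast]
        exact if_pos (mem_filter.1 hu).2) hQ1 hQ2
    have h2 : (N : ℝ) ≤ 4 * (N / 2 : ℕ) := by exact_mod_cast (by omega)
    exact (weight_lt_of_density hδ₀0 hN0 h2 (Nat.cast_nonneg _) hdens).not_ge h1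

end Assembly

end PrimeProduct

namespace PrimeProduct

open Finset Function
open scoped BigOperators

section Labelings

lemma pow_length_primeFactorsList_le {n : ℕ} (hn : n ≠ 0) :
    2 ^ n.primeFactorsList.length ≤ n := by
  conv_rhs => rw [← Nat.prod_primeFactorsList hn]
  exact List.pow_card_le_prod _ _ fun p hp => (Nat.prime_of_mem_primeFactorsList hp).two_le

lemma le_length_primeFactorsList_of_pow_dvd {j n : ℕ} (hn : n ≠ 0) (h : 2 ^ j ∣ n) :
    j ≤ n.primeFactorsList.length := by
  have h1 := (Nat.primeFactorsList_sublist_of_dvd h hn).length_le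
  rwa [Nat.Prime.primeFactorsList_pow Nat.prime_two, List.length_replicate] at h1

/-- Colouring the vertices by their labels modulo a power of two. -/
lemma colorable_of_isPrimeProductGraph {V : Type*} {G : SimpleGraph V} {j : ℕ}
    (h : IsPrimeProductGraph G j) : G.Colorable (2 ^ (j + 1)) := by
  obtain ⟨L, -, h1, h2⟩ := h
  have : NeZero (2 ^ (j + 1)) := ⟨by positivity⟩
  let C : G.Coloring (ZMod (2 ^ (j + 1))) := SimpleGraph.Coloring.mk (fun v => (L v : ZMod _)) (by
    intro u v huv heq
    have h3 := h1 u v huv.ne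
    have h4 : (L u - L v).natAbs ≠ 0 := by
      rw [Int.natAbs_ne_zero]
      intro h5
      rw [h5] at h3
      norm_num at h3
    have h5 : ((2 ^ (j + 1) : ℕ) : ℤ) ∣ L u - L v := by
      rw [← ZMod.intCast_zmod_eq_zero_iff_dvd, Int.cast_sub, sub_eq_zero]
      exact heq
    have h6 := le_length_primeFactorsList_of_pow_dvd h4 (Int.natCast_dvd.1 h5)
    have h7 := h2 u v huv
    omega)
  have h3 := C.colorable
  rwa [ZMod.card] at h3

/-- Graphs colourable with `2 ^ m` colours are `m`-prime product graphs. -/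
lemma isPrimeProductGraph_of_colorable {V : Type*} [Fintype V] {G : SimpleGraph V} {m : ℕ}
    (hm : 0 < m) (h : G.Colorable (2 ^ m)) : IsPrimeProductGraph G m := by
  obtain ⟨C⟩ := h
  obtain ⟨w, hw, b, N, y, hy, hp⟩ := exists_prime_box
    (Nat.le_self_pow hm.ne' 2 : 2 ≤ 2 ^ m) (Fintype.card V)
  set W := w.factorial ^ 2 with hW
  let i := Fintype.equivFin V
  let L : V → ℤ := fun v => ((C v : ℕ) : ℤ) * b + W * ((y (C v) (i v) : ℕ) : ℤ)
  have hlt : ∀ u v, C u < C v → ∃ t p : ℕ, 0 < t ∧ t < 2 ^ m ∧ p.Prime ∧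
      (L u - L v).natAbs = t * p := by
    intro u v huv
    have h1 : (C u : ℕ) < C v := huv
    have h2 := (C v).2
    refine ⟨C v - C u, _, by omega, by omega, hp _ _ huv (i u) (i v), ?_⟩
    have h3 : (C v - C u : ℕ) ∣ W :=
      (Nat.dvd_factorial (by omega) (by omega)).trans (dvd_pow_self _ two_ne_zero)
    have h4 : ((W / (C v - C u : ℕ) : ℕ) : ℤ) * (((C v : ℕ) : ℤ) - (C u : ℕ)) = W := by
      rw [← Nat.cast_sub h1.le]
      exact_mod_cast Nat.div_mul_cancel h3
    have h5 : -(L u - L v) = ((C v - C u : ℕ) : ℤ) * ((b : ℤ) - ((W / (C v - C u : ℕ) : ℕ) : ℤ) *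
        ((y (C u) (i u) : ℕ) - (y (C v) (i v) : ℕ))) := by
      rw [Nat.cast_sub h1.le]
      simp only [L]
      linear_combination (((y (C u) (i u) : ℕ) : ℤ) - (y (C v) (i v) : ℕ)) * h4
    rw [← Int.natAbs_neg, h5, Int.natAbs_mul, Int.natAbs_natCast]
  have hne : ∀ u v, C u ≠ C v → ∃ t p : ℕ, 0 < t ∧ t < 2 ^ m ∧ p.Prime ∧
      (L u - L v).natAbs = t * p := by
    intro u v huv
    rcases lt_or_gt_of_ne huv with h | h
    · exact hlt u v h
    · obtain ⟨t, p, h1, h2, h3, h4⟩ := hlt v u h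
      exact ⟨t, p, h1, h2, h3, by rw [← h4, ← Int.natAbs_neg, neg_sub]⟩
  have hgap : ∀ u v : V, u ≠ v → 1 < |L u - L v| := by
    intro u v huv
    by_cases hC : C u = C v
    · have h1 : ((y (C u) (i u) : ℕ) : ℤ) ≠ (y (C v) (i v) : ℕ) := by
        rw [hC]
        exact fun h => huv (i.injective (hy _ (Fin.ext (by exact_mod_cast h))))
      have h2 : L u - L v = W * (((y (C u) (i u) : ℕ) : ℤ) - (y (C v) (i v) : ℕ)) := by
        simp only [L, hC]
        ring
      have h3 : (2 : ℤ) ≤ W := by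
        have h4 : 2 ≤ w := (Nat.le_self_pow hm.ne' 2).trans hw
        have h5 := h4.trans (Nat.self_le_factorial w)
        exact_mod_cast h5.trans (Nat.le_self_pow two_ne_zero _)
      have h4 := Int.one_le_abs (sub_ne_zero.2 h1)
      rw [h2, abs_mul, abs_of_nonneg (by omega)]
      nlinarith
    · obtain ⟨t, p, h1, -, h3, h4⟩ := hne u v hC
      rw [Int.abs_eq_natAbs, h4]
      have := h3.two_le
      have : 1 < t * p := by nlinarith
      exact_mod_cast this
  refine ⟨L, fun u v huv => ?_, hgap, fun u v huv => ?_⟩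
  · by_contra hne'
    have := hgap u v hne'
    rw [huv, sub_self] at this
    norm_num at this
  · obtain ⟨t, p, h1, h2, h3, h4⟩ := hne u v (C.valid huv)
    rw [h4, (Nat.perm_primeFactorsList_mul h1.ne' h3.ne_zero).length_eq, List.length_append,
      Nat.primeFactorsList_prime h3, List.length_singleton]
    have h5 := (Nat.pow_lt_pow_iff_right one_lt_two).1
      ((pow_length_primeFactorsList_le h1.ne').trans_lt h2)
    omega

end Labelings

end PrimeProduct

/-- For a nonempty `k`-chromatic finite graph `G`, the prime product number of `G`
is `⌈log₂ k⌉ - 1` or `⌈log₂ k⌉`. -/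
theorem ppn_of_chromatic {V : Type*} [Fintype V] (G : SimpleGraph V) (k : ℕ)
    (hne : ∃ u v : V, G.Adj u v) (hchrom : G.chromaticNumber = k) :
    ppn G = Nat.clog 2 k - 1 ∨ ppn G = Nat.clog 2 k := by
  obtain ⟨u, v, huv⟩ := hne
  have hk : G.Colorable k := SimpleGraph.chromaticNumber_le_iff_colorable.1 hchrom.le
  have hk2 : 2 ≤ k := by
    have h := SimpleGraph.two_le_chromaticNumber_of_adj huv
    rw [hchrom] at h
    exact_mod_cast h
  have hm : 0 < Nat.clog 2 k := Nat.clog_pos one_lt_two hk2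
  have hmem : Nat.clog 2 k ∈ {k : ℕ | 0 < k ∧ IsPrimeProductGraph G k} :=
    ⟨hm, PrimeProduct.isPrimeProductGraph_of_colorable hm
      (hk.mono (Nat.le_pow_clog one_lt_two k))⟩
  have hle : ppn G ≤ Nat.clog 2 k := Nat.sInf_le hmem
  have hge : Nat.clog 2 k ≤ ppn G + 1 := by
    refine Nat.clog_le_of_le_pow ?_
    have h := SimpleGraph.chromaticNumber_le_iff_colorable.2
      (PrimeProduct.colorable_of_isPrimeProductGraph (Nat.sInf_mem ⟨_, hmem⟩).2)
    rw [hchrom] at h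
    exact_mod_cast h
  omega
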